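/- For all positive integers n and c₁ there exists a positive integer c₂ (depending only on n and c₁) with the following property: for every prime p, every finite field k of characteristic p, and every subgroup Γ of GL_n(k) such that (i) Γ contains no nontrivial normal subgroup of p-power order, and (ii) there is a surjective group homomorphism from Γ onto a cyclic group of order at least c₂, the center of Γ contains an element whose order is at least c₁ and coprime to p. -/

import Mathlib

section
open Matrix

/-- Commuting matrices of finite order prime to the characteristic are simultaneously
diagonalizable. -/
theorem exists_simultaneous_diagonalization {F : Type*} [Field F] [IsAlgClosed F] {n N : ℕ}
    {ι : Type*} (f : ι → Matrix (Fin n) (Fin n) F) (hcomm : ∀ i j, Commute (f i) (f j))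
    (hN : (N : F) ≠ 0) (hf : ∀ i, f i ^ N = 1) :
    ∃ (S : (Matrix (Fin n) (Fin n) F)ˣ) (d : ι → Fin n → F),
      ∀ i, f i * S = S * diagonal (d i) := by
  classical
  set T : ι → Module.End F (Fin n → F) := fun i => toLin' (f i) with hT
  have hss : ∀ i, (T i).IsSemisimple := by
    intro i
    have hsq : Squarefree (Polynomial.X ^ N - 1 : Polynomial F) := by
      have := (Polynomial.separable_X_pow_sub_C (F := F) (n := N) 1 hN one_ne_zero).squarefree
      simpa using this
    refine Module.End.isSemisimple_of_squarefree_aeval_eq_zero hsq ?_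
    have : T i ^ N = 1 := by
      simp only [hT, ← toLin'_pow, hf]; simp; rfl
    simp [this]
  have hTc : ∀ i j, Commute (T i) (T j) := by
    intro i j
    have := (hcomm i j).eq
    simp only [Commute, SemiconjBy, hT, Module.End.mul_eq_comp, ← toLin'_mul, this]
  have htop :=
    Module.End.iSup_iInf_maxGenEigenspace_eq_top_of_iSup_maxGenEigenspace_eq_top_of_commute
      T (fun i j _ => hTc i j) (fun i => Module.End.iSup_maxGenEigenspace_eq_top (T i))
  set s : Set (Fin n → F) := {v | ∃ χ : ι → F, ∀ i, T i v = χ i • v} with hs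
  have hspan : ⊤ ≤ Submodule.span F s := by
    rw [← htop]
    refine iSup_le fun χ v hv => Submodule.subset_span ⟨χ, fun i => ?_⟩
    have := (Submodule.mem_iInf _).1 hv i
    rw [(hss i).isFinitelySemisimple.maxGenEigenspace_eq_eigenspace] at this
    exact Module.End.mem_eigenspace_iff.1 this
  set b0 := Module.Basis.ofSpan hspan
  have hb0 : ∀ i, b0 i ∈ s := fun i => Module.Basis.ofSpan_subset hspan ⟨i, rfl⟩
  have : Fintype ((linearIndepOn_empty F id).extend (Set.empty_subset s)) :=
    FiniteDimensional.fintypeBasisIndex b0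
  have hcard : Fintype.card ((linearIndepOn_empty F id).extend (Set.empty_subset s)) = n := by
    rw [← Module.finrank_eq_card_basis b0]; simp
  set b := b0.reindex (Fintype.equivFinOfCardEq hcard) with hb
  have hbs : ∀ i, b i ∈ s := fun i => by rw [hb, Module.Basis.reindex_apply]; exact hb0 _
  choose χ hχ using hbs
  have hinv : Invertible ((Pi.basisFun F (Fin n)).toMatrix b) := 
    Module.Basis.invertibleToMatrix _ _
  refine ⟨unitOfInvertible ((Pi.basisFun F (Fin n)).toMatrix b), fun i j => χ j i, fun i => ?_⟩
  ext r c
  have := congrFun (hχ c i) r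
  simp only [hT, toLin'_apply, Pi.smul_apply, smul_eq_mul] at this
  simp only [val_unitOfInvertible, Matrix.mul_diagonal, Module.Basis.toMatrix_apply,
    Pi.basisFun_repr]
  rw [mul_comm, ← this]
  simp [Matrix.mul_apply, mulVec, dotProduct, Module.Basis.toMatrix_apply]

/-- Conjugation by the normalizer of an abelian semisimple group of matrices is governed by a
self-map of the index set. -/
theorem exists_normalizer_action {F : Type*} [Field F] [IsAlgClosed F] {n : ℕ} {G : Type*} [Group G]
    [Finite G] (ρ : G →* Matrix (Fin n) (Fin n) F) (hρ : Function.Injective ρ) (A : Subgroup G)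
    (hA : ∀ a ∈ A, ∀ b ∈ A, a * b = b * a) (hc : (Nat.card A : F) ≠ 0) :
    (∃ σ : G → (Fin n → Fin n), ∀ g g', (∀ a ∈ A, g * a * g⁻¹ ∈ A) → (∀ a ∈ A, g' * a * g'⁻¹ ∈ A) →
      σ g = σ g' → ∀ a ∈ A, g * a * g⁻¹ = g' * a * g'⁻¹) ∧
    ∀ m : ℕ, 0 < m → Nat.card {a : G // a ∈ A ∧ a ^ m = 1} ≤ m ^ n := by
  classical
  obtain ⟨S, d, hd⟩ := exists_simultaneous_diagonalization (N := Nat.card A) (fun a : A => ρ a)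
    (fun a b => by
      rw [Commute, SemiconjBy, ← map_mul, ← map_mul, hA a a.2 b b.2]) hc
    (fun a => by
      rw [← map_pow, ← SubgroupClass.coe_pow, pow_card_eq_one']; simp)
  have hinj : ∀ a b : A, d a = d b → a = b := by
    intro a b hab
    have h : ρ a * S = ρ b * S := by rw [hd, hd, hab]
    exact Subtype.ext (hρ (S.mul_left_inj.1 h))
  refine ⟨?_, ?_⟩
  · have key : ∀ g : G, ∃ σ : Fin n → Fin n, ∀ a b : A, (b : G) = g * a * g⁻¹ →
        ∀ i, d b i = d a (σ i) := by
      intro g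
      set M : Matrix (Fin n) (Fin n) F := (S⁻¹ : (Matrix (Fin n) (Fin n) F)ˣ) * ρ g * S with hM
      have hrow : ∀ i, ∃ j, M i j ≠ 0 := by
        intro i
        by_contra hcon
        push Not at hcon
        have hinv : M * ((S⁻¹ : (Matrix (Fin n) (Fin n) F)ˣ) * ρ g⁻¹ * S) = 1 := by
          calc M * ((S⁻¹ : (Matrix (Fin n) (Fin n) F)ˣ) * ρ g⁻¹ * S)
              = (S⁻¹ : (Matrix (Fin n) (Fin n) F)ˣ) * (ρ g * ((S : Matrix (Fin n) (Fin n) F) *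
                (S⁻¹ : (Matrix (Fin n) (Fin n) F)ˣ)) * ρ g⁻¹) * S := by
                simp only [hM, mul_assoc]
            _ = 1 := by rw [S.mul_inv, mul_one, ← map_mul, mul_inv_cancel, map_one, mul_one,
                S.inv_mul]
        have := congrFun (congrFun hinv i) i
        simp [Matrix.mul_apply, hcon] at this
      choose σ hσ using hrow
      refine ⟨σ, fun a b hb i => ?_⟩
      have h1 : diagonal (d b) * M = M * diagonal (d a) := by
        have e1 : ρ b * ρ g = ρ g * ρ a := by
          rw [← map_mul, ← map_mul, hb]; simp
        calc diagonal (d b) * M =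
            (S⁻¹ : (Matrix (Fin n) (Fin n) F)ˣ) * (S * diagonal (d b)) * M := by
              rw [← mul_assoc (S⁻¹ : (Matrix (Fin n) (Fin n) F)ˣ).1, S.inv_mul, one_mul]
          _ = (S⁻¹ : (Matrix (Fin n) (Fin n) F)ˣ) * ρ b * ((S : Matrix (Fin n) (Fin n) F) *
                (S⁻¹ : (Matrix (Fin n) (Fin n) F)ˣ)) * ρ g * S := by
              rw [← hd b, hM]; simp only [mul_assoc]
          _ = (S⁻¹ : (Matrix (Fin n) (Fin n) F)ˣ) * (ρ b * ρ g) * S := by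
              rw [S.mul_inv, mul_one]; simp only [mul_assoc]
          _ = (S⁻¹ : (Matrix (Fin n) (Fin n) F)ˣ) * ρ g * (ρ a * S) := by
              rw [e1]; simp only [mul_assoc]
          _ = M * diagonal (d a) := by rw [hd, hM]; simp only [mul_assoc]
      have h2 := congrFun (congrFun h1 i) (σ i)
      rw [diagonal_mul, mul_diagonal, mul_comm] at h2
      exact mul_left_cancel₀ (hσ i) h2
    choose σ hσ using key
    refine ⟨σ, fun g g' hg hg' hgg a ha => ?_⟩
    have : (⟨g * a * g⁻¹, hg a ha⟩ : A) = ⟨g' * a * g'⁻¹, hg' a ha⟩ := by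
      apply hinj
      funext i
      rw [hσ g ⟨a, ha⟩ ⟨g * a * g⁻¹, hg a ha⟩ rfl,
        hσ g' ⟨a, ha⟩ ⟨g' * a * g'⁻¹, hg' a ha⟩ rfl, hgg]
    exact congrArg Subtype.val this
  · intro m hm
    have hroot : ∀ (a : {a : G // a ∈ A ∧ a ^ m = 1}) (i : Fin n),
        d ⟨a.1, a.2.1⟩ i ∈ (Polynomial.nthRoots m (1 : F)).toFinset := by
      intro a i
      rw [Multiset.mem_toFinset, Polynomial.mem_nthRoots hm]
      have hpow : ∀ j : ℕ, ρ a.1 ^ j * S = S * diagonal (d ⟨a.1, a.2.1⟩) ^ j := by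
        intro j
        induction j with
        | zero => simp
        | succ j ih =>
          rw [pow_succ, mul_assoc, hd ⟨a.1, a.2.1⟩, ← mul_assoc, ih, pow_succ, mul_assoc]
      have := hpow m
      have h4 : ρ a.1 ^ m = 1 := by rw [← map_pow, a.2.2, map_one]
      rw [h4, one_mul, diagonal_pow] at this
      have h3 : (1 : Matrix (Fin n) (Fin n) F) = diagonal (d ⟨a.1, a.2.1⟩ ^ m) :=
        S.mul_right_inj.1 (by rw [mul_one]; exact this)
      have := congrFun (congrFun h3 i) i
      simpa using this.symm
    let φ : {a : G // a ∈ A ∧ a ^ m = 1} → (Fin n → (Polynomial.nthRoots m (1 : F)).toFinset) :=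
      fun a i => ⟨_, hroot a i⟩
    have hφ : Function.Injective φ := by
      intro a b hab
      have : (⟨a.1, a.2.1⟩ : A) = ⟨b.1, b.2.1⟩ := by
        apply hinj
        funext i
        exact congrArg Subtype.val (congrFun hab i)
      exact Subtype.ext (congrArg (fun x : A => (x : G)) this)
    calc Nat.card {a : G // a ∈ A ∧ a ^ m = 1}
        ≤ Nat.card (Fin n → (Polynomial.nthRoots m (1 : F)).toFinset) :=
          Nat.card_le_card_of_injective φ hφ
      _ = ((Polynomial.nthRoots m (1 : F)).toFinset.card) ^ n := by
        rw [Nat.card_fun, Nat.card_eq_fintype_card, Fintype.card_coe]; simp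
      _ ≤ m ^ n := Nat.pow_le_pow_left ((Multiset.toFinset_card_le _).trans
          (Polynomial.card_nthRoots m 1)) n

end

/-- A subgroup all of whose elements commute. -/
abbrev IsCommSubgroup {G : Type*} [Group G] (A : Subgroup G) : Prop :=
  ∀ a ∈ A, ∀ b ∈ A, a * b = b * a

/-- The consequences of an embedding into `GL_n` in characteristic `p` that concern commutative
subgroups of order prime to `p`. -/
structure IsLinearLike (p n : ℕ) (G : Type*) [Group G] : Prop where
  action : ∀ A : Subgroup G, IsCommSubgroup A → (Nat.card A).Coprime p →
    ∃ σ : G → (Fin n → Fin n), ∀ g g', (∀ a ∈ A, g * a * g⁻¹ ∈ A) →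
      (∀ a ∈ A, g' * a * g'⁻¹ ∈ A) → σ g = σ g' → ∀ a ∈ A, g * a * g⁻¹ = g' * a * g'⁻¹
  torsion : ∀ A : Subgroup G, IsCommSubgroup A → (Nat.card A).Coprime p →
    ∀ m : ℕ, 0 < m → Nat.card {a : G // a ∈ A ∧ a ^ m = 1} ≤ m ^ n

theorem isLinearLike_of_injective {F : Type*} [Field F] [IsAlgClosed F] {p n : ℕ} (hp : p.Prime)
    [CharP F p] {G : Type*} [Group G] [Finite G] (ρ : G →* Matrix (Fin n) (Fin n) F)
    (hρ : Function.Injective ρ) : IsLinearLike p n G := by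
  have h0 : ∀ A : Subgroup G, (Nat.card A).Coprime p → (Nat.card A : F) ≠ 0 := by
    intro A hA h
    rw [CharP.cast_eq_zero_iff F p] at h
    exact (hp.coprime_iff_not_dvd.1 hA.symm) h
  exact ⟨fun A hA hc => (exists_normalizer_action ρ hρ A hA (h0 A hc)).1,
    fun A hA hc => (exists_normalizer_action ρ hρ A hA (h0 A hc)).2⟩

section
variable {p n : ℕ} {G : Type*} [Group G]

theorem IsCommSubgroup.map {A : Subgroup G} (hA : IsCommSubgroup A) {K : Type*} [Group K]
    (f : G →* K) : IsCommSubgroup (A.map f) := by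
  rintro _ ⟨a, ha, rfl⟩ _ ⟨b, hb, rfl⟩
  rw [← map_mul, hA a ha b hb, map_mul]

theorem IsLinearLike.subgroup (h : IsLinearLike p n G) (H : Subgroup G) :
    IsLinearLike p n H := by
  have hcard : ∀ A : Subgroup H, Nat.card (A.map H.subtype) = Nat.card A := fun A =>
    Nat.card_congr (A.equivMapOfInjective H.subtype H.subtype_injective).symm.toEquiv
  refine ⟨fun A hA hc => ?_, fun A hA hc m hm => ?_⟩
  · obtain ⟨σ, hσ⟩ := h.action (A.map H.subtype) (hA.map _) (by rwa [hcard])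
    refine ⟨fun g => σ g, fun g g' hg hg' he a ha => Subtype.ext ?_⟩
    refine hσ g g' ?_ ?_ he a ⟨a, ha, rfl⟩
    · rintro _ ⟨b, hb, rfl⟩
      exact ⟨_, hg b hb, rfl⟩
    · rintro _ ⟨b, hb, rfl⟩
      exact ⟨_, hg' b hb, rfl⟩
  · refine le_trans (le_of_eq ?_) (h.torsion (A.map H.subtype) (hA.map _) (by rwa [hcard]) m hm)
    refine Nat.card_congr ⟨fun a => ⟨a.1, ⟨a.1, a.2.1, rfl⟩, by
      rw [← SubgroupClass.coe_pow, a.2.2]; rfl⟩, fun a => ⟨⟨a.1, ?_⟩, ?_, ?_⟩, ?_, ?_⟩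
    · obtain ⟨b, hb, hb'⟩ := a.2.1; rw [← hb']; exact b.2
    · obtain ⟨b, hb, hb'⟩ := a.2.1
      have h2 : b = ⟨a.1, hb' ▸ b.2⟩ := Subtype.ext hb'
      exact h2 ▸ hb
    · exact Subtype.ext a.2.2
    · intro a; rfl
    · intro a; rfl

/-- A self-centralizing normalized commutative subgroup of order prime to `p` has index at most
`n ^ n`. -/
theorem IsLinearLike.index_le (h : IsLinearLike p n G) [Finite G] (A : Subgroup G)
    (hA : IsCommSubgroup A) (hc : (Nat.card A).Coprime p) [A.Normal]
    (hcent : ∀ g : G, (∀ a ∈ A, g * a = a * g) → g ∈ A) : A.index ≤ n ^ n := by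
  obtain ⟨σ, hσ⟩ := h.action A hA hc
  have hn : ∀ g : G, ∀ a ∈ A, g * a * g⁻¹ ∈ A := fun g a ha => ‹A.Normal›.conj_mem a ha g
  have hinj : Function.Injective (fun q : G ⧸ A => σ q.out) := by
    intro q q' hq
    rw [← q.out_eq', ← q'.out_eq', QuotientGroup.eq]
    refine hcent _ fun a ha => ?_
    have := hσ _ _ (hn q.out) (hn q'.out) hq (q'.out⁻¹ * (q'.out * a * q'.out⁻¹) * q'.out)
      (by simpa [mul_assoc] using ha)
    have h2 : q.out * a * q.out⁻¹ = q'.out * a * q'.out⁻¹ := by simpa [mul_assoc] using this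
    have h3 : a * q.out⁻¹ * q'.out = q.out⁻¹ * q'.out * a := by
      have := congrArg (fun x => q.out⁻¹ * x * q'.out) h2
      simpa [mul_assoc] using this
    rw [← h3, mul_assoc]
  calc A.index = Nat.card (G ⧸ A) := rfl
    _ ≤ Nat.card (Fin n → Fin n) := Nat.card_le_card_of_injective _ hinj
    _ = n ^ n := by simp

theorem IsPGroup.exists_mem_center_of_normal {q : ℕ} [Fact q.Prime] [Finite G]
    (hG : IsPGroup q G) (N : Subgroup G) [N.Normal] (hN : N ≠ ⊥) :
    ∃ x ∈ N, x ≠ 1 ∧ ∀ g : G, g * x = x * g := by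
  have hG' : IsPGroup q (ConjAct G) := hG.of_equiv ConjAct.toConjAct
  have hd : q ∣ Nat.card N := by
    rcases (hG.to_subgroup N).card_eq_or_dvd with h | h
    · exact absurd (Subgroup.card_eq_one.1 h) hN
    · exact h
  have h1 : (1 : N) ∈ MulAction.fixedPoints (ConjAct G) N := fun g => smul_one g
  obtain ⟨x, hx, hx1⟩ := hG'.exists_fixed_point_of_prime_dvd_card_of_fixed_point N hd h1
  refine ⟨x, x.2, fun h => hx1 (Subtype.ext h.symm), fun g => ?_⟩
  have := congrArg Subtype.val (hx (ConjAct.toConjAct g))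
  rw [ConjAct.Subgroup.val_conj_smul, ConjAct.toConjAct_smul] at this
  exact mul_inv_eq_iff_eq_mul.1 this

/-- A finite `q`-group has a self-centralizing commutative normal subgroup. -/
theorem IsPGroup.exists_self_centralizing {q : ℕ} [Fact q.Prime] [Finite G] (hG : IsPGroup q G) :
    ∃ A : Subgroup G, A.Normal ∧ IsCommSubgroup A ∧ ∀ g : G, (∀ a ∈ A, g * a = a * g) → g ∈ A := by
  obtain ⟨A, -, hA⟩ := Finite.exists_le_maximal
    (p := fun A : Subgroup G => A.Normal ∧ IsCommSubgroup A) (a := ⊥) ⟨inferInstance, by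
      intro a ha b hb; rw [Subgroup.mem_bot.1 ha, Subgroup.mem_bot.1 hb]⟩
  have := hA.prop.1
  refine ⟨A, hA.prop.1, hA.prop.2, ?_⟩
  set C := Subgroup.centralizer (A : Set G) with hC
  have hAC : A ≤ C := fun a ha => Subgroup.mem_centralizer_iff.2 fun b hb => hA.prop.2 b hb a ha
  suffices hCA : C ≤ A from fun g hg =>
    hCA (Subgroup.mem_centralizer_iff.2 fun a ha => (hg a ha).symm)
  by_contra hcon
  have hCbar : C.map (QuotientGroup.mk' A) ≠ ⊥ := by
    intro h
    exact hcon fun c hc => (QuotientGroup.eq_one_iff c).1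
      (Subgroup.mem_bot.1 (h ▸
        (⟨c, hc, rfl⟩ : QuotientGroup.mk' A c ∈ C.map (QuotientGroup.mk' A))))
  have : C.Normal := inferInstance
  have : (C.map (QuotientGroup.mk' A)).Normal :=
    this.map _ (QuotientGroup.mk'_surjective A)
  obtain ⟨_, ⟨x, hx, rfl⟩, hx1, hxc⟩ :=
    (hG.to_quotient A).exists_mem_center_of_normal (C.map (QuotientGroup.mk' A)) hCbar
  have hxA : x ∉ A := fun h => hx1 ((QuotientGroup.eq_one_iff x).2 h)
  set A' := A ⊔ Subgroup.zpowers x with hA'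
  have hle : A ≤ A' := le_sup_left
  have hdesc : ∀ y ∈ A', ∃ a ∈ A, ∃ i : ℤ, y = a * x ^ i := by
    intro y hy
    obtain ⟨a, ha, b, ⟨i, rfl⟩, rfl⟩ := Subgroup.mem_sup_of_normal_left.1 hy
    exact ⟨a, ha, i, rfl⟩
  have hxcomm : ∀ a ∈ A, Commute a x := fun a ha => Subgroup.mem_centralizer_iff.1 hx a ha
  have hnorm : A'.Normal := by
    constructor
    intro y hy g
    obtain ⟨a, ha, i, rfl⟩ := hdesc y hy
    have h1 : g * a * g⁻¹ ∈ A := hA.prop.1.conj_mem a ha g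
    have h2 : (g * x * g⁻¹) ∈ A' := by
      have : g * x * g⁻¹ * x⁻¹ ∈ A := by
        rw [← QuotientGroup.eq_one_iff]
        have := hxc g
        simp only [QuotientGroup.mk'_apply] at this
        simp [this]
      have h3 := mul_mem (hle this) (Subgroup.mem_sup_right (Subgroup.mem_zpowers x) : x ∈ A')
      simpa using h3
    have : g * (a * x ^ i) * g⁻¹ = (g * a * g⁻¹) * (g * x * g⁻¹) ^ i := by
      rw [conj_zpow]; group
    rw [this]
    exact mul_mem (hle h1) (zpow_mem h2 i)
  have hcomm : IsCommSubgroup A' := by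
    intro y hy y' hy'
    obtain ⟨a, ha, i, rfl⟩ := hdesc y hy
    obtain ⟨b, hb, j, rfl⟩ := hdesc y' hy'
    have hab : Commute a b := hA.prop.2 a ha b hb
    have h1 : Commute (a * x ^ i) b := hab.mul_left ((hxcomm b hb).symm.zpow_left i)
    have h2 : Commute (a * x ^ i) (x ^ j) :=
      ((hxcomm a ha).zpow_right j).mul_left (Commute.zpow_zpow (Commute.refl x) i j)
    exact h1.mul_right h2
  have := hA.2 ⟨hnorm, hcomm⟩ hle
  exact hxA (this (Subgroup.mem_sup_right (Subgroup.mem_zpowers x)))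

theorem IsPGroup.card_coprime {q : ℕ} (hq : q.Prime) (hp : p.Prime) (hqp : q ≠ p) [Finite G]
    (hG : IsPGroup q G) : (Nat.card G).Coprime p := by
  have := Fact.mk hq
  obtain ⟨k, hk⟩ := IsPGroup.iff_card.1 hG
  rw [hk]
  exact Nat.Coprime.pow_left _ ((Nat.coprime_primes hq hp).2 hqp)

/-- A `q`-group which is linear in characteristic `p ≠ q` has a commutative subgroup of bounded
index. -/
theorem IsLinearLike.exists_isCommSubgroup {q : ℕ} (hq : q.Prime) (hp : p.Prime) (hqp : q ≠ p)
    [Finite G] (h : IsLinearLike p n G) (hG : IsPGroup q G) :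
    ∃ A : Subgroup G, A.Normal ∧ IsCommSubgroup A ∧ A.index ≤ n ^ n := by
  have := Fact.mk hq
  obtain ⟨A, hA, hAc, hcent⟩ := hG.exists_self_centralizing
  exact ⟨A, hA, hAc, h.index_le A hAc ((hG.to_subgroup A).card_coprime hq hp hqp) hcent⟩

end

section
variable {p n : ℕ} {G : Type*} [Group G]

/-- The bound on the index of the subgroup of `(n ^ n)!`-th powers. -/
abbrev powerIndexBound (n : ℕ) : ℕ := n ^ n * ((n ^ n).factorial) ^ n

/-- If `x` centralizes a commutative subgroup `U` and acts trivially on `Q ⧸ U`, then some power of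
`x` acts on `Q` as an inner automorphism. -/
theorem exists_mul_pow_commute [Finite G] (Q U : Subgroup G) (hUc : IsCommSubgroup U)
    (hQU : ∀ g ∈ Q, ∀ u ∈ U, g * u * g⁻¹ ∈ U) (x : G) (hx : ∀ u ∈ U, Commute x u)
    (hxQ : ∀ g ∈ Q, x * g * x⁻¹ * g⁻¹ ∈ U) :
    ∃ a ∈ U, ∀ g ∈ Q, Commute (x ^ U.relIndex Q * a) g := by
  classical
  let _ : CommGroup U :=
    { (inferInstance : Group U) with mul_comm := fun a b => Subtype.ext (hUc a a.2 b b.2) }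
  set V : Subgroup Q := U.subgroupOf Q with hV
  have : Fintype (Q ⧸ V) := Fintype.ofFinite _
  let f : Q → U := fun g => ⟨x * g * x⁻¹ * (g : G)⁻¹, hxQ g g.2⟩
  have hf : ∀ g h : Q, (g⁻¹ * h) ∈ V → f g = f h := by
    intro g h hgh
    apply Subtype.ext
    change x * g * x⁻¹ * (g : G)⁻¹ = x * h * x⁻¹ * (h : G)⁻¹
    have h1 : (g : G)⁻¹ * h ∈ U := hgh
    have h2 := (hx _ h1).eq
    have h3 : x⁻¹ * ((g : G)⁻¹ * h) = ((g : G)⁻¹ * h) * x⁻¹ := (hx _ h1).inv_left.eq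
    calc x * g * x⁻¹ * (g : G)⁻¹ = x * g * (x⁻¹ * ((g : G)⁻¹ * h)) * (h : G)⁻¹ := by group
      _ = x * h * x⁻¹ * (h : G)⁻¹ := by rw [h3]; group
  let F : Q ⧸ V → U := fun c => Quotient.liftOn' c f fun g h hgh =>
    hf g h (QuotientGroup.leftRel_apply.1 hgh)
  have hF : ∀ g : Q, F (g : Q ⧸ V) = f g := fun g => rfl
  set a0 : U := ∏ c, F c with ha0
  -- conjugation by an element of `Q` as an endomorphism of `U`
  let conj : Q → (U →* U) := fun g =>
    { toFun := fun u => ⟨g * u * (g : G)⁻¹, hQU g g.2 u u.2⟩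
      map_one' := Subtype.ext (by simp)
      map_mul' := fun u v => Subtype.ext (by simp [mul_assoc]) }
  have hN : Fintype.card (Q ⧸ V) = U.relIndex Q := by
    rw [← Nat.card_eq_fintype_card]; rfl
  have hkey : ∀ g : Q, a0 = f g ^ U.relIndex Q * conj g a0 := by
    intro g
    have h1 : a0 = ∏ c : Q ⧸ V, F (g • c) :=
      (Equiv.prod_comp (MulAction.toPerm g) F).symm
    have h2 : ∀ c : Q ⧸ V, F (g • c) = f g * conj g (F c) := by
      intro c
      induction c using QuotientGroup.induction_on with
      | H h =>
        change f (g * h) = f g * conj g (f h)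
        apply Subtype.ext
        change x * (g * h) * x⁻¹ * ((g : G) * h)⁻¹ =
          (x * g * x⁻¹ * (g : G)⁻¹) * (g * (x * h * x⁻¹ * (h : G)⁻¹) * (g : G)⁻¹)
        group
    conv_lhs => rw [h1]
    simp_rw [h2]
    rw [Finset.prod_mul_distrib, Finset.prod_const, Finset.card_univ, hN, ← map_prod]
  have hpow : ∀ g : Q, ∀ m : ℕ, x ^ m * g = ((f g ^ m : U) : G) * g * x ^ m := by
    intro g m
    induction m with
    | zero => simp
    | succ m ih =>
      have h1 : x * g = (f g : G) * g * x := by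
        change x * g = (x * g * x⁻¹ * (g : G)⁻¹) * g * x
        group
      have h2 : Commute (x ^ m) (f g : G) := (hx _ (f g).2).pow_left m
      calc x ^ (m + 1) * g = x ^ m * (x * g) := by rw [pow_succ, mul_assoc]
        _ = (f g : G) * (x ^ m * g) * x := by
          rw [h1, ← mul_assoc, ← mul_assoc, h2.eq]; simp only [mul_assoc]
        _ = _ := by
          rw [ih, pow_succ' (f g), pow_succ x]; push_cast; simp only [mul_assoc]
  refine ⟨(a0⁻¹ : U), (a0⁻¹ : U).2, fun g hg => ?_⟩
  have h1 : Commute (x ^ U.relIndex Q) ((a0 : G)⁻¹) :=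
    ((hx _ a0.2).pow_left _).inv_right
  have h2 := congrArg Subtype.val (hkey ⟨g, hg⟩)
  have h3 : (a0 : G) = ((f ⟨g, hg⟩ ^ U.relIndex Q : U) : G) * (g * a0 * g⁻¹) := h2
  have h4 := hpow ⟨g, hg⟩ (U.relIndex Q)
  have h5 : ((f ⟨g, hg⟩ ^ U.relIndex Q : U) : G) * g = a0 * g * (a0 : G)⁻¹ := by
    have : ((f ⟨g, hg⟩ ^ U.relIndex Q : U) : G) = a0 * (g * (a0 : G) * g⁻¹)⁻¹ :=
      eq_mul_inv_of_mul_eq h3.symm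
    rw [this]; group
  rw [h5] at h4
  change x ^ U.relIndex Q * g = _ at h4
  change x ^ _ * (a0 : G)⁻¹ * g = g * (x ^ _ * (a0 : G)⁻¹)
  rw [h1.eq, mul_assoc, h4]; group

theorem Subgroup.conj_pow_mem {Q : Subgroup G} {x : G} (hx : ∀ g ∈ Q, x * g * x⁻¹ ∈ Q) (m : ℕ) :
    ∀ g ∈ Q, x ^ m * g * (x ^ m)⁻¹ ∈ Q := by
  intro g hg
  induction m with
  | zero => simpa
  | succ m ih => convert hx _ ih using 1; rw [pow_succ']; group

theorem Subgroup.inv_conj_mem [Finite G] {Q : Subgroup G} {x : G} (hx : ∀ g ∈ Q, x * g * x⁻¹ ∈ Q) :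
    ∀ g ∈ Q, x⁻¹ * g * x ∈ Q := by
  intro g hg
  obtain ⟨m, hm⟩ : ∃ m : ℕ, x ^ m = x⁻¹ := by
    refine ⟨orderOf x - 1, eq_inv_of_mul_eq_one_left ?_⟩
    rw [← pow_succ, Nat.sub_add_cancel (orderOf_pos x), pow_orderOf_eq_one]
  have := Subgroup.conj_pow_mem hx m g hg
  rwa [hm, inv_inv] at this

/-- Pigeonhole for iterated conjugation. -/
theorem exists_pow_conj_eq {X : Type*} [Finite X] (φ : ℕ → X) (N : ℕ) (hN : Nat.card X ≤ N) :
    ∃ i j, i < j ∧ j ≤ N ∧ φ i = φ j := by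
  by_contra hcon
  push Not at hcon
  have hinj : Function.Injective (fun i : Fin (N + 1) => φ i) := by
    intro i j hij
    by_contra hne
    rcases lt_or_gt_of_ne (fun h => hne (Fin.ext h) : (i : ℕ) ≠ j) with h | h
    · exact hcon i j h (by omega) hij
    · exact hcon j i h (by omega) hij.symm
  have := Nat.card_le_card_of_injective _ hinj
  simp at this
  omega

/-- A power of bounded exponent of an element normalizing a commutative subgroup centralizes it. -/
theorem IsLinearLike.commute_pow_factorial (h : IsLinearLike p n G) (A : Subgroup G)
    (hA : IsCommSubgroup A) (hc : (Nat.card A).Coprime p) (x : G)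
    (hx : ∀ a ∈ A, x * a * x⁻¹ ∈ A) : ∀ a ∈ A, Commute (x ^ (n ^ n).factorial) a := by
  obtain ⟨σ, hσ⟩ := h.action A hA hc
  obtain ⟨i, j, hij, hj, he⟩ := exists_pow_conj_eq (fun i => σ (x ^ i)) (n ^ n) (by simp)
  have h1 : ∀ a ∈ A, Commute (x ^ (j - i)) a := by
    intro a ha
    have h2 := hσ (x ^ i) (x ^ j) (Subgroup.conj_pow_mem hx i) (Subgroup.conj_pow_mem hx j) he a ha
    have h3 : x ^ j = x ^ i * x ^ (j - i) := by rw [← pow_add]; congr 1; omega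
    rw [h3] at h2
    have h4 : a = x ^ (j - i) * a * (x ^ (j - i))⁻¹ := by
      have := congrArg (fun y => (x ^ i)⁻¹ * y * x ^ i) h2
      simpa [mul_assoc] using this
    exact (mul_inv_eq_iff_eq_mul.1 h4.symm)
  intro a ha
  obtain ⟨k, hk⟩ : (j - i) ∣ (n ^ n).factorial := Nat.dvd_factorial (by omega) (by omega)
  rw [hk, pow_mul]
  exact (h1 a ha).pow_left k

theorem conj_pow_mul_inv_mem_of_index_le [Finite G] (Q U : Subgroup G)
    (hQU : ∀ g ∈ Q, ∀ u ∈ U, g * u * g⁻¹ ∈ U) (x : G) (hxQ : ∀ g ∈ Q, x * g * x⁻¹ ∈ Q)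
    (hxU : ∀ u ∈ U, x * u * x⁻¹ ∈ U) {I : ℕ} (hI : U.relIndex Q ≤ I) :
    ∀ g ∈ Q, x ^ I.factorial * g * (x ^ I.factorial)⁻¹ * g⁻¹ ∈ U := by
  intro g hg
  set V : Subgroup Q := U.subgroupOf Q with hV
  obtain ⟨i, j, hij, hj, he⟩ := exists_pow_conj_eq (X := Q ⧸ V)
    (fun i => ((⟨x ^ i * g * (x ^ i)⁻¹, Subgroup.conj_pow_mem hxQ i g hg⟩ : Q) : Q ⧸ V)) I hI
  set y := x ^ (j - i) with hy
  have h1 : y * g * y⁻¹ * g⁻¹ ∈ U := by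
    have h2 : (x ^ i * g * (x ^ i)⁻¹)⁻¹ * (x ^ j * g * (x ^ j)⁻¹) ∈ U := by
      have h3 := QuotientGroup.eq.1 he
      exact h3
    have h3 : x ^ j = x ^ i * y := by rw [hy, ← pow_add]; congr 1; omega
    have h4 : (x ^ i)⁻¹ * ((x ^ i * g * (x ^ i)⁻¹)⁻¹ * (x ^ j * g * (x ^ j)⁻¹)) * x ^ i ∈ U :=
      Subgroup.inv_conj_mem (Subgroup.conj_pow_mem hxU i) _ h2
    have h5 : g⁻¹ * (y * g * y⁻¹) ∈ U := by
      convert h4 using 1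
      rw [h3]; group
    have := hQU g hg _ h5
    convert this using 1
    group
  have h2 : ∀ k : ℕ, y ^ k * g * (y ^ k)⁻¹ * g⁻¹ ∈ U := by
    intro k
    induction k with
    | zero => simp
    | succ k ih =>
      have h3 := Subgroup.conj_pow_mem (Subgroup.conj_pow_mem hxU (j - i)) k _ h1
      rw [← hy] at h3
      convert mul_mem h3 ih using 1
      rw [pow_succ]; group
  obtain ⟨k, hk⟩ : (j - i) ∣ I.factorial := Nat.dvd_factorial (by omega) (by omega)
  rw [hk, pow_mul]
  exact h2 k

theorem IsLinearLike.relIndex_powers_le [Finite G] (h : IsLinearLike p n G) (hG : ∃ q : ℕ, q.Prime ∧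
    p.Prime ∧ q ≠ p ∧ IsPGroup q G) :
    IsCommSubgroup (Subgroup.closure (Set.range fun g : G => g ^ (n ^ n).factorial)) ∧
    (Subgroup.closure (Set.range fun g : G => g ^ (n ^ n).factorial)).index ≤
      powerIndexBound n := by
  obtain ⟨q, hq, hp, hqp, hG⟩ := hG
  have := Fact.mk hq
  obtain ⟨A, hAn, hAc, hA⟩ := h.exists_isCommSubgroup hq hp hqp hG
  set m := (n ^ n).factorial with hm
  set U := Subgroup.closure (Set.range fun g : G => g ^ m) with hU
  have hUA : U ≤ A := by
    rw [hU, Subgroup.closure_le]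
    rintro _ ⟨g, rfl⟩
    obtain ⟨k, hk⟩ : A.index ∣ m :=
      Nat.dvd_factorial (Nat.pos_of_ne_zero Subgroup.index_ne_zero_of_finite) hA
    change g ^ m ∈ A
    rw [hk, pow_mul]
    exact pow_mem (A.pow_index_mem g) k
  refine ⟨fun a ha b hb => hAc a (hUA ha) b (hUA hb), ?_⟩
  let φ : A →* A :=
    { toFun := fun a => a ^ m
      map_one' := one_pow m
      map_mul' := fun a b => (show Commute a b from Subtype.ext (hAc a a.2 b b.2)).mul_pow m }
  have h1 : φ.range ≤ U.subgroupOf A := by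
    rintro _ ⟨a, rfl⟩
    exact Subgroup.subset_closure ⟨(a : G), rfl⟩
  have h2 : φ.range.index ≤ m ^ n := by
    have e1 : Nat.card φ.range * φ.range.index = Nat.card A := Subgroup.card_mul_index _
    have e2 : Nat.card φ.ker * Nat.card φ.range = Nat.card A := by
      rw [← Subgroup.index_ker, Subgroup.card_mul_index]
    have e3 : φ.range.index = Nat.card φ.ker := by
      have : 0 < Nat.card φ.range := Nat.card_pos
      nlinarith
    rw [e3]
    refine le_trans (Nat.card_le_card_of_injective
      (fun a : φ.ker => (⟨a.1, a.1.2, congrArg Subtype.val a.2⟩ : {a : G // a ∈ A ∧ a ^ m = 1})) ?_)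
      (h.torsion A hAc ((hG.to_subgroup A).card_coprime hq hp hqp) m (Nat.factorial_pos _))
    intro a b hab
    exact Subtype.ext (Subtype.ext (congrArg (fun z => z.1) hab))
  have h3 : U.relIndex A ≤ m ^ n :=
    le_trans (Nat.le_of_dvd (Nat.pos_of_ne_zero Subgroup.index_ne_zero_of_finite)
      (Subgroup.index_dvd_of_le h1)) h2
  rw [← Subgroup.relIndex_mul_index hUA, mul_comm, powerIndexBound]
  exact Nat.mul_le_mul hA h3

/-- The exponent needed to make the action on a `q`-subgroup inner. -/
abbrev innerExponent (n : ℕ) : ℕ :=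
  (n ^ n).factorial * (powerIndexBound n).factorial * (powerIndexBound n).factorial

/-- Some power of bounded exponent of an element normalizing a `q`-subgroup `Q`, with `q ≠ p`, acts
on `Q` as an inner automorphism. -/
theorem IsLinearLike.exists_pow_mul_commute [Finite G] (h : IsLinearLike p n G) {q : ℕ}
    (hq : q.Prime) (hp : p.Prime) (hqp : q ≠ p) (Q : Subgroup G) (hQ : IsPGroup q Q) (x : G)
    (hx : ∀ g ∈ Q, x * g * x⁻¹ ∈ Q) :
    ∃ b : ℕ, 0 < b ∧ b ∣ innerExponent n ∧ ∃ a ∈ Q, ∀ g ∈ Q, Commute (x ^ b * a) g := by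
  set m := (n ^ n).factorial with hm
  set U0 : Subgroup Q := Subgroup.closure (Set.range fun g : Q => g ^ m) with hU0
  obtain ⟨hc0, hi0⟩ := (h.subgroup Q).relIndex_powers_le ⟨q, hq, hp, hqp, hQ⟩
  set U : Subgroup G := U0.map Q.subtype with hU
  have hUQ : U ≤ Q := by rintro _ ⟨u, -, rfl⟩; exact u.2
  have hUc : IsCommSubgroup U := hc0.map _
  have hUcl : U = Subgroup.closure ((fun g : G => g ^ m) '' Q) := by
    rw [hU, hU0, MonoidHom.map_closure]
    congr 1
    ext y
    constructor
    · rintro ⟨_, ⟨g, rfl⟩, rfl⟩; exact ⟨g, g.2, rfl⟩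
    · rintro ⟨g, hg, rfl⟩; exact ⟨_, ⟨⟨g, hg⟩, rfl⟩, rfl⟩
  have hUn : ∀ y : G, (∀ g ∈ Q, y * g * y⁻¹ ∈ Q) → ∀ u ∈ U, y * u * y⁻¹ ∈ U := by
    intro y hy u hu
    have : U ≤ U.comap (MulAut.conj y).toMonoidHom := by
      conv_lhs => rw [hUcl]
      rw [Subgroup.closure_le]
      rintro _ ⟨g, hg, rfl⟩
      change y * g ^ m * y⁻¹ ∈ U
      rw [← conj_pow, hUcl]
      exact Subgroup.subset_closure ⟨_, hy g hg, rfl⟩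
    exact this hu
  have hQU : ∀ g ∈ Q, ∀ u ∈ U, g * u * g⁻¹ ∈ U := fun g hg =>
    hUn g fun g' hg' => mul_mem (mul_mem hg hg') (inv_mem hg)
  have hrel : U.relIndex Q = U0.index := by
    rw [Subgroup.relIndex, hU, Subgroup.subgroupOf, Subgroup.comap_map_eq_self_of_injective
      Q.subtype_injective]
  set I := powerIndexBound n with hI
  have hUp : (Nat.card U).Coprime p := (hQ.to_le hUQ).card_coprime hq hp hqp
  set x1 := x ^ (m * I.factorial) with hx1
  have h1 : ∀ u ∈ U, Commute x1 u := by
    intro u hu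
    rw [hx1, pow_mul]
    exact (h.commute_pow_factorial U hUc hUp x (hUn x hx) u hu).pow_left _
  have h2 : ∀ g ∈ Q, x1 * g * x1⁻¹ * g⁻¹ ∈ U := by
    rw [hx1, pow_mul]
    exact conj_pow_mul_inv_mem_of_index_le Q U hQU _ (Subgroup.conj_pow_mem hx m)
      (hUn _ (Subgroup.conj_pow_mem hx m)) (by rw [hrel]; exact hi0)
  obtain ⟨a, ha, hax⟩ := exists_mul_pow_commute Q U hUc hQU x1 h1 h2
  have hpos : 0 < U.relIndex Q := by
    rw [hrel]; exact Nat.pos_of_ne_zero Subgroup.index_ne_zero_of_finite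
  refine ⟨m * I.factorial * U.relIndex Q, by positivity, ?_, a, hUQ ha, ?_⟩
  · exact Nat.mul_dvd_mul dvd_rfl (Nat.dvd_factorial hpos (by rw [hrel]; exact hi0))
  · rw [pow_mul]; exact hax

end

section
variable {G : Type*} [Group G]

theorem mem_centralizer_self_iff {z g : G} : g ∈ Subgroup.centralizer {z} ↔ Commute g z := by
  rw [Subgroup.mem_centralizer_iff]
  simp only [Set.mem_singleton_iff, forall_eq]
  exact ⟨fun h => h.symm, fun h => h.symm⟩

/-- A Frobenius-type criterion for an element to be central. -/
theorem central_of_index_centralizer_eq_prime_pow [Finite G] {p : ℕ} [hp : Fact p.Prime] (z : G)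
    (hR : ∀ R : Subgroup G, IsPGroup p R → (∀ r ∈ R, z * r * z⁻¹ ∈ R) → R = ⊥)
    (hK : ∀ K : Subgroup G, z ∈ K → K ≠ ⊤ → ∀ k ∈ K, Commute k z)
    (hconj : ∀ g, Commute z (g * z * g⁻¹) → Commute g z)
    (hidx : ∃ k : ℕ, (Subgroup.centralizer {z}).index = p ^ k) : ∀ g, Commute g z := by
  classical
  set C := Subgroup.centralizer {z} with hC
  obtain ⟨k, hk⟩ := hidx
  have hCp : ∀ c ∈ C, ∀ a : ℕ, c ^ p ^ a = 1 → c = 1 := by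
    intro c hc a ha
    have h1 := hR (Subgroup.zpowers c) (by
        refine IsPGroup.of_card_dvd_pow (n := a) ?_
        rw [Nat.card_zpowers]; exact orderOf_dvd_of_pow_eq_one ha) (by
        rintro _ ⟨i, rfl⟩
        have : Commute z (c ^ i) := (mem_centralizer_self_iff.1 hc).symm.zpow_right i
        simp only
        rw [this.eq, mul_inv_cancel_right]; exact ⟨i, rfl⟩)
    exact Subgroup.mem_bot.1 (h1 ▸ Subgroup.mem_zpowers c)
  have hCcard : ¬ p ∣ Nat.card C := by
    intro h
    obtain ⟨c, hc⟩ := exists_prime_orderOf_dvd_card' p h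
    have h1 := hCp c c.2 1 (by rw [pow_one, ← SubgroupClass.coe_pow, ← hc, pow_orderOf_eq_one]; rfl)
    have : c = 1 := Subtype.ext h1
    rw [this, orderOf_one] at hc
    exact hp.out.one_lt.ne hc
  obtain ⟨S⟩ : Nonempty (Sylow p G) := inferInstance
  have hScard : Nat.card S = p ^ k := by
    rw [S.card_eq_multiplicity, ← C.card_mul_index, hk, Nat.factorization_mul Nat.card_pos.ne'
      (pow_pos hp.out.pos _).ne', Finsupp.add_apply, Nat.factorization_eq_zero_of_not_dvd hCcard,
      hp.out.factorization_pow]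
    simp
  set Z := Subgroup.center G with hZ
  have hZC : Z ≤ C := fun x hx => mem_centralizer_self_iff.2 ((Subgroup.mem_center_iff.1 hx z).symm)
  have hinter : ∀ g x : G, g ∉ C → x ∈ C → g⁻¹ * x * g ∈ C → x ∈ Z := by
    intro g x hg hx hxg
    have hx1 := mem_centralizer_self_iff.1 hx
    have hx2 : Commute x (g * z * g⁻¹) := by
      have h1 := (mem_centralizer_self_iff.1 hxg).eq
      have := congrArg (fun y => g * y * g⁻¹) h1
      change x * (g * z * g⁻¹) = (g * z * g⁻¹) * x
      simpa [mul_assoc] using this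
    by_contra hxZ
    refine hg (mem_centralizer_self_iff.2 (hconj g ?_))
    refine (hK (Subgroup.centralizer {x}) (mem_centralizer_self_iff.2 hx1.symm) ?_ _
      (mem_centralizer_self_iff.2 hx2.symm)).symm
    intro htop
    refine hxZ (Subgroup.mem_center_iff.2 fun y => ?_)
    exact (mem_centralizer_self_iff.1 (htop ▸ Subgroup.mem_top y)).eq
  have : Fintype G := Fintype.ofFinite G
  have : Fintype (G ⧸ C) := Fintype.ofFinite _
  set D : Finset G := Finset.univ.filter fun x => ∀ g : G, g⁻¹ * x * g ∉ C with hD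
  have hfix : ∀ (x g : G), (g : G ⧸ C) ∈ MulAction.fixedBy (G ⧸ C) x ↔ g⁻¹ * x * g ∈ C := by
    intro x g
    rw [MulAction.mem_fixedBy, eq_comm]
    change ((g : G ⧸ C) = ((x * g : G) : G ⧸ C)) ↔ _
    rw [QuotientGroup.eq, mul_assoc]
  have hburn : ∑ x : G, Nat.card (MulAction.fixedBy (G ⧸ C) x) = Nat.card G := by
    have h1 := MulAction.sum_card_fixedBy_eq_card_orbits_mul_card_group G (G ⧸ C)
    have h2 : Fintype.card (Quotient (MulAction.orbitRel G (G ⧸ C))) = 1 := by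
      rw [Fintype.card_eq_one_iff_nonempty_unique]
      have := (MulAction.pretransitive_iff_subsingleton_quotient G (G ⧸ C)).1 inferInstance
      exact ⟨⟨⟨Quotient.mk _ (1 : G)⟩, fun _ => Subsingleton.elim _ _⟩⟩
    rw [h2, one_mul] at h1
    simpa [Nat.card_eq_fintype_card] using h1
  have hle : ∀ x : G, Nat.card (MulAction.fixedBy (G ⧸ C) x) + (if x ∈ D then 1 else 0) ≤
      1 + (if x ∈ Z then p ^ k - 1 else 0) := by
    intro x
    by_cases hxZ : x ∈ Z
    · have hxD : x ∉ D := by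
        intro h
        have := (Finset.mem_filter.1 h).2 1
        exact this (by simpa using hZC hxZ)
      have h1 : Nat.card (MulAction.fixedBy (G ⧸ C) x) ≤ p ^ k :=
        hk ▸ Nat.card_le_card_of_injective _ Subtype.val_injective
      have := pow_pos hp.out.pos k
      simp only [hxD, hxZ, if_true, if_false]
      omega
    · simp only [hxZ, if_false, add_zero]
      have hsub : Subsingleton (MulAction.fixedBy (G ⧸ C) x) := by
        constructor
        rintro ⟨a, ha⟩ ⟨b, hb⟩
        induction a using QuotientGroup.induction_on with
        | H a =>
        induction b using QuotientGroup.induction_on with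
        | H b =>
        rw [hfix] at ha hb
        apply Subtype.ext
        by_contra hne
        have h1 : a⁻¹ * b ∉ C := fun h => hne (QuotientGroup.eq.2 h)
        have h2 := hinter (a⁻¹ * b) (a⁻¹ * x * a) h1 ha (by convert hb using 1; group)
        apply hxZ
        have h3 := Subgroup.mem_center_iff.1 h2 a
        have : x = a⁻¹ * x * a := by
          have := congrArg (fun y => y * a⁻¹) h3
          simpa [mul_assoc] using this
        rwa [this]
      by_cases hxD : x ∈ D
      · have : IsEmpty (MulAction.fixedBy (G ⧸ C) x) := by
          constructor
          rintro ⟨a, ha⟩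
          induction a using QuotientGroup.induction_on with
          | H a =>
          exact (Finset.mem_filter.1 hxD).2 a ((hfix x a).1 ha)
        simp [hxD]
      · simp only [hxD, if_false, add_zero]
        exact Finite.card_le_one_iff_subsingleton.2 hsub
  have hDcard : D.card ≤ Nat.card Z * (p ^ k - 1) := by
    have h1 := Finset.sum_le_sum (s := Finset.univ) fun x _ => hle x
    rw [Finset.sum_add_distrib, Finset.sum_add_distrib, hburn, ← Finset.sum_filter,
      ← Finset.sum_filter, Finset.sum_const, Finset.sum_const, Finset.sum_const, Finset.card_univ,
      ← Nat.card_eq_fintype_card] at h1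
    have h2 : (Finset.univ.filter fun x => x ∈ D).card = D.card := by simp
    have h3 : (Finset.univ.filter fun x => x ∈ Z).card = Nat.card Z := by
      rw [Nat.card_eq_fintype_card, Fintype.card_subtype]
    rw [h2, h3] at h1
    simp only [smul_eq_mul, mul_one] at h1
    omega
  -- the products of nontrivial elements of `S` with central elements exhaust `D`
  have hSp : ∀ s ∈ S, ∃ a : ℕ, s ^ p ^ a = 1 := by
    intro s hs
    obtain ⟨a, ha⟩ := isPGroup_iff_pow_pow_eq_one.1 S.2 ⟨s, hs⟩
    exact ⟨a, congrArg Subtype.val ha⟩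
  let ψ : ({s : S // s ≠ 1} × Z) → G := fun x => (x.1.1 : G) * x.2
  have hψD : ∀ x, ψ x ∈ D := by
    rintro ⟨⟨⟨s, hs⟩, hs1⟩, ζ, hζ⟩
    refine Finset.mem_filter.2 ⟨Finset.mem_univ _, fun g hg => hs1 ?_⟩
    change g⁻¹ * (s * ζ) * g ∈ C at hg
    have hcz := Subgroup.mem_center_iff.1 hζ
    have h1 : g⁻¹ * s * g ∈ C := by
      have : g⁻¹ * s * g = (g⁻¹ * (s * ζ) * g) * ζ⁻¹ := by
        have e : ζ * g = g * ζ := (hcz g).symm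
        calc g⁻¹ * s * g = g⁻¹ * s * (g * ζ) * ζ⁻¹ := by group
          _ = _ := by rw [← e]; group
      rw [this]
      exact mul_mem hg (inv_mem (hZC hζ))
    obtain ⟨a, ha⟩ := hSp s hs
    have h2 := hCp _ h1 a (by
      have : (g⁻¹ * s * g) ^ p ^ a = g⁻¹ * s ^ p ^ a * g := by
        have := conj_pow (a := g⁻¹) (b := s) (i := p ^ a)
        simpa using this
      rw [this, ha]; simp)
    apply Subtype.ext
    change s = 1
    have := congrArg (fun y => g * y * g⁻¹) h2
    simpa [mul_assoc] using this
  have hψinj : Function.Injective ψ := by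
    rintro ⟨⟨⟨s, hs⟩, hs1⟩, ζ, hζ⟩ ⟨⟨⟨t, ht⟩, ht1⟩, ξ, hξ⟩ h
    change s * ζ = t * ξ at h
    have h1 : t⁻¹ * s = ξ * ζ⁻¹ := by
      have := congrArg (fun y => t⁻¹ * y * ζ⁻¹) h
      simpa [mul_assoc] using this
    obtain ⟨a, ha⟩ := hSp (t⁻¹ * s) (mul_mem (inv_mem ht) hs)
    have h2 : t⁻¹ * s = 1 := hCp _ (h1 ▸ hZC (mul_mem hξ (inv_mem hζ))) a ha
    have h3 : t = s := inv_mul_eq_one.1 h2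
    have h4 : ζ = ξ := by rw [h3] at h; exact mul_left_cancel h
    subst h3; subst h4; rfl
  have hcardψ : Nat.card ({s : S // s ≠ 1} × Z) = Nat.card Z * (p ^ k - 1) := by
    rw [Nat.card_prod, mul_comm, ← hScard]
    congr 1
    rw [Nat.card_eq_fintype_card, Fintype.card_subtype_compl, Fintype.card_subtype_eq,
      Nat.card_eq_fintype_card]
    rfl
  have hsurj : ∀ x ∈ D, ∃ y, ψ y = x := by
    have hfin : Fintype ({s : S // s ≠ 1} × Z) := Fintype.ofFinite _
    have h1 : Finset.univ.image ψ = D := by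
      refine Finset.eq_of_subset_of_card_le ?_ ?_
      · intro x hx
        obtain ⟨y, -, rfl⟩ := Finset.mem_image.1 hx
        exact hψD y
      · rw [Finset.card_image_of_injective _ hψinj, Finset.card_univ, ← Nat.card_eq_fintype_card,
          hcardψ]
        exact hDcard
    intro x hx
    rw [← h1] at hx
    obtain ⟨y, -, hy⟩ := Finset.mem_image.1 hx
    exact ⟨y, hy⟩
  have hnormal : ∀ s ∈ S, ∀ g : G, g * s * g⁻¹ ∈ S := by
    intro s hs g
    by_cases hs1 : s = 1
    · simp [hs1]
    have h1 : g * s * g⁻¹ ∈ D := by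
      have h2 := (Finset.mem_filter.1 (hψD ⟨⟨⟨s, hs⟩, fun h => hs1 (congrArg Subtype.val h)⟩, 1⟩)).2
      refine Finset.mem_filter.2 ⟨Finset.mem_univ _, fun g' hg' => h2 (g⁻¹ * g') ?_⟩
      change (g⁻¹ * g')⁻¹ * (s * 1) * (g⁻¹ * g') ∈ C
      convert hg' using 1
      group
    obtain ⟨⟨⟨⟨t, ht⟩, _⟩, ζ, hζ⟩, h3⟩ := hsurj _ h1
    change t * ζ = g * s * g⁻¹ at h3
    obtain ⟨a, ha⟩ := hSp s hs
    obtain ⟨b, hb⟩ := hSp t ht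
    have htζ : Commute t ζ := Subgroup.mem_center_iff.1 hζ t
    have h4 : ζ ^ p ^ (a + b) = 1 := by
      have e1 : (g * s * g⁻¹) ^ p ^ (a + b) = 1 := by
        rw [conj_pow, pow_add, pow_mul, ha]; simp
      have e2 : t ^ p ^ (a + b) = 1 := by
        rw [pow_add, mul_comm, pow_mul, hb, one_pow]
      rw [← h3, htζ.mul_pow, e2, one_mul] at e1
      exact e1
    have h5 := hCp ζ (hZC hζ) _ h4
    rw [← h3, h5, mul_one]
    exact ht
  have hSbot : (S : Subgroup G) = ⊥ := hR S S.2 fun r hr => hnormal r hr z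
  have h1 : p ^ k = 1 := by
    rw [← hScard]
    rw [hSbot]; simp
  have h2 : C = ⊤ := Subgroup.index_eq_one.1 (hk.trans h1)
  intro g
  have : g ∈ C := h2 ▸ Subgroup.mem_top g
  exact mem_centralizer_self_iff.1 this

end

section
variable {G : Type*} [Group G]

theorem isPGroup_zpowers {ℓ a : ℕ} {x : G} (hx : x ^ ℓ ^ a = 1) :
    IsPGroup ℓ (Subgroup.zpowers x) :=
  IsPGroup.of_card_dvd_pow (n := a) (by rw [Nat.card_zpowers]; exact orderOf_dvd_of_pow_eq_one hx)

theorem exists_conj_mem_of_pow_eq_one [Finite G] {ℓ : ℕ} [Fact ℓ.Prime] (T : Subgroup G) {x y : G}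
    (hxT : x ∈ T) (hyT : y ∈ T) (hx : ∃ a : ℕ, x ^ ℓ ^ a = 1) (hy : ∃ a : ℕ, y ^ ℓ ^ a = 1) :
    ∃ t ∈ T, ∃ L : Subgroup G, IsPGroup ℓ L ∧ x ∈ L ∧ t * y * t⁻¹ ∈ L := by
  obtain ⟨a, ha⟩ := hx
  obtain ⟨b, hb⟩ := hy
  obtain ⟨L1, h1⟩ := (isPGroup_zpowers (G := T) (x := ⟨x, hxT⟩) (Subtype.ext ha)).exists_le_sylow
  obtain ⟨L2, h2⟩ := (isPGroup_zpowers (G := T) (x := ⟨y, hyT⟩) (Subtype.ext hb)).exists_le_sylow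
  obtain ⟨t, rfl⟩ := MulAction.exists_smul_eq T L2 L1
  refine ⟨t, t.2, (t • L2 : Sylow ℓ T).map T.subtype, (t • L2).2.map _,
    ⟨_, h1 (Subgroup.mem_zpowers _), rfl⟩, ?_⟩
  have h3 := Subgroup.smul_mem_pointwise_smul _ (MulAut.conj t) _
    (h2 (Subgroup.mem_zpowers (⟨y, hyT⟩ : T)))
  exact Subgroup.mem_map.2 ⟨t * (⟨y, hyT⟩ : T) * t⁻¹, h3, rfl⟩

theorem Subgroup.mul_eq_univ_of_coprime_index [Finite G] {R C : Subgroup G}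
    (h : Nat.Coprime R.index C.index) (g : G) : ∃ r ∈ R, ∃ c ∈ C, g = r * c := by
  have h1 : (R ⊓ C).index = (R ⊓ C).relIndex R * R.index :=
    (Subgroup.relIndex_mul_index inf_le_left).symm
  have h2 : C.index ∣ (R ⊓ C).index := Subgroup.index_dvd_of_le inf_le_right
  have h3 : C.index ∣ (R ⊓ C).relIndex R := by
    rw [h1] at h2
    exact h.symm.dvd_of_dvd_mul_right h2
  have h4 : C.index ≤ C.relIndex R := by
    rw [← Subgroup.inf_relIndex_left]
    exact Nat.le_of_dvd (Nat.pos_of_ne_zero Subgroup.index_ne_zero_of_finite) h3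
  let f : R ⧸ C.subgroupOf R → G ⧸ C := fun c => Quotient.liftOn' c (fun r => ((r : G) : G ⧸ C))
    fun a b hab => by
      have h := QuotientGroup.leftRel_apply.1 hab
      exact QuotientGroup.eq.2 h
  have hf : Function.Injective f := by
    intro a b hab
    induction a using QuotientGroup.induction_on with
    | H a =>
    induction b using QuotientGroup.induction_on with
    | H b =>
      have h := QuotientGroup.eq.1 (show ((a : G) : G ⧸ C) = ((b : G) : G ⧸ C) from hab)
      exact QuotientGroup.eq.2 h
  have hf2 : Function.Surjective f :=
    (Function.Injective.bijective_of_nat_card_le hf h4).2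
  obtain ⟨c, hc⟩ := hf2 (g : G ⧸ C)
  induction c using QuotientGroup.induction_on with
  | H r => exact ⟨r, r.2, (r : G)⁻¹ * g, QuotientGroup.eq.1 hc, by group⟩

theorem exists_normal_pGroup_of_forall_commutator_mem (R : Subgroup G) (z : G) {p : ℕ}
    (hR : IsPGroup p R) (h : ∀ g : G, g * z * g⁻¹ * z⁻¹ ∈ R) :
    ∃ R' : Subgroup G, R'.Normal ∧ IsPGroup p R' ∧ ∀ g : G, g * z * g⁻¹ * z⁻¹ ∈ R' := by
  refine ⟨R.normalCore, inferInstance, hR.to_le (Subgroup.normalCore_le R), fun g x => ?_⟩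
  have := mul_mem (h (x * g)) (inv_mem (h x))
  convert this using 1
  group

theorem exists_normal_pGroup_commutator_mem [Finite G] {p ℓ : ℕ} [hp : Fact p.Prime]
    [Fact ℓ.Prime] (z : G) (hz : ∃ a : ℕ, z ^ ℓ ^ a = 1)
    (hiso : ∀ (g : G) (L : Subgroup G), IsPGroup ℓ L → z ∈ L → g * z * g⁻¹ ∈ L → Commute g z)
    (hK : ∀ K : Subgroup G, z ∈ K → K ≠ ⊤ → ∃ R ≤ K, IsPGroup p R ∧
      (∀ k ∈ K, ∀ r ∈ R, k * r * k⁻¹ ∈ R) ∧ ∀ k ∈ K, k * z * k⁻¹ * z⁻¹ ∈ R)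
    (hidx : ∃ k : ℕ, (Subgroup.centralizer {z}).index = p ^ k) :
    ∃ R : Subgroup G, R.Normal ∧ IsPGroup p R ∧ ∀ g : G, g * z * g⁻¹ * z⁻¹ ∈ R := by
  obtain ⟨R, -, hR⟩ := Finite.exists_le_maximal
    (p := fun R : Subgroup G => IsPGroup p R ∧ ∀ r ∈ R, z * r * z⁻¹ ∈ R)
    (a := ⊥) ⟨IsPGroup.of_bot, by
      intro r hr; rw [Subgroup.mem_bot.1 hr]; simp⟩
  have hRp := hR.prop.1
  have hRz := hR.prop.2
  set N := Subgroup.normalizer (R : Set G) with hN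
  have hzN : z ∈ N := Subgroup.mem_normalizer_fintype hRz
  have hRN : R ≤ N := Subgroup.le_normalizer
  by_cases hNtop : N = ⊤
  · have hnormal : R.Normal := Subgroup.normalizer_eq_top_iff.1 hNtop
    set π := QuotientGroup.mk' R with hπ
    have hπs : Function.Surjective π := QuotientGroup.mk'_surjective R
    have hker : ∀ x : G, π x = 1 ↔ x ∈ R := fun x => QuotientGroup.eq_one_iff x
    have hcomm : ∀ g : G, Commute (π g) (π z) → g * z * g⁻¹ * z⁻¹ ∈ R := by
      intro g hg
      rw [← hker]
      simp only [map_mul, map_inv]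
      rw [hg.eq]; group
    have hcomm' : ∀ g : G, g * z * g⁻¹ * z⁻¹ ∈ R → Commute (π g) (π z) := by
      intro g hg
      rw [← hker] at hg
      simp only [map_mul, map_inv] at hg
      have := mul_inv_eq_iff_eq_mul.1 (mul_inv_eq_one.1 hg)
      exact this
    obtain ⟨a, ha⟩ := hz
    have hcentral : ∀ g : G ⧸ R, Commute g (π z) := by
      refine central_of_index_centralizer_eq_prime_pow (p := p) (π z) ?_ ?_ ?_ ?_
      · intro S hS hSz
        have h1 : IsPGroup p (S.comap π) := hS.comap_of_ker_isPGroup π (by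
          rw [hπ, QuotientGroup.ker_mk']; exact hRp)
        have h2 := hR.2 (y := S.comap π) ⟨h1, fun r hr => by
          rw [Subgroup.mem_comap] at hr ⊢; simpa using hSz _ hr⟩ (fun r hr => by
            rw [Subgroup.mem_comap, (hker r).2 hr]; exact one_mem _)
        rw [eq_bot_iff]
        intro s hs
        obtain ⟨r, rfl⟩ := hπs s
        exact Subgroup.mem_bot.2 ((hker r).2 (h2 hs))
      · intro K hzK hKtop k hk
        obtain ⟨k, rfl⟩ := hπs k
        obtain ⟨R0, hR0K, hR0p, hR0n, hR0⟩ := hK (K.comap π) hzK (fun h => hKtop (by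
          rw [← Subgroup.map_comap_eq_self_of_surjective hπs K, h,
            Subgroup.map_top_of_surjective _ hπs]))
        have h1 := hR.2 (y := R0 ⊔ R) ⟨hR0p.to_sup_of_normal_right hRp, fun r hr => by
          obtain ⟨x, hx, y, hy, rfl⟩ := Subgroup.mem_sup_of_normal_right.1 hr
          have := mul_mem (Subgroup.mem_sup_left (T := R) (hR0n z hzK x hx))
            (Subgroup.mem_sup_right (S := R0) (hRz y hy))
          convert this using 1
          group⟩ le_sup_right
        exact hcomm' k (h1 (Subgroup.mem_sup_left (hR0 k hk)))
      · intro g hg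
        obtain ⟨g, rfl⟩ := hπs g
        set x := π g * π z * (π g)⁻¹ with hx
        have hx' : x = π (g * z * g⁻¹) := by simp [hx]
        set E := Subgroup.zpowers (π z) ⊔ Subgroup.zpowers x with hE
        have hzE : π z ∈ E := Subgroup.mem_sup_left (Subgroup.mem_zpowers _)
        have hxE : x ∈ E := Subgroup.mem_sup_right (Subgroup.mem_zpowers _)
        have hEx : ∀ e ∈ E, Commute e x := by
          intro e he
          have h1 : E ≤ Subgroup.centralizer {x} := by
            rw [hE, sup_le_iff, Subgroup.zpowers_le, Subgroup.zpowers_le]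
            exact ⟨mem_centralizer_self_iff.2 hg, mem_centralizer_self_iff.2 (Commute.refl x)⟩
          exact mem_centralizer_self_iff.1 (h1 he)
        obtain ⟨t, ht, L, hL, hzL, htL⟩ := exists_conj_mem_of_pow_eq_one (ℓ := ℓ) (E.comap π)
          (x := z) (y := g * z * g⁻¹) hzE (by rw [Subgroup.mem_comap, ← hx']; exact hxE) ⟨a, ha⟩
          ⟨a, by rw [conj_pow, ha]; simp⟩
        have h1 := hiso (t * g) L hL hzL (by convert htL using 1; group)
        have h2 : π z = π t * x * (π t)⁻¹ := by
          rw [hx', ← map_inv, ← map_mul, ← map_mul]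
          congr 1
          exact (mul_inv_eq_iff_eq_mul.2 h1.eq).symm.trans (by group)
        have h3 : π z = x := by rw [h2, (hEx _ ht).eq]; group
        have h4 := mul_inv_eq_iff_eq_mul.1 (hx.symm.trans h3.symm)
        exact h4
      · obtain ⟨k, hk⟩ := hidx
        have h1 : (Subgroup.centralizer {π z}).index ∣ p ^ k := by
          rw [← hk, ← Subgroup.index_comap_of_surjective _ hπs]
          refine Subgroup.index_dvd_of_le fun c hc => ?_
          rw [Subgroup.mem_comap, mem_centralizer_self_iff]
          exact (mem_centralizer_self_iff.1 hc).map π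
        obtain ⟨j, -, hj⟩ := (Nat.dvd_prime_pow hp.out).1 h1
        exact ⟨j, hj⟩
    exact ⟨R, hnormal, hRp, fun g => hcomm g (hcentral _)⟩
  · obtain ⟨R0, hR0N, hR0p, hR0n, hR0⟩ := hK N hzN hNtop
    obtain ⟨S0, hS0⟩ := (hRp.comap_subtype (K := N)).exists_le_sylow
    have hR0' : (R0.comap N.subtype).Normal :=
      ⟨fun r hr k => hR0n k k.2 r hr⟩
    have hR0S : R0.subgroupOf N ≤ S0 := (hR0p.comap_subtype (K := N)).le_sylow_of_normal S0
    have hSR : (S0 : Subgroup N).map N.subtype ≤ R := by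
      refine hR.2 (y := (S0 : Subgroup N).map N.subtype) ⟨S0.2.map _, ?_⟩
        fun r hr => ⟨⟨r, hRN hr⟩, hS0 hr, rfl⟩
      rintro _ ⟨s, hs, rfl⟩
      have h1 : (⟨(s : G)⁻¹ * z * (s : G)⁻¹⁻¹ * z⁻¹, hR0N (hR0 _ (inv_mem s.2))⟩ : N) ∈ S0 :=
        hR0S (hR0 _ (inv_mem s.2))
      refine ⟨_, mul_mem hs h1, ?_⟩
      simp only [Subgroup.subtype_apply, Subgroup.coe_mul]
      group
    have hS0R : (S0 : Subgroup N) = R.subgroupOf N :=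
      le_antisymm (fun s hs => hSR ⟨s, hs, rfl⟩) hS0
    obtain ⟨m, hm⟩ := IsPGroup.iff_card.1 hRp
    have hidxR : ¬ p ∣ R.index := by
      intro hd
      have h1 : p ^ (m + 1) ∣ Nat.card G := by
        rw [← R.card_mul_index, hm, pow_succ]
        exact Nat.mul_dvd_mul_left _ hd
      have h2 := Sylow.prime_dvd_card_quotient_normalizer h1 hm
      have h3 := S0.not_dvd_index
      rw [hS0R] at h3
      exact h3 h2
    obtain ⟨k, hk⟩ := hidx
    have hcop : Nat.Coprime R.index (Subgroup.centralizer {z}).index := by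
      rw [hk]
      exact (Nat.Coprime.pow_left k ((hp.out.coprime_iff_not_dvd).2 hidxR)).symm
    refine exists_normal_pGroup_of_forall_commutator_mem R z hRp fun g => ?_
    obtain ⟨r, hr, c, hc, rfl⟩ := Subgroup.mul_eq_univ_of_coprime_index hcop g
    have h1 : c * z = z * c := (mem_centralizer_self_iff.1 hc).eq
    have h2 : r * c * z * (r * c)⁻¹ * z⁻¹ = r * (z * r⁻¹ * z⁻¹) := by
      rw [mul_assoc r c z, h1]; group
    rw [h2]
    exact mul_mem hr (hRz _ (inv_mem hr))

end

section
variable {G : Type*} [Group G]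

open scoped IsMulCommutative in
theorem IsCommSubgroup.exists_hom_pow_index [Finite G] {B : Subgroup G} (hB : IsCommSubgroup B) :
    ∃ τ : G →* B, ∀ (m : ℕ) (g : G), (∀ (k : ℕ) (x : G), x⁻¹ * g ^ k * x ∈ B →
      (x⁻¹ * g ^ k * x) ^ m = g ^ (k * m)) → ((τ g : B) : G) ^ m = g ^ (B.index * m) := by
  classical
  have : IsMulCommutative B := ⟨⟨fun a b => Subtype.ext (hB a a.2 b b.2)⟩⟩
  let := B.fintypeQuotientOfFiniteIndex
  refine ⟨MonoidHom.transfer (MonoidHom.id B), fun m g hg => ?_⟩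
  rw [MonoidHom.transfer_eq_prod_quotient_orbitRel_zpowers_quot, ← Subgroup.coe_pow,
    ← Finset.prod_pow, Subgroup.index_eq_sum_minimalPeriod B g]
  have key : ∀ (ι : Type _) (s : Finset ι) (b : ι → B) (k : ι → ℕ),
      (∀ i, ((b i : B) : G) ^ m = g ^ (k i * m)) →
      ((∏ i ∈ s, b i ^ m : B) : G) = g ^ ((∑ i ∈ s, k i) * m) := by
    intro ι s b k hb
    induction s using Finset.induction_on with
    | empty => simp
    | insert i s hi ih =>
      rw [Finset.prod_insert hi, Finset.sum_insert hi, Subgroup.coe_mul, ih, Subgroup.coe_pow, hb,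
        add_mul, pow_add]
  exact key _ _ _ _ fun q => hg _ _ (QuotientGroup.out_conj_pow_minimalPeriod_mem B g q.out)

theorem eq_one_of_pow_eq_one_of_isPGroup {ℓ q a : ℕ} (hℓ : ℓ.Prime) (hq : q.Prime) (h : q ≠ ℓ)
    {x : G} (hG : IsPGroup ℓ G) (hx : x ^ q ^ a = 1) : x = 1 := by
  obtain ⟨k, hk⟩ := hG x
  have h1 := Nat.dvd_gcd (orderOf_dvd_of_pow_eq_one hx) (orderOf_dvd_of_pow_eq_one hk)
  rw [Nat.Coprime.gcd_eq_one (Nat.Coprime.pow _ _ ((Nat.coprime_primes hq hℓ).2 h))] at h1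
  exact orderOf_eq_one_iff.1 (Nat.dvd_one.1 h1)

/-- An `ℓ`-element is a power of each of its powers with exponent prime to `ℓ`. -/
theorem commute_pow_of_coprime {ℓ e s : ℕ} {z g : G} (hz : ∃ a : ℕ, z ^ ℓ ^ a = 1)
    (he : ℓ.Coprime e) (h : Commute g (z ^ (s * e))) : Commute g (z ^ s) := by
  obtain ⟨a, ha⟩ := hz
  have hc : (orderOf (z ^ s)).Coprime e :=
    Nat.Coprime.coprime_dvd_left (orderOf_dvd_of_pow_eq_one (n := ℓ ^ a) (by
      rw [← pow_mul, mul_comm, pow_mul, ha, one_pow])) (he.pow_left a)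
  obtain ⟨m, hm⟩ := exists_pow_eq_self_of_coprime hc.symm
  rw [← hm, ← pow_mul z]
  exact h.pow_right m

theorem Subgroup.index_dvd_card_of_mul [Finite G] {R C : Subgroup G}
    (h : ∀ g : G, ∃ r ∈ R, ∃ c ∈ C, g = r * c) : C.index ∣ Nat.card R := by
  let f : R ⧸ C.subgroupOf R → G ⧸ C := fun c => Quotient.liftOn' c (fun r => ((r : G) : G ⧸ C))
    fun a b hab => by
      have h := QuotientGroup.leftRel_apply.1 hab
      exact QuotientGroup.eq.2 h
  have hf : Function.Bijective f := by
    constructor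
    · intro a b hab
      induction a using QuotientGroup.induction_on with
      | H a =>
      induction b using QuotientGroup.induction_on with
      | H b =>
        have h := QuotientGroup.eq.1 (show ((a : G) : G ⧸ C) = ((b : G) : G ⧸ C) from hab)
        exact QuotientGroup.eq.2 h
    · intro x
      induction x using QuotientGroup.induction_on with
      | H g =>
        obtain ⟨r, hr, c, hc, rfl⟩ := h g
        exact ⟨((⟨r, hr⟩ : R) : R ⧸ C.subgroupOf R), QuotientGroup.eq.2 (by simpa using hc)⟩
  have h1 : C.index = (C.subgroupOf R).index := (Nat.card_congr (Equiv.ofBijective f hf)).symm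
  rw [h1]
  exact Subgroup.index_dvd_card _

end

/-- The exponent through which fusion is controlled. -/
abbrev fusionExponent (n : ℕ) : ℕ := (n ^ n).factorial

/-- The power up to which centralizers of powers are required to stabilize. -/
abbrev gapExponent (n : ℕ) : ℕ := (n ^ n).factorial * innerExponent n * (n ^ n).factorial

/-- `ℓ`-elements whose fusion in `ℓ`-subgroups is trivial up to a bounded power, and whose
centralizer does not grow when passing to a bounded power. -/
structure IsFusionRigid (n ℓ : ℕ) {G : Type*} [Group G] (z : G) : Prop where
  pow_eq_one : ∃ a : ℕ, z ^ ℓ ^ a = 1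
  fusion : ∀ (r : ℕ) (g : G) (R : Subgroup G), IsPGroup ℓ R → z ^ r ∈ R → g * z ^ r * g⁻¹ ∈ R →
    Commute g (z ^ (r * fusionExponent n))
  gap : ∀ g : G, Commute g (z ^ gapExponent n) → Commute g z

section
variable {n ℓ : ℕ} {G : Type*} [Group G]

theorem IsFusionRigid.commute {z : G} (hz : IsFusionRigid n ℓ z) (g : G) (L : Subgroup G)
    (hL : IsPGroup ℓ L) (h1 : z ∈ L) (h2 : g * z * g⁻¹ ∈ L) : Commute g z := by
  refine hz.gap g ?_
  have h := hz.fusion 1 g L hL (by simpa using h1) (by simpa using h2)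
  rw [one_mul] at h
  rw [gapExponent, mul_assoc, pow_mul]
  exact h.pow_right _

theorem IsFusionRigid.subgroup {H : Subgroup G} {z : H} (hz : IsFusionRigid n ℓ (z : G)) :
    IsFusionRigid n ℓ z where
  pow_eq_one := hz.pow_eq_one.imp fun a ha => Subtype.ext ha
  fusion r g R hR h1 h2 := by
    have := hz.fusion r g (R.map H.subtype) (hR.map _) ⟨_, h1, rfl⟩ ⟨_, h2, rfl⟩
    exact Subtype.ext this
  gap g h := Subtype.ext (hz.gap g (congrArg Subtype.val h))

/-- If `y` centralizes a Sylow `q`-subgroup and `z`, and `z` is central modulo a `p`-group in the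
centralizer of `y`, then `q` does not divide the index of the centralizer of `z`. -/
theorem IsFusionRigid.not_dvd_index [Finite G] {p q : ℕ} [hp : Fact p.Prime] [hq : Fact q.Prime]
    [Fact ℓ.Prime] (hqp : q ≠ p) {z : G} (hz : IsFusionRigid n ℓ z) (H R : Subgroup G)
    (hzH : z ∈ H) (hR : IsPGroup p R) (hRn : ∀ k ∈ H, ∀ r ∈ R, k * r * k⁻¹ ∈ R)
    (hRz : ∀ k ∈ H, k * z * k⁻¹ * z⁻¹ ∈ R) (hH : ¬ q ∣ H.index) :
    ¬ q ∣ (Subgroup.centralizer {z}).index := by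
  set C := Subgroup.centralizer {z} with hC
  intro hd
  have h1 : q ∣ (C ⊓ H).relIndex H * H.index := by
    rw [Subgroup.relIndex_mul_index inf_le_right]
    exact hd.trans (Subgroup.index_dvd_of_le inf_le_left)
  rw [Subgroup.inf_relIndex_right] at h1
  have h2 : (C.subgroupOf H).index ∣ Nat.card (R.subgroupOf H) := by
    refine Subgroup.index_dvd_card_of_mul fun k => ?_
    have hnorm : (R.subgroupOf H).Normal := ⟨fun r hr k => hRn k k.2 r hr⟩
    set z' : H := ⟨z, hzH⟩ with hz'
    have hk : k * z' * k⁻¹ * z'⁻¹ ∈ R.subgroupOf H := hRz k k.2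
    have hpz : ∃ a : ℕ, z' ^ ℓ ^ a = 1 := hz.pow_eq_one.imp fun a ha => Subtype.ext ha
    obtain ⟨t, ht, L, hL, hzL, hkL⟩ := exists_conj_mem_of_pow_eq_one (ℓ := ℓ)
      (R.subgroupOf H ⊔ Subgroup.zpowers z') (x := z') (y := k * z' * k⁻¹)
      (Subgroup.mem_sup_right (Subgroup.mem_zpowers _)) (by
        have := mul_mem (Subgroup.mem_sup_left (T := Subgroup.zpowers z') hk)
          (Subgroup.mem_sup_right (S := R.subgroupOf H) (Subgroup.mem_zpowers z'))
        simpa using this) hpz (hpz.imp fun a ha => by rw [conj_pow, ha]; simp)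
    have h3 := (IsFusionRigid.subgroup (z := z') hz).commute (t * k) L hL hzL
      (by convert hkL using 1; group)
    obtain ⟨r, hr, y, ⟨i, rfl⟩, rfl⟩ := Subgroup.mem_sup_of_normal_left.1 ht
    refine ⟨_, hnorm.conj_mem _ (inv_mem hr) (z' ^ (-i)), z' ^ (-i) * (r * z' ^ i * k), ?_, ?_⟩
    · refine mul_mem (zpow_mem ?_ _) ?_
      · exact mem_centralizer_self_iff.2 (Commute.refl z)
      · exact mem_centralizer_self_iff.2 (congrArg Subtype.val h3)
    · simp only [zpow_neg]; group
  rcases (Nat.Prime.dvd_mul hq.out).1 h1 with h | h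
  · obtain ⟨k, hk⟩ := IsPGroup.iff_card.1 (hR.comap_subtype (K := H))
    have h4 : q ∣ p ^ k := h.trans (hk ▸ h2)
    exact hqp ((Nat.prime_dvd_prime_iff_eq hq.out hp.out).1 (hq.out.dvd_of_dvd_pow h4))
  · exact hH h

end

section
variable {n ℓ : ℕ} {G : Type*} [Group G]

/-- An element of the normalizer of a Sylow `q`-subgroup with the same image as `z` yields an
`ℓ`-element centralizing a Sylow `q`-subgroup. -/
theorem IsLinearLike.exists_centralizing [Finite G] {p q : ℕ} (h : IsLinearLike p n G)
    (hp : p.Prime) (hq : q.Prime) [Fact ℓ.Prime] (hqp : q ≠ p) (hqℓ : q ≠ ℓ) (L : Sylow ℓ G)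
    {B : Subgroup G} (hB : IsPGroup ℓ B) (τ : G →* B) (hτ : ∀ g x : G, τ (g * x * g⁻¹) = τ x)
    (z : G) :
    ∃ y ∈ L, ∃ b m : ℕ, b ∣ innerExponent n ∧ ℓ.Coprime m ∧ τ y = τ z ^ (b * m) ∧
      ∃ Q : Sylow q G, ∀ g ∈ Q, Commute y g := by
  have hℓ := Fact.out (p := ℓ.Prime)
  have := Fact.mk hq
  let Q : Sylow q G := default
  have hQτ : (Q : Subgroup G) ≤ τ.ker := by
    intro x hx
    obtain ⟨a, ha⟩ := Q.2 ⟨x, hx⟩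
    have hxa : x ^ q ^ a = 1 := congrArg Subtype.val ha
    refine eq_one_of_pow_eq_one_of_isPGroup hℓ hq hqℓ (a := a) hB ?_
    rw [← map_pow, hxa, map_one]
  have hz : z ∈ Subgroup.normalizer (Q : Set G) ⊔ τ.ker := by
    have h1 := Sylow.normalizer_sup_eq_top' Q hQτ
    exact h1 ▸ Subgroup.mem_top z
  obtain ⟨x, hx, k, hk, rfl⟩ := Subgroup.mem_sup_of_normal_right.1 hz
  obtain ⟨b, hb0, hb, a, ha, hcomm⟩ := h.exists_pow_mul_commute hq hp hqp Q Q.2 x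
    (fun g hg => (Subgroup.mem_normalizer_iff.1 hx g).1 hg)
  set y := x ^ b * a with hy
  have hτy : τ y = τ (x * k) ^ b := by
    rw [hy, map_mul, map_mul, map_pow, MonoidHom.mem_ker.1 (hQτ ha), MonoidHom.mem_ker.1 hk]
    simp
  have ho : orderOf y ≠ 0 := (orderOf_pos y).ne'
  set m := orderOf y / ℓ ^ (orderOf y).factorization ℓ with hm
  have hm1 : ℓ.Coprime m := Nat.coprime_ordCompl hℓ ho
  have hym : (y ^ m) ^ ℓ ^ (orderOf y).factorization ℓ = 1 := by
    rw [← pow_mul, mul_comm, Nat.ordProj_mul_ordCompl_eq_self, pow_orderOf_eq_one]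
  obtain ⟨L1, h1⟩ := (isPGroup_zpowers hym).exists_le_sylow
  obtain ⟨u, rfl⟩ := MulAction.exists_smul_eq G L1 L
  refine ⟨u * y ^ m * u⁻¹, Subgroup.smul_mem_pointwise_smul _ (MulAut.conj u) _
    (h1 (Subgroup.mem_zpowers _)), b, m, hb, hm1, ?_, u • Q, ?_⟩
  · rw [hτ, map_pow, hτy, pow_mul]
  · intro g hg
    obtain ⟨s, hs, rfl⟩ := (Subgroup.mem_smul_pointwise_iff_exists _ _ _).1 hg
    have h2 := (hcomm s hs).pow_left m
    exact Commute.map h2 (MulAut.conj u)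

theorem IsFusionRigid.exists_index_eq_pow [Finite G] {p : ℕ} (h : IsLinearLike p n G)
    [hp : Fact p.Prime] [hℓ : Fact ℓ.Prime] (hℓp : ℓ ≠ p) {z : G} (hz : IsFusionRigid n ℓ z)
    (hK : ∀ K : Subgroup G, z ∈ K → K ≠ ⊤ → ∃ R ≤ K, IsPGroup p R ∧
      (∀ k ∈ K, ∀ r ∈ R, k * r * k⁻¹ ∈ R) ∧ ∀ k ∈ K, k * z * k⁻¹ * z⁻¹ ∈ R) :
    ∃ k : ℕ, (Subgroup.centralizer {z}).index = p ^ k := by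
  refine ⟨_, Nat.eq_prime_pow_of_unique_prime_dvd Subgroup.index_ne_zero_of_finite ?_⟩
  intro q hq hd
  by_contra hqp
  have := Fact.mk hq
  obtain ⟨a0, ha0⟩ := hz.pow_eq_one
  obtain ⟨L, hL⟩ := (isPGroup_zpowers ha0).exists_le_sylow
  have hzL : z ∈ L := hL (Subgroup.mem_zpowers z)
  have hLz : ∀ g ∈ L, Commute g z := fun g hg =>
    hz.commute g L L.2 hzL (mul_mem (mul_mem hg hzL) (inv_mem hg))
  rcases eq_or_ne q ℓ with rfl | hqℓ
  · exact L.not_dvd_index (hd.trans (Subgroup.index_dvd_of_le fun g hg =>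
      mem_centralizer_self_iff.2 (hLz g hg)))
  · obtain ⟨A, -, hA, hAi⟩ :=
      (h.subgroup (L : Subgroup G)).exists_isCommSubgroup hℓ.out hp.out hℓp L.2
    set B := A.map (L : Subgroup G).subtype with hBdef
    have hBL : B ≤ L := by rintro _ ⟨x, -, rfl⟩; exact x.2
    have hBidx : B.index = A.index * (L : Subgroup G).index := by
      rw [← Subgroup.relIndex_mul_index hBL, Subgroup.relIndex, hBdef, Subgroup.subgroupOf,
        Subgroup.comap_map_eq_self_of_injective (L : Subgroup G).subtype_injective]
    obtain ⟨τ, hτ⟩ := (hA.map (L : Subgroup G).subtype).exists_hom_pow_index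
    have hBcomm : ∀ x y : B, x * y = y * x := fun x y =>
      Subtype.ext (hA.map (L : Subgroup G).subtype x x.2 y y.2)
    obtain ⟨y, hyL, b, m, hb, hm, hτy, Q, hQ⟩ := h.exists_centralizing hp.out hq hqp hqℓ L
      (L.2.to_le hBL) τ (fun g x => by simp only [map_mul, map_inv]; rw [hBcomm (τ g)]; group) z
    have hzy : Commute z y := (hLz y hyL).symm
    by_cases hy : ∀ g : G, Commute y g
    · have h1 := hτ 1 y fun k x _ => by
        rw [pow_one, mul_one, mul_assoc, ((hy x).pow_left k).eq]; group
      have h2 := hτ (fusionExponent n) z fun k x hx => by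
        have hc := hz.fusion k x⁻¹ L L.2 (pow_mem hzL k) (by rw [inv_inv]; exact hBL hx)
        have h3 := conj_pow (a := x⁻¹) (b := z ^ k) (i := fusionExponent n)
        rw [inv_inv, ← pow_mul, hc.eq] at h3
        rw [h3]; group
      rw [hτy, Subgroup.coe_pow] at h1
      simp only [pow_one, mul_one] at h1
      have h3 : z ^ (fusionExponent n * b * A.index * ((L : Subgroup G).index * m)) =
          y ^ (B.index * fusionExponent n) := by
        rw [pow_mul y, hBdef, ← h1, ← pow_mul, mul_comm (b * m),
          pow_mul ((τ z : B) : G), h2, ← pow_mul, ← hBdef, hBidx]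
        congr 1; ring
      have hcop : ℓ.Coprime ((L : Subgroup G).index * m) :=
        Nat.Coprime.mul_right ((Nat.Prime.coprime_iff_not_dvd hℓ.out).2 L.not_dvd_index) hm
      have hcent : ∀ g : G, Commute g z := by
        intro g
        have h4 := commute_pow_of_coprime (g := g) ⟨a0, ha0⟩ hcop
          (by rw [h3]; exact ((hy g).pow_left _).symm)
        obtain ⟨d, hdd⟩ : fusionExponent n * b * A.index ∣ gapExponent n :=
          mul_dvd_mul (mul_dvd_mul_left _ hb) (Nat.dvd_factorial
            (Nat.pos_of_ne_zero Subgroup.index_ne_zero_of_finite) hAi)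
        refine hz.gap g ?_
        rw [hdd, pow_mul]
        exact h4.pow_right d
      have h5 : Subgroup.centralizer {z} = ⊤ :=
        eq_top_iff.2 fun g _ => mem_centralizer_self_iff.2 (hcent g)
      rw [h5, Subgroup.index_top] at hd
      exact hq.one_lt.ne' (Nat.dvd_one.1 hd)
    · have hH : Subgroup.centralizer {y} ≠ ⊤ := fun ht => hy fun g =>
        (mem_centralizer_self_iff.1 (ht ▸ Subgroup.mem_top g)).symm
      have hzH : z ∈ Subgroup.centralizer {y} := mem_centralizer_self_iff.2 hzy
      obtain ⟨R, -, hR, hRn, hRz⟩ := hK _ hzH hH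
      refine hz.not_dvd_index hqp _ R hzH hR hRn hRz (fun hdvd => ?_) hd
      exact Q.not_dvd_index (hdvd.trans (Subgroup.index_dvd_of_le fun g hg =>
        mem_centralizer_self_iff.2 (hQ g hg).symm))

end

/-- A fusion-rigid element is central modulo a normal `p`-subgroup. -/
theorem IsFusionRigid.exists_normal_pGroup {n ℓ p : ℕ} [hp : Fact p.Prime] [hℓ : Fact ℓ.Prime]
    (hℓp : ℓ ≠ p) {G : Type*} [Group G] [Finite G] (h : IsLinearLike p n G) {z : G}
    (hz : IsFusionRigid n ℓ z) :
    ∃ R : Subgroup G, R.Normal ∧ IsPGroup p R ∧ ∀ g : G, g * z * g⁻¹ * z⁻¹ ∈ R := by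
  induction hN : Nat.card G using Nat.strong_induction_on generalizing G with
  | _ N ih =>
    have hK : ∀ K : Subgroup G, z ∈ K → K ≠ ⊤ → ∃ R ≤ K, IsPGroup p R ∧
        (∀ k ∈ K, ∀ r ∈ R, k * r * k⁻¹ ∈ R) ∧ ∀ k ∈ K, k * z * k⁻¹ * z⁻¹ ∈ R := by
      intro K hzK hKtop
      have hlt : Nat.card K < N := by
        rw [← hN]
        exact lt_of_le_of_ne (Subgroup.card_le_card_group K)
          fun h => hKtop (Subgroup.eq_top_of_card_eq K h)
      obtain ⟨R, hRn, hR, hRz⟩ := ih _ hlt (h.subgroup K)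
        (IsFusionRigid.subgroup (z := (⟨z, hzK⟩ : K)) hz) rfl
      refine ⟨R.map K.subtype, ?_, hR.map _, ?_, fun k hk => ⟨_, hRz ⟨k, hk⟩, rfl⟩⟩
      · rintro _ ⟨r, -, rfl⟩; exact r.2
      · rintro k hk _ ⟨r, hr, rfl⟩
        exact ⟨_, hRn.conj_mem r hr ⟨k, hk⟩, rfl⟩
    exact exists_normal_pGroup_commutator_mem z hz.pow_eq_one (fun g L => hz.commute g L) hK
      (hz.exists_index_eq_pow h hℓp hK)

section
open Pointwise

section
variable {G : Type*} [Group G]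

/-- The commutative subgroups of order `m` of a subgroup. -/
def commFamily (m : ℕ) (R : Subgroup G) : Set (Subgroup G) :=
  {B | B ≤ R ∧ IsCommSubgroup B ∧ Nat.card B = m}

/-- The Thompson subgroup. -/
def thompsonSubgroup (m : ℕ) (R : Subgroup G) : Subgroup G := sSup (commFamily m R)

/-- The intersection of the commutative subgroups of order `m`. -/
def thompsonInf (m : ℕ) (R : Subgroup G) : Subgroup G := sInf (commFamily m R)

theorem IsCommSubgroup.smul {A : Subgroup G} (hA : IsCommSubgroup A) (g : G) :
    IsCommSubgroup (MulAut.conj g • A) := hA.map _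

theorem smul_mem_commFamily {m : ℕ} {R B : Subgroup G} (h : B ∈ commFamily m R) (g : G) :
    MulAut.conj g • B ∈ commFamily m (MulAut.conj g • R) :=
  ⟨Subgroup.pointwise_smul_le_pointwise_smul_iff.2 h.1, h.2.1.smul g,
    (Nat.card_congr (Subgroup.equivSMul (MulAut.conj g) B).toEquiv).symm.trans h.2.2⟩

theorem commFamily_mono {m : ℕ} {R S : Subgroup G} (h : R ≤ S) : commFamily m R ⊆ commFamily m S :=
  fun _ hB => ⟨hB.1.trans h, hB.2⟩

theorem thompsonSubgroup_le (m : ℕ) (R : Subgroup G) : thompsonSubgroup m R ≤ R :=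
  sSup_le fun _ hB => hB.1

theorem commFamily_thompsonSubgroup (m : ℕ) (R : Subgroup G) :
    commFamily m (thompsonSubgroup m R) = commFamily m R :=
  (commFamily_mono (thompsonSubgroup_le m R)).antisymm fun _ hB => ⟨le_sSup hB, hB.2⟩

theorem smul_thompsonSubgroup_le (m : ℕ) (R : Subgroup G) (g : G) :
    MulAut.conj g • thompsonSubgroup m R ≤ thompsonSubgroup m (MulAut.conj g • R) :=
  Subgroup.pointwise_smul_subset_iff.2 <| sSup_le fun _ hB =>
    Subgroup.pointwise_smul_subset_iff.1 (le_sSup (smul_mem_commFamily hB g))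

theorem thompsonSubgroup_smul (m : ℕ) (R : Subgroup G) (g : G) :
    thompsonSubgroup m (MulAut.conj g • R) = MulAut.conj g • thompsonSubgroup m R := by
  refine le_antisymm ?_ (smul_thompsonSubgroup_le m R g)
  have := smul_thompsonSubgroup_le m (MulAut.conj g • R) g⁻¹
  rw [map_inv, inv_smul_smul] at this
  exact Subgroup.subset_pointwise_smul_iff.2 this

theorem conj_mem_thompsonInf {m : ℕ} {R : Subgroup G} {x : G} (hx : x ∈ thompsonInf m R) (g : G) :
    g * x * g⁻¹ ∈ thompsonInf m (MulAut.conj g • R) := by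
  rw [thompsonInf, Subgroup.mem_sInf] at hx ⊢
  intro B hB
  have h1 := smul_mem_commFamily hB g⁻¹
  rw [map_inv, inv_smul_smul] at h1
  have h2 := Subgroup.smul_mem_pointwise_smul _ (MulAut.conj g) _ (hx _ h1)
  rwa [smul_inv_smul] at h2

theorem conj_mem_thompsonInf_of_smul_eq {m : ℕ} {R : Subgroup G} {x g : G}
    (hx : x ∈ thompsonInf m R)
    (hg : MulAut.conj g • thompsonSubgroup m R = thompsonSubgroup m R) :
    g * x * g⁻¹ ∈ thompsonInf m R := by
  have h : thompsonInf m (thompsonSubgroup m R) = thompsonInf m R := by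
    rw [thompsonInf, commFamily_thompsonSubgroup, thompsonInf]
  rw [← h] at hx ⊢
  have := conj_mem_thompsonInf hx g
  rwa [hg] at this

theorem commute_of_mem_thompsonInf {m : ℕ} {R : Subgroup G} {x : G} (hx : x ∈ thompsonInf m R) :
    thompsonSubgroup m R ≤ Subgroup.centralizer {x} :=
  sSup_le fun B hB b hb => mem_centralizer_self_iff.2
    (hB.2.1 b hb x (Subgroup.mem_sInf.1 hx B hB))

variable {ℓ m : ℕ} [hℓ : Fact ℓ.Prime] [Finite G]

theorem commFamily_nonempty
    (hm : ∃ B : Subgroup G, IsPGroup ℓ B ∧ IsCommSubgroup B ∧ Nat.card B = m)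
    (P : Sylow ℓ G) : (commFamily m (P : Subgroup G)).Nonempty := by
  obtain ⟨B, hB, hBc, hBm⟩ := hm
  obtain ⟨P', hP'⟩ := hB.exists_le_sylow
  obtain ⟨g, rfl⟩ := MulAction.exists_smul_eq G P' P
  exact ⟨_, smul_mem_commFamily (⟨hP', hBc, hBm⟩ : B ∈ commFamily m P') g⟩

theorem card_thompsonSubgroup_eq (P P' : Sylow ℓ G) :
    Nat.card (thompsonSubgroup m (P : Subgroup G)) =
      Nat.card (thompsonSubgroup m (P' : Subgroup G)) := by
  obtain ⟨g, rfl⟩ := MulAction.exists_smul_eq G P P'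
  rw [Sylow.coe_subgroup_smul, thompsonSubgroup_smul]
  exact Nat.card_congr (Subgroup.equivSMul (MulAut.conj g) _).toEquiv

theorem exists_smul_thompsonSubgroup_eq (P₁ P₂ : Sylow ℓ G) {s : G}
    (h₁ : s ∈ thompsonInf m (P₁ : Subgroup G)) (h₂ : s ∈ thompsonInf m (P₂ : Subgroup G)) :
    ∃ c : G, Commute c s ∧
      MulAut.conj c • thompsonSubgroup m (P₁ : Subgroup G) =
        thompsonSubgroup m (P₂ : Subgroup G) := by
  set C := Subgroup.centralizer {s} with hC
  have hJ : ∀ P : Sylow ℓ G, s ∈ thompsonInf m (P : Subgroup G) →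
      ∃ S : Sylow ℓ C, thompsonSubgroup m (P : Subgroup G) ≤ (S : Subgroup C).map C.subtype := by
    intro P hP
    have h1 := commute_of_mem_thompsonInf hP
    obtain ⟨S, hS⟩ := ((P.2.to_le (thompsonSubgroup_le m (P : Subgroup G))).comap_subtype
      (K := C)).exists_le_sylow
    exact ⟨S, fun x hx => ⟨⟨x, h1 hx⟩, hS hx, rfl⟩⟩
  obtain ⟨S₁, hS₁⟩ := hJ P₁ h₁
  obtain ⟨S₂, hS₂⟩ := hJ P₂ h₂
  obtain ⟨c, rfl⟩ := MulAction.exists_smul_eq C S₁ S₂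
  obtain ⟨P₃, hP₃⟩ := ((c • S₁).2.map C.subtype).exists_le_sylow
  have hle : ∀ P : Sylow ℓ G, ∀ g : G, MulAut.conj g • thompsonSubgroup m (P : Subgroup G) ≤ P₃ →
      MulAut.conj g • thompsonSubgroup m (P : Subgroup G) =
        thompsonSubgroup m (P₃ : Subgroup G) := by
    intro P g h
    refine Subgroup.eq_of_le_of_card_ge ?_ ?_
    · rw [Subgroup.pointwise_smul_subset_iff]
      refine sSup_le fun B hB => ?_
      rw [← Subgroup.pointwise_smul_subset_iff]
      refine le_sSup ⟨?_, (smul_mem_commFamily hB g).2⟩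
      exact (Subgroup.pointwise_smul_le_pointwise_smul_iff.2 (le_sSup hB)).trans h
    · rw [card_thompsonSubgroup_eq P₃ P]
      exact (Nat.card_congr (Subgroup.equivSMul (MulAut.conj g) _).toEquiv).le
  refine ⟨c, mem_centralizer_self_iff.1 c.2, ?_⟩
  rw [hle P₁ c, ← hle P₂ 1]
  · simp
  · simpa using hS₂.trans hP₃
  · refine le_trans ?_ hP₃
    intro x hx
    obtain ⟨y, hy, rfl⟩ := (Subgroup.mem_smul_pointwise_iff_exists _ _ _).1 hx
    obtain ⟨t, ht, rfl⟩ := hS₁ hy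
    exact ⟨_, Subgroup.smul_mem_pointwise_smul _ (MulAut.conj c) _ ht, rfl⟩

theorem pow_mem_thompsonInf {p n : ℕ} (h : IsLinearLike p n G) (hp : p.Prime) (hℓp : ℓ ≠ p)
    (hm : ∀ B : Subgroup G, IsPGroup ℓ B → IsCommSubgroup B → Nat.card B ≤ m) (P : Sylow ℓ G)
    {x : G} (hx : x ∈ P) : x ^ fusionExponent n ∈ thompsonInf m (P : Subgroup G) := by
  rw [thompsonInf, Subgroup.mem_sInf]
  intro B hB
  obtain ⟨A, -, hA, hAi⟩ := (h.subgroup (P : Subgroup G)).exists_isCommSubgroup hℓ.out hp hℓp P.2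
  have h1 : Nat.card A ≤ Nat.card B := by
    rw [hB.2.2, Nat.card_congr (A.equivMapOfInjective _ (P : Subgroup G).subtype_injective).toEquiv]
    exact hm _ ((P.2.to_subgroup A).map _) (hA.map _)
  have h2 : B.relIndex P ≤ n ^ n := by
    have h3 := A.card_mul_index
    rw [← Subgroup.relIndex_bot_left (H := (P : Subgroup G)),
      ← Subgroup.relIndex_mul_relIndex ⊥ B P bot_le hB.1, Subgroup.relIndex_bot_left] at h3
    have h4 : Nat.card A * B.relIndex P ≤ Nat.card A * A.index := by
      rw [h3]; exact Nat.mul_le_mul_right _ h1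
    exact (Nat.le_of_mul_le_mul_left h4 Nat.card_pos).trans hAi
  exact (Subgroup.pow_mem_of_relIndex_ne_zero_of_dvd (H := B) (K := P)
    (Subgroup.index_ne_zero_of_finite (H := B.subgroupOf P)) hx
    fun k hk hk2 => Nat.dvd_factorial hk (hk2.trans h2)).1

theorem commute_pow_of_mem_thompsonInf {p n : ℕ} (h : IsLinearLike p n G) (hp : p.Prime)
    (hℓp : ℓ ≠ p) (hm : ∀ B : Subgroup G, IsPGroup ℓ B → IsCommSubgroup B → Nat.card B ≤ m)
    (P : Sylow ℓ G) {z : G} (hz : z ∈ thompsonInf m (P : Subgroup G))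
    (hzN : ∀ g : G, MulAut.conj g • thompsonSubgroup m (P : Subgroup G) =
      thompsonSubgroup m (P : Subgroup G) → Commute g z) (r : ℕ) (g : G) (R : Subgroup G)
    (hR : IsPGroup ℓ R) (h1 : z ^ r ∈ R) (h2 : g * z ^ r * g⁻¹ ∈ R) :
    Commute g (z ^ (r * fusionExponent n)) := by
  obtain ⟨P', hP'⟩ := hR.exists_le_sylow
  set s := z ^ (r * fusionExponent n) with hs
  have hs1 : s ∈ thompsonInf m (P : Subgroup G) := pow_mem hz _
  have hs2 : s ∈ thompsonInf m (P' : Subgroup G) := by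
    rw [hs, pow_mul]; exact pow_mem_thompsonInf h hp hℓp hm P' (hP' h1)
  have hg1 : g * s * g⁻¹ ∈ thompsonInf m ((g • P : Sylow ℓ G) : Subgroup G) := by
    rw [Sylow.coe_subgroup_smul]; exact conj_mem_thompsonInf hs1 g
  have hg2 : g * s * g⁻¹ ∈ thompsonInf m (P' : Subgroup G) := by
    rw [hs, pow_mul, ← conj_pow]; exact pow_mem_thompsonInf h hp hℓp hm P' (hP' h2)
  obtain ⟨c, hc, hcJ⟩ := exists_smul_thompsonSubgroup_eq P P' hs1 hs2
  obtain ⟨d, hd, hdJ⟩ := exists_smul_thompsonSubgroup_eq (g • P) P' hg1 hg2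
  rw [Sylow.coe_subgroup_smul, thompsonSubgroup_smul] at hdJ
  have h3 : Commute (c⁻¹ * (d * g)) s := by
    refine (hzN _ ?_).pow_right _
    rw [map_mul, map_mul, mul_smul, mul_smul, hdJ, ← hcJ, map_inv, inv_smul_smul]
  have h4 : Commute (d * g) s := by simpa using hc.mul_left h3
  have h5 : d * (g * s * g⁻¹) * d⁻¹ = g * s * g⁻¹ := by rw [hd.eq]; group
  have h6 : g * s * g⁻¹ = s := by
    rw [← h5]
    calc d * (g * s * g⁻¹) * d⁻¹ = d * g * s * (d * g)⁻¹ := by group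
      _ = s := by rw [h4.eq]; group
  exact mul_inv_eq_iff_eq_mul.1 h6

theorem IsLinearLike.exists_invariant {p n : ℕ} (h : IsLinearLike p n G) (A : Subgroup G)
    (hA : IsCommSubgroup A) (hc : (Nat.card A).Coprime p) (N : Set G)
    (hN1 : 1 ∈ N) (hN2 : ∀ g ∈ N, ∀ g' ∈ N, g * g' ∈ N)
    (hN : ∀ g ∈ N, ∀ a ∈ A, g * a * g⁻¹ ∈ A) {a : G} (ha : a ∈ A) :
    ∃ z ∈ A, (∀ g ∈ N, Commute g z) ∧ ∃ k : ℕ, 0 < k ∧ k ≤ n ^ n ∧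
      ∀ (C : Type) [CommGroup C] (f : G →* C), f z = f a ^ k := by
  classical
  obtain ⟨σ, hσ⟩ := h.action A hA hc
  let _ : CommGroup A := { (inferInstance : Group A) with
    mul_comm := fun x y => Subtype.ext (hA x x.2 y y.2) }
  have : Fintype A := Fintype.ofFinite A
  let O : Finset A := Finset.univ.filter fun b => ∃ g ∈ N, (b : G) = g * a * g⁻¹
  have hO : ∀ b, b ∈ O ↔ ∃ g ∈ N, (b : G) = g * a * g⁻¹ := fun b => by simp [O]
  refine ⟨(∏ b ∈ O, b : A), (∏ b ∈ O, b : A).2, fun g hg => ?_, O.card,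
    Finset.card_pos.2 ⟨⟨a, ha⟩, (hO _).2 ⟨1, hN1, by simp⟩⟩, ?_, fun C _ f => ?_⟩
  · let φ : A →* A :=
      { toFun := fun x => ⟨g * x * g⁻¹, hN g hg x x.2⟩
        map_one' := Subtype.ext (by simp)
        map_mul' := fun x y => Subtype.ext (by simp) }
    have hφ : Function.Injective φ := fun x y hxy => Subtype.ext (by
      have := congrArg Subtype.val hxy
      simpa [φ] using this)
    have h1 : O.image φ = O := by
      refine Finset.eq_of_subset_of_card_le ?_ (Finset.card_image_of_injective _ hφ).ge
      intro b hb
      obtain ⟨x, hx, rfl⟩ := Finset.mem_image.1 hb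
      obtain ⟨g', hg', hx'⟩ := (hO x).1 hx
      exact (hO _).2 ⟨g * g', hN2 g hg g' hg', by
        simp only [φ, MonoidHom.coe_mk, OneHom.coe_mk, hx']; group⟩
    have h2 : φ (∏ b ∈ O, b) = ∏ b ∈ O, b := by
      rw [map_prod]
      conv_rhs => rw [← h1, Finset.prod_image fun x _ y _ hxy => hφ hxy]
    exact mul_inv_eq_iff_eq_mul.1 (congrArg Subtype.val h2)
  · have hsel : ∀ b : O, ∃ g ∈ N, ((b : A) : G) = g * a * g⁻¹ := fun b => (hO _).1 b.2
    choose γ hγ hγ' using hsel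
    have hinj : Function.Injective fun b : O => σ (γ b) := by
      intro b b' hbb
      refine Subtype.ext (Subtype.ext ?_)
      rw [hγ', hγ']
      exact hσ _ _ (hN _ (hγ b)) (hN _ (hγ b')) hbb a ha
    have := Fintype.card_le_of_injective _ hinj
    simpa using this
  · have h1 : f ((∏ b ∈ O, b : A) : G) = (f.comp A.subtype) (∏ b ∈ O, b) := rfl
    rw [h1, map_prod, Finset.prod_congr rfl (g := fun _ => f a), Finset.prod_const]
    intro b hb
    obtain ⟨g, -, hg⟩ := (hO b).1 hb
    simp [hg, mul_comm]

end

end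

section
open Pointwise

/-- The loss of order in passing to a fusion-rigid element. -/
abbrev rigidityLoss (n : ℕ) : ℕ := fusionExponent n * n ^ n * gapExponent n ^ (n * n)

section
variable {G : Type*} [Group G] {n ℓ p : ℕ}

theorem exists_pow_gap {F : Type*} [Field F] (ρ : G →* Matrix (Fin n) (Fin n) F)
    (hρ : Function.Injective ρ) (z : G) (b : ℕ) :
    ∃ j ≤ n * n, ∀ g : G, Commute g (z ^ b ^ (j + 1)) → Commute g (z ^ b ^ j) := by
  let V : ℕ → Submodule F (Matrix (Fin n) (Fin n) F) := fun j =>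
    (Subalgebra.centralizer F {ρ (z ^ b ^ j)}).toSubmodule
  have hmem : ∀ j X, X ∈ V j ↔ ρ (z ^ b ^ j) * X = X * ρ (z ^ b ^ j) := fun j X => by
    simp [V, Subalgebra.mem_centralizer_iff]
  have hmono : ∀ j, V j ≤ V (j + 1) := fun j X hX => by
    rw [hmem] at hX ⊢
    rw [pow_succ, pow_mul, map_pow]
    exact Commute.pow_left hX b
  obtain ⟨j, hj, hV⟩ : ∃ j ≤ n * n, V j = V (j + 1) := by
    by_contra! hne
    have h1 : ∀ j ≤ n * n + 1, j ≤ Module.finrank F (V j) := by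
      intro j hj
      induction j with
      | zero => exact Nat.zero_le _
      | succ j ih =>
        exact (ih (by omega)).trans_lt
          (Submodule.finrank_lt_finrank_of_lt ((hmono j).lt_of_ne (hne j (by omega))))
    have h2 := (h1 _ le_rfl).trans (Submodule.finrank_le _)
    simp [Module.finrank_matrix] at h2
  refine ⟨j, hj, fun g hg => ?_⟩
  have h1 : ρ g ∈ V (j + 1) := (hmem _ _).2 (hg.symm.map ρ)
  rw [← hV, hmem, ← map_mul, ← map_mul] at h1
  exact (hρ h1).symm

theorem IsLinearLike.exists_isFusionRigid [Finite G] {F : Type*} [Field F]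
    (ρ : G →* Matrix (Fin n) (Fin n) F) (hρ : Function.Injective ρ) (h : IsLinearLike p n G)
    (hp : p.Prime) [hℓ : Fact ℓ.Prime] (hℓp : ℓ ≠ p) {x : G} (hx : ∃ a : ℕ, x ^ ℓ ^ a = 1) :
    ∃ z : G, IsFusionRigid n ℓ z ∧ ∃ k : ℕ, 0 < k ∧ k ≤ rigidityLoss n ∧
      ∀ (C : Type) [CommGroup C] (f : G →* C), f z = f x ^ k := by
  obtain ⟨B0, hB0, hmax⟩ := Set.exists_max_image
    {B : Subgroup G | IsPGroup ℓ B ∧ IsCommSubgroup B} (fun B => Nat.card B) (Set.toFinite _)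
    ⟨⊥, IsPGroup.of_bot, fun a ha b hb => by
      rw [Subgroup.mem_bot.1 ha, Subgroup.mem_bot.1 hb]⟩
  set m := Nat.card B0 with hm
  have hm' : ∀ B : Subgroup G, IsPGroup ℓ B → IsCommSubgroup B → Nat.card B ≤ m :=
    fun B h1 h2 => hmax B ⟨h1, h2⟩
  obtain ⟨a, ha⟩ := hx
  obtain ⟨P, hP⟩ := (isPGroup_zpowers ha).exists_le_sylow
  have hxP : x ∈ P := hP (Subgroup.mem_zpowers x)
  set A := thompsonInf m (P : Subgroup G) with hAdef
  obtain ⟨B, hB⟩ := commFamily_nonempty ⟨B0, hB0.1, hB0.2, rfl⟩ P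
  have hAB : A ≤ B := sInf_le hB
  have hA : IsCommSubgroup A := fun u hu v hv => hB.2.1 u (hAB hu) v (hAB hv)
  have hAp : IsPGroup ℓ A := P.2.to_le (hAB.trans hB.1)
  obtain ⟨z0, hz0, hzN, k, hk0, hk, hf⟩ := h.exists_invariant A hA (hAp.card_coprime hℓ.out hp hℓp)
    {g | MulAut.conj g • thompsonSubgroup m (P : Subgroup G) = thompsonSubgroup m (P : Subgroup G)}
    (by simp) (fun g hg g' hg' => by
      rw [Set.mem_ofPred_eq] at hg hg' ⊢; rw [map_mul, mul_smul, hg', hg])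
    (fun g hg u hu => conj_mem_thompsonInf_of_smul_eq hu hg)
    (pow_mem_thompsonInf h hp hℓp hm' P hxP)
  obtain ⟨j, hj, hgap⟩ := exists_pow_gap ρ hρ z0 (gapExponent n)
  have hgap0 : 0 < gapExponent n := by
    have h1 : 0 < innerExponent n := Nat.mul_pos (Nat.mul_pos (Nat.factorial_pos _)
      (Nat.factorial_pos _)) (Nat.factorial_pos _)
    exact Nat.mul_pos (Nat.mul_pos (Nat.factorial_pos _) h1) (Nat.factorial_pos _)
  refine ⟨z0 ^ gapExponent n ^ j, ⟨?_, fun r g R hR h1 h2 => ?_, fun g hg => hgap g ?_⟩,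
    fusionExponent n * k * gapExponent n ^ j, ?_, ?_, fun C _ f => ?_⟩
  · obtain ⟨b, hb⟩ := hAp ⟨z0, hz0⟩
    refine ⟨b, ?_⟩
    have hb' : z0 ^ ℓ ^ b = 1 := congrArg Subtype.val hb
    rw [← pow_mul, mul_comm, pow_mul, hb', one_pow]
  · rw [← pow_mul] at h1 h2 ⊢
    have := commute_pow_of_mem_thompsonInf h hp hℓp hm' P hz0 hzN _ g R hR h1 h2
    rwa [mul_assoc] at this
  · rwa [pow_succ, pow_mul]
  · exact Nat.mul_pos (Nat.mul_pos (Nat.factorial_pos _) hk0) (Nat.pow_pos hgap0)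
  · exact Nat.mul_le_mul (Nat.mul_le_mul_left _ hk) (Nat.pow_le_pow_right hgap0 hj)
  · rw [map_pow, hf, map_pow, ← pow_mul, ← pow_mul, mul_assoc]

/-- An element of `ℓ`-power order whose image under `f` still generates. -/
theorem exists_pow_eq_one_of_surjective [Finite G] [hℓ : Fact ℓ.Prime] {a : ℕ}
    (f : G →* Multiplicative (ZMod (ℓ ^ a))) (hf : Function.Surjective f) :
    ∃ x : G, (∃ b : ℕ, x ^ ℓ ^ b = 1) ∧ orderOf (f x) = ℓ ^ a := by
  obtain ⟨y, hy⟩ := hf (Multiplicative.ofAdd 1)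
  have ho : orderOf y ≠ 0 := (orderOf_pos y).ne'
  refine ⟨y ^ (orderOf y / ℓ ^ (orderOf y).factorization ℓ), ⟨(orderOf y).factorization ℓ, ?_⟩, ?_⟩
  · rw [← pow_mul, mul_comm, Nat.ordProj_mul_ordCompl_eq_self, pow_orderOf_eq_one]
  · have h1 : orderOf (Multiplicative.ofAdd (1 : ZMod (ℓ ^ a))) = ℓ ^ a := by
      rw [orderOf_ofAdd_eq_addOrderOf, ZMod.addOrderOf_one]
    rw [map_pow, hy, Nat.Coprime.orderOf_pow, h1]
    rw [h1]
    exact (Nat.coprime_ordCompl hℓ.out ho).pow_left a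

theorem exists_mem_center_of_surjective [Finite G] {F : Type*} [Field F]
    (ρ : G →* Matrix (Fin n) (Fin n) F) (hρ : Function.Injective ρ) (h : IsLinearLike p n G)
    (hp : p.Prime) (hℓ : ℓ.Prime) (hℓp : ℓ ≠ p)
    (hG : ∀ R : Subgroup G, R.Normal → IsPGroup p R → R = ⊥) {a : ℕ}
    (f : G →* Multiplicative (ZMod (ℓ ^ a))) (hf : Function.Surjective f) :
    ∃ z ∈ Subgroup.center G, ℓ ^ a ≤ rigidityLoss n * orderOf z ∧ (orderOf z).Coprime p := by
  have := Fact.mk hp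
  have := Fact.mk hℓ
  obtain ⟨x, hx, hfx⟩ := exists_pow_eq_one_of_surjective f hf
  obtain ⟨z, hz, k, hk0, hk, hfz⟩ := h.exists_isFusionRigid ρ hρ hp hℓp hx
  obtain ⟨R, hRn, hRp, hR⟩ := hz.exists_normal_pGroup hℓp h
  refine ⟨z, ?_, ?_, ?_⟩
  · rw [Subgroup.mem_center_iff]
    intro g
    have h1 := hR g
    rw [hG R hRn hRp, Subgroup.mem_bot, mul_inv_eq_one] at h1
    exact mul_inv_eq_iff_eq_mul.1 h1
  · have h1 : f x ^ (k * orderOf z) = 1 := by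
      rw [pow_mul, ← hfz, ← map_pow, pow_orderOf_eq_one, map_one]
    have h2 := orderOf_dvd_of_pow_eq_one h1
    rw [hfx] at h2
    exact (Nat.le_of_dvd (Nat.mul_pos hk0 (orderOf_pos z)) h2).trans (Nat.mul_le_mul_right _ hk)
  · obtain ⟨b, hb⟩ := hz.pow_eq_one
    exact Nat.Coprime.coprime_dvd_left (orderOf_dvd_of_pow_eq_one hb)
      (((Nat.coprime_primes hℓ hp).2 hℓp).pow_left b)

end

end

section
attribute [local instance] LieRing.ofAssociativeRing

variable {K M : Type*} [Field K] [AddCommGroup M] [Module K M]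

theorem LieModule.exists_range_toEnd_pow_eq_bot {L : Type*} [LieRing L] [LieAlgebra K L]
    [LieRingModule L M] [LieModule K L M] (h : LieModule.IsNilpotent L M) :
    ∃ N : ℕ, (LinearMap.range (LieModule.toEnd K L M : L →ₗ[K] Module.End K M)) ^ N = ⊥ := by
  obtain ⟨N, hN⟩ := (LieModule.isNilpotent_iff K L M).1 h
  refine ⟨N, ?_⟩
  have key : ∀ k : ℕ, ∀ a ∈ (LinearMap.range
      (LieModule.toEnd K L M : L →ₗ[K] Module.End K M)) ^ k, ∀ m : M,
      a m ∈ LieModule.lowerCentralSeries K L M k := by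
    intro k
    induction k with
    | zero => intro a _ m; simp
    | succ k ih =>
      intro a ha m
      rw [pow_succ'] at ha
      induction ha using Submodule.mul_induction_on' with
      | mem_mul_mem x hx y hy =>
        obtain ⟨l, rfl⟩ := hx
        rw [LieModule.lowerCentralSeries_succ]
        exact LieSubmodule.lie_mem_lie (LieSubmodule.mem_top l) (ih y hy m)
      | add x _ y _ hx hy => exact add_mem hx hy
  rw [eq_bot_iff]
  intro a ha
  rw [Submodule.mem_bot]
  ext m
  simpa [hN] using key N a ha m

theorem exists_span_commutator_pow_eq_bot [CharZero K] [FiniteDimensional K M]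
    (I : Submodule K (Module.End K M)) (hI : ∀ x ∈ I, ∀ y ∈ I, x * y - y * x ∈ I)
    (htr : ∀ x ∈ I, ∀ y ∈ I, LinearMap.trace K M (x * y) = 0) :
    ∃ N : ℕ, (Submodule.span K {z | ∃ x ∈ I, ∃ y ∈ I, z = x * y - y * x}) ^ N = ⊥ := by
  let L : LieSubalgebra K (Module.End K M) := { I with lie_mem' := fun {x y} hx hy => hI x hx y hy }
  have h0 : LieModule.traceForm K L M = 0 := by
    ext x y
    exact htr x x.2 y y.2
  obtain ⟨N, hN⟩ := LieModule.exists_range_toEnd_pow_eq_bot (K := K)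
    (LieModule.isNilpotent_derivedSeries_of_traceForm_eq_zero h0)
  refine ⟨N, ?_⟩
  rw [eq_bot_iff, ← hN]
  refine pow_le_pow_left' (?_ : _ ≤ _) N
  rw [Submodule.span_le]
  rintro _ ⟨x, hx, y, hy, rfl⟩
  have : ⁅(⟨x, hx⟩ : L), (⟨y, hy⟩ : L)⁆ ∈ LieAlgebra.derivedSeries K L 1 :=
    LieSubmodule.lie_mem_lie (LieSubmodule.mem_top _) (LieSubmodule.mem_top _)
  exact ⟨⟨_, this⟩, rfl⟩

theorem exists_pow_eq_bot_of_isNilpotent [FiniteDimensional K M]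
    (I : Submodule K (Module.End K M)) (hI : ∀ x ∈ I, ∀ y ∈ I, x * y - y * x ∈ I)
    (hnil : ∀ x ∈ I, IsNilpotent x) : ∃ N : ℕ, I ^ N = ⊥ := by
  let L : LieSubalgebra K (Module.End K M) := { I with lie_mem' := fun {x y} hx hy => hI x hx y hy }
  obtain ⟨N, hN⟩ := LieModule.exists_range_toEnd_pow_eq_bot (K := K) (L := L) (M := M)
    ((LieModule.isNilpotent_iff_forall' (R := K)).2 fun x => hnil x x.2)
  refine ⟨N, ?_⟩
  rw [eq_bot_iff, ← hN]
  exact pow_le_pow_left' (fun x hx => ⟨⟨x, hx⟩, rfl⟩) N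

end

theorem TwoSidedIdeal.isNilpotent_add {R : Type*} [Ring R] (J : TwoSidedIdeal R)
    (hJ : ∀ x ∈ J, IsNilpotent x) {x y : R} (hx : IsNilpotent x) (hy : IsNilpotent y)
    (hxy : x * y - y * x ∈ J) : IsNilpotent (x + y) := by
  have hcomm : Commute (J.ringCon.mk' x) (J.ringCon.mk' y) := by
    rw [commute_iff_eq, ← map_mul, ← map_mul]
    exact (RingCon.eq _).2 ((J.rel_iff _ _).2 hxy)
  obtain ⟨N, hN⟩ := hcomm.isNilpotent_add (hx.map _) (hy.map _)
  rw [← map_add, ← map_pow, ← map_zero J.ringCon.mk'] at hN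
  obtain ⟨m, hm⟩ := hJ _ ((J.mem_iff _).2 ((RingCon.eq _).1 hN))
  exact ⟨N * m, by rw [pow_mul, hm]⟩

section
variable {K A G : Type*} [Field K] [Ring A] [Algebra K A] [Group G]

/-- The linear span of the image of a group representation. -/
def repSpan (ρ : G →* A) : Submodule K A := Submodule.span K (Set.range ρ)

/-- A subspace is stable under conjugation by the image of a group representation. -/
def IsConjStable (ρ : G →* A) (V : Submodule K A) : Prop :=
  ∀ g, ∀ v ∈ V, ρ g * v * ρ g⁻¹ ∈ V

theorem mem_repSpan (ρ : G →* A) (g : G) : ρ g ∈ repSpan (K := K) ρ :=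
  Submodule.subset_span ⟨g, rfl⟩

theorem one_mem_repSpan (ρ : G →* A) : (1 : A) ∈ repSpan (K := K) ρ := by
  simpa using mem_repSpan (K := K) ρ 1

theorem repSpan_mul_self_le (ρ : G →* A) :
    repSpan (K := K) ρ * repSpan (K := K) ρ ≤ repSpan ρ := by
  rw [repSpan, Submodule.span_mul_span, Submodule.span_le]
  rintro _ ⟨_, ⟨g, rfl⟩, _, ⟨h, rfl⟩, rfl⟩
  have := mem_repSpan (K := K) ρ (g * h)
  rwa [map_mul] at this

theorem repSpan_pow_le (ρ : G →* A) {N : ℕ} (hN : N ≠ 0) :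
    repSpan (K := K) ρ ^ N ≤ repSpan ρ := by
  induction N with
  | zero => exact absurd rfl hN
  | succ N ih =>
    rcases eq_or_ne N 0 with rfl | h
    · simp
    · rw [pow_succ]
      exact (mul_le_mul' (ih h) le_rfl).trans (repSpan_mul_self_le ρ)

theorem IsConjStable.commute_repSpan {ρ : G →* A} {V : Submodule K A} (hV : IsConjStable ρ V) :
    Commute V (repSpan ρ) := by
  have hinv : ∀ g, ρ g * ρ g⁻¹ = 1 := fun g => by rw [← map_mul, mul_inv_cancel, map_one]
  have hinv' : ∀ g, ρ g⁻¹ * ρ g = 1 := fun g => by rw [← map_mul, inv_mul_cancel, map_one]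
  apply le_antisymm
  · rw [Submodule.mul_le]
    intro v hv e he
    induction he using Submodule.span_induction with
    | mem x hx =>
      obtain ⟨g, rfl⟩ := hx
      have := Submodule.mul_mem_mul (mem_repSpan (K := K) ρ g) (hV g⁻¹ v hv)
      rwa [inv_inv, ← mul_assoc, ← mul_assoc, hinv, one_mul] at this
    | zero => simp
    | add x y _ _ hx hy => rw [mul_add]; exact add_mem hx hy
    | smul c x _ hx => rw [mul_smul_comm]; exact Submodule.smul_mem _ c hx
  · rw [Submodule.mul_le]
    intro e he v hv
    induction he using Submodule.span_induction with
    | mem x hx =>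
      obtain ⟨g, rfl⟩ := hx
      have := Submodule.mul_mem_mul (hV g v hv) (mem_repSpan (K := K) ρ g)
      rwa [mul_assoc, hinv', mul_one] at this
    | zero => simp
    | add x y _ _ hx hy => rw [add_mul]; exact add_mem hx hy
    | smul c x _ hx => rw [smul_mul_assoc]; exact Submodule.smul_mem _ c hx

theorem IsConjStable.mul_repSpan_pow_eq_bot {ρ : G →* A} {V : Submodule K A}
    (hV : IsConjStable ρ V) {N : ℕ} (hN : V ^ N = ⊥) : (V * repSpan ρ) ^ N = ⊥ := by
  rw [hV.commute_repSpan.mul_pow, hN, Submodule.bot_mul]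

theorem isNilpotent_of_pow_eq_bot {V : Submodule K A} {N : ℕ} (hN : V ^ N = ⊥) {x : A}
    (hx : x ∈ V) : IsNilpotent x :=
  ⟨N, by simpa [hN] using Submodule.pow_mem_pow V hx N⟩

theorem IsConjStable.isNilpotent_add {ρ : G →* A} {V : Submodule K A}
    (hV : IsConjStable ρ V) {N : ℕ} (hN : V ^ N = ⊥) {x y : A}
    (hxE : x ∈ repSpan (K := K) ρ) (hyE : y ∈ repSpan (K := K) ρ) (hx : IsNilpotent x)
    (hy : IsNilpotent y) (hxy : x * y - y * x ∈ V) : IsNilpotent (x + y) := by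
  let E : Subalgebra K A := (repSpan (K := K) ρ).toSubalgebra (one_mem_repSpan ρ)
    fun a b ha hb => repSpan_mul_self_le ρ (Submodule.mul_mem_mul ha hb)
  let J : TwoSidedIdeal E := TwoSidedIdeal.mk' {a | (a : A) ∈ V * repSpan (K := K) ρ}
    (by simp) (fun {a b} (ha : (a : A) ∈ V * repSpan (K := K) ρ)
      (hb : (b : A) ∈ V * repSpan (K := K) ρ) => add_mem ha hb)
    (fun {a} (ha : (a : A) ∈ V * repSpan (K := K) ρ) => neg_mem ha)
    (fun {a b} (hb : (b : A) ∈ V * repSpan (K := K) ρ) => by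
      have := Submodule.mul_mem_mul a.2 hb
      change (a : A) * b ∈ repSpan (K := K) ρ * (V * repSpan ρ) at this
      rw [← mul_assoc, ← hV.commute_repSpan.eq, mul_assoc] at this
      exact mul_le_mul' le_rfl (repSpan_mul_self_le ρ) this)
    (fun {a b} (ha : (a : A) ∈ V * repSpan (K := K) ρ) => by
      have := Submodule.mul_mem_mul ha b.2
      change (a : A) * b ∈ V * repSpan (K := K) ρ * (repSpan ρ) at this
      rw [mul_assoc] at this
      exact mul_le_mul' le_rfl (repSpan_mul_self_le ρ) this)
  have hsub : ∀ a : E, IsNilpotent (a : A) → IsNilpotent a := fun a ⟨m, hm⟩ =>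
    ⟨m, Subtype.ext (by simpa using hm)⟩
  have hJ : ∀ a ∈ J, IsNilpotent a := fun a ha =>
    hsub a (isNilpotent_of_pow_eq_bot (hV.mul_repSpan_pow_eq_bot hN)
      (by simpa [J, TwoSidedIdeal.mem_mk'] using ha))
  have := J.isNilpotent_add hJ (hsub ⟨x, hxE⟩ hx) (hsub ⟨y, hyE⟩ hy) (by
    rw [TwoSidedIdeal.mem_mk']
    simpa using Submodule.mul_mem_mul hxy (one_mem_repSpan (K := K) ρ))
  exact this.map E.val

end

section
variable {K : Type*} [Field K] {n : ℕ}

theorem Matrix.exists_span_commutator_pow_eq_bot [CharZero K]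
    (I : Submodule K (Matrix (Fin n) (Fin n) K)) (hI : ∀ x ∈ I, ∀ y ∈ I, x * y - y * x ∈ I)
    (htr : ∀ x ∈ I, ∀ y ∈ I, Matrix.trace (x * y) = 0) :
    ∃ N : ℕ, (Submodule.span K {z | ∃ x ∈ I, ∃ y ∈ I, z = x * y - y * x}) ^ N = ⊥ := by
  let φ : Matrix (Fin n) (Fin n) K ≃ₐ[K] Module.End K (Fin n → K) := Matrix.toLinAlgEquiv'
  obtain ⟨N, hN⟩ := _root_.exists_span_commutator_pow_eq_bot (I.map φ.toLinearMap)
    (by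
      rintro _ ⟨x, hx, rfl⟩ _ ⟨y, hy, rfl⟩
      exact ⟨_, hI x hx y hy, by simp⟩)
    (by
      rintro _ ⟨x, hx, rfl⟩ _ ⟨y, hy, rfl⟩
      have : φ (x * y) = Matrix.toLin' (x * y) := rfl
      rw [AlgEquiv.toLinearMap_apply, AlgEquiv.toLinearMap_apply, ← map_mul, this,
        Matrix.trace_toLin'_eq]
      exact htr x hx y hy)
  refine ⟨N, ?_⟩
  apply Submodule.map_injective_of_injective (f := φ.toAlgHom.toLinearMap) φ.injective
  rw [Submodule.map_pow, Submodule.map_bot, eq_bot_iff, ← hN]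
  refine pow_le_pow_left' ?_ N
  rw [Submodule.map_span_le]
  rintro _ ⟨x, hx, y, hy, rfl⟩
  exact Submodule.subset_span ⟨_, ⟨x, hx, rfl⟩, _, ⟨y, hy, rfl⟩, by simp⟩

theorem Matrix.exists_pow_eq_bot_of_isNilpotent
    (I : Submodule K (Matrix (Fin n) (Fin n) K)) (hI : ∀ x ∈ I, ∀ y ∈ I, x * y - y * x ∈ I)
    (hnil : ∀ x ∈ I, IsNilpotent x) : ∃ N : ℕ, I ^ N = ⊥ := by
  let φ : Matrix (Fin n) (Fin n) K ≃ₐ[K] Module.End K (Fin n → K) := Matrix.toLinAlgEquiv'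
  obtain ⟨N, hN⟩ := _root_.exists_pow_eq_bot_of_isNilpotent (I.map φ.toAlgHom.toLinearMap)
    (by
      rintro _ ⟨x, hx, rfl⟩ _ ⟨y, hy, rfl⟩
      exact ⟨_, hI x hx y hy, by simp⟩)
    (by
      rintro _ ⟨x, hx, rfl⟩
      exact (hnil x hx).map φ)
  refine ⟨N, ?_⟩
  apply Submodule.map_injective_of_injective (f := φ.toAlgHom.toLinearMap) φ.injective
  rw [Submodule.map_pow, Submodule.map_bot, hN]

variable {G : Type*} [Group G]

theorem exists_nil_isConjStable [CharZero K] (ρ : G →* Matrix (Fin n) (Fin n) K)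
    (I : Submodule K (Matrix (Fin n) (Fin n) K)) (hI : ∀ x ∈ I, ∀ y ∈ I, x * y - y * x ∈ I)
    (htr : ∀ x ∈ I, ∀ y ∈ I, Matrix.trace (x * y) = 0) (hconj : IsConjStable ρ I)
    (hIE : I ≤ repSpan ρ) {X : Matrix (Fin n) (Fin n) K} (hX : X ∈ I) (hXnil : IsNilpotent X) :
    ∃ V : Submodule K (Matrix (Fin n) (Fin n) K), IsConjStable ρ V ∧ X ∈ V ∧ ∃ N, V ^ N = ⊥ := by
  have hinv' : ∀ g, ρ g⁻¹ * ρ g = 1 := fun g => by rw [← map_mul, inv_mul_cancel, map_one]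
  have hcm : ∀ g x y, ρ g * (x * y) * ρ g⁻¹ = (ρ g * x * ρ g⁻¹) * (ρ g * y * ρ g⁻¹) := by
    intro g x y
    simp only [mul_assoc]
    rw [← mul_assoc (ρ g⁻¹) (ρ g), hinv', one_mul]
  have hcp : ∀ g x m, (ρ g * x * ρ g⁻¹) ^ m = ρ g * x ^ m * ρ g⁻¹ := by
    intro g x m
    induction m with
    | zero => simp [← map_mul]
    | succ m ih => rw [pow_succ, pow_succ, ih, hcm]
  set V₁ := Submodule.span K {z | ∃ x ∈ I, ∃ y ∈ I, z = x * y - y * x} with hV₁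
  obtain ⟨N₁, hN₁⟩ := Matrix.exists_span_commutator_pow_eq_bot I hI htr
  have hV₁c : IsConjStable ρ V₁ := by
    intro g v hv
    induction hv using Submodule.span_induction with
    | mem v hv =>
      obtain ⟨x, hx, y, hy, rfl⟩ := hv
      refine Submodule.subset_span ⟨_, hconj g x hx, _, hconj g y hy, ?_⟩
      rw [mul_sub, sub_mul, hcm, hcm]
    | zero => simp
    | add x y _ _ hx hy => rw [mul_add, add_mul]; exact add_mem hx hy
    | smul c x _ hx => rw [mul_smul_comm, smul_mul_assoc]; exact Submodule.smul_mem _ c hx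
  have hadd : ∀ x ∈ I, ∀ y ∈ I, IsNilpotent x → IsNilpotent y → IsNilpotent (x + y) :=
    fun x hx y hy hxn hyn => hV₁c.isNilpotent_add hN₁ (hIE hx) (hIE hy) hxn hyn
      (Submodule.subset_span ⟨x, hx, y, hy, rfl⟩)
  let V : Submodule K (Matrix (Fin n) (Fin n) K) :=
    { carrier := {x | x ∈ I ∧ IsNilpotent x}
      zero_mem' := ⟨I.zero_mem, IsNilpotent.zero⟩
      add_mem' := fun {x y} hx hy => ⟨I.add_mem hx.1 hy.1, hadd x hx.1 y hy.1 hx.2 hy.2⟩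
      smul_mem' := fun c x hx => ⟨I.smul_mem c hx.1, hx.2.smul c⟩ }
  refine ⟨V, ?_, ⟨hX, hXnil⟩, ?_⟩
  · rintro g v ⟨hv, m, hm⟩
    exact ⟨hconj g v hv, m, by rw [hcp, hm]; simp⟩
  · refine Matrix.exists_pow_eq_bot_of_isNilpotent V ?_ fun x hx => hx.2
    rintro x ⟨hx, -⟩ y ⟨hy, -⟩
    exact ⟨hI x hx y hy, isNilpotent_of_pow_eq_bot hN₁ (Submodule.subset_span ⟨x, hx, y, hy, rfl⟩)⟩

theorem exists_prod_conj_sub_one_eq_zero [CharZero K] (ρ : G →* Matrix (Fin n) (Fin n) K)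
    (I : Submodule K (Matrix (Fin n) (Fin n) K)) (hI : ∀ x ∈ I, ∀ y ∈ I, x * y - y * x ∈ I)
    (htr : ∀ x ∈ I, ∀ y ∈ I, Matrix.trace (x * y) = 0) (hconj : IsConjStable ρ I)
    (hIE : I ≤ repSpan ρ) {X b : Matrix (Fin n) (Fin n) K} (hX : X ∈ I) (hXnil : IsNilpotent X)
    (hb : b ∈ repSpan (K := K) ρ) {u : G} (hu : ρ u - 1 = X * b) :
    ∃ N : ℕ, ∀ g : Fin N → G, (List.ofFn fun i => ρ (g i * u * (g i)⁻¹) - 1).prod = 0 := by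
  obtain ⟨V, hV, hXV, N, hN⟩ := exists_nil_isConjStable ρ I hI htr hconj hIE hX hXnil
  refine ⟨N, fun g => ?_⟩
  have hmem : ∀ g : G, ρ (g * u * g⁻¹) - 1 ∈ V * repSpan ρ := by
    intro g
    have h1 : ρ (g * u * g⁻¹) - 1 = (ρ g * X * ρ g⁻¹) * (ρ g * b * ρ g⁻¹) := by
      have : ρ g * X * ρ g⁻¹ * (ρ g * b * ρ g⁻¹) = ρ g * (ρ u - 1) * ρ g⁻¹ := by
        rw [hu]
        simp only [mul_assoc]
        rw [← mul_assoc (ρ g⁻¹) (ρ g), ← map_mul, inv_mul_cancel, map_one, one_mul]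
      rw [this, mul_sub, sub_mul, mul_one, ← map_mul, ← map_mul, ← map_mul, mul_inv_cancel,
        map_one]
    rw [h1]
    refine Submodule.mul_mem_mul (hV g X hXV) ?_
    exact repSpan_mul_self_le ρ (Submodule.mul_mem_mul (repSpan_mul_self_le ρ
      (Submodule.mul_mem_mul (mem_repSpan ρ g) hb)) (mem_repSpan ρ g⁻¹))
  have key : ∀ m (g : Fin m → G), (List.ofFn fun i => ρ (g i * u * (g i)⁻¹) - 1).prod ∈
      (V * repSpan ρ) ^ m := by
    intro m
    induction m with
    | zero => intro g; simpa using ⟨1, map_one _⟩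
    | succ m ih =>
      intro g
      rw [List.ofFn_succ, List.prod_cons, pow_succ']
      exact Submodule.mul_mem_mul (hmem _) (ih fun i => g i.succ)
  simpa [hV.mul_repSpan_pow_eq_bot hN] using key N g

end

section
open Polynomial
variable {K : Type*} [Field K] {n : ℕ}

theorem Matrix.pow_eq_zero_of_isNilpotent {ν : Matrix (Fin n) (Fin n) K} (hν : IsNilpotent ν) :
    ν ^ n = 0 := by
  have h := (Matrix.isNilpotent_charpoly_sub_pow_of_isNilpotent hν).eq_zero
  rw [sub_eq_zero, Fintype.card_fin] at h
  simpa [h] using Matrix.aeval_self_charpoly ν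

theorem Matrix.trace_eq_zero_of_isNilpotent {ν : Matrix (Fin n) (Fin n) K} (hν : IsNilpotent ν) :
    ν.trace = 0 :=
  (Matrix.isNilpotent_trace_of_isNilpotent hν).eq_zero

/-- Evaluation of a matrix of polynomials. -/
noncomputable def evalMat (c : K) : Matrix (Fin n) (Fin n) K[X] →ₐ[K] Matrix (Fin n) (Fin n) K :=
  (Polynomial.aeval c).mapMatrix

/-- Constant matrices of polynomials. -/
noncomputable def constMat : Matrix (Fin n) (Fin n) K →ₐ[K] Matrix (Fin n) (Fin n) K[X] :=
  (Algebra.ofId K K[X]).mapMatrix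

theorem evalMat_apply (c : K) (P : Matrix (Fin n) (Fin n) K[X]) (i j : Fin n) :
    evalMat c P i j = (P i j).eval c := by
  simp [evalMat, Polynomial.coe_aeval_eq_eval]

@[simp] theorem evalMat_constMat (c : K) (A : Matrix (Fin n) (Fin n) K) :
    evalMat c (constMat A) = A := by
  ext i j
  simp [evalMat_apply, constMat, Algebra.ofId_apply]

@[simp] theorem evalMat_smul (c : K) (p : K[X]) (P : Matrix (Fin n) (Fin n) K[X]) :
    evalMat c (p • P) = p.eval c • evalMat c P := by
  ext i j
  simp [evalMat_apply]

theorem eval_trace (c : K) (P : Matrix (Fin n) (Fin n) K[X]) :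
    P.trace.eval c = (evalMat c P).trace := by
  simp [Matrix.trace, Polynomial.eval_finsetSum, evalMat_apply]

theorem exists_eq_constMat_add (P : Matrix (Fin n) (Fin n) K[X]) :
    ∃ Q, P = constMat (evalMat 0 P) + (X : K[X]) • Q := by
  refine ⟨P.map divX, ?_⟩
  ext1 i j
  have : constMat (evalMat 0 P) i j = C ((P i j).coeff 0) := by
    simp only [constMat, AlgHom.mapMatrix_apply, Matrix.map_apply, evalMat_apply,
      Algebra.ofId_apply, coeff_zero_eq_eval_zero]
    rfl
  rw [Matrix.add_apply, this, Matrix.smul_apply, Matrix.map_apply, smul_eq_mul, add_comm,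
    X_mul_divX_add]

theorem X_smul_injective {P Q : Matrix (Fin n) (Fin n) K[X]}
    (h : (X : K[X]) • P = (X : K[X]) • Q) : P = Q := by
  ext1 i j
  have := congrFun (congrFun h i) j
  simpa using this

theorem Polynomial.eq_zero_of_eval_nat [CharZero K] {p : K[X]}
    (h : ∀ j : ℕ, j ≠ 0 → p.eval (j : K) = 0) : p = 0 := by
  apply Polynomial.eq_zero_of_infinite_isRoot
  refine ((Set.finite_singleton 0).infinite_compl.image
    (Nat.cast_injective (R := K)).injOn).mono ?_
  rintro _ ⟨j, hj, rfl⟩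
  exact h j hj

theorem evalMat_mem [CharZero K] (L : Submodule K (Matrix (Fin n) (Fin n) K))
    (P : Matrix (Fin n) (Fin n) K[X]) (h : ∀ j : ℕ, j ≠ 0 → evalMat (j : K) P ∈ L) (c : K) :
    evalMat c P ∈ L := by
  rw [← Subspace.forall_mem_dualAnnihilator_apply_eq_zero_iff]
  intro f hf
  let p : K[X] := ∑ i, ∑ j, C (f (Matrix.single i j 1)) * P i j
  have hp : ∀ c, p.eval c = f (evalMat c P) := by
    intro c
    conv_rhs => rw [Matrix.matrix_eq_sum_single (evalMat c P)]
    simp only [p, eval_finsetSum, eval_mul, eval_C, map_sum]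
    refine Finset.sum_congr rfl fun i _ => Finset.sum_congr rfl fun j _ => ?_
    rw [evalMat_apply, mul_comm, ← smul_eq_mul, ← map_smul, Matrix.smul_single, smul_eq_mul,
      mul_one]
  have : p = 0 := Polynomial.eq_zero_of_eval_nat fun j hj => by
    rw [hp]
    exact (Submodule.mem_dualAnnihilator f).1 hf _ (h j hj)
  rw [← hp, this, eval_zero]

theorem evalMat_ext [CharZero K] {P Q : Matrix (Fin n) (Fin n) K[X]}
    (h : ∀ j : ℕ, evalMat (j : K) P = evalMat (j : K) Q) : P = Q := by
  ext1 i j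
  rw [← sub_eq_zero]
  apply Polynomial.eq_zero_of_eval_nat
  intro m _
  rw [eval_sub, ← evalMat_apply, ← evalMat_apply, h, sub_self]

/-- The divided difference of the interpolation of the powers of a unipotent matrix `1 + ν`. -/
noncomputable def powCurve (ν : Matrix (Fin n) (Fin n) K) : Matrix (Fin n) (Fin n) K[X] :=
  ∑ k ∈ Finset.range n,
    (C ((k + 1).factorial : K)⁻¹ * (descPochhammer K k).comp (X - 1)) • constMat (ν ^ (k + 1))

/-- The logarithm of the unipotent matrix `1 + ν`. -/
noncomputable def nilLog (ν : Matrix (Fin n) (Fin n) K) : Matrix (Fin n) (Fin n) K :=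
  evalMat 0 (powCurve ν)

theorem evalMat_powCurve [CharZero K] {ν : Matrix (Fin n) (Fin n) K} (hν : IsNilpotent ν)
    (j : ℕ) : evalMat (j : K) (1 + (X : K[X]) • powCurve ν) = (1 + ν) ^ j := by
  have h0 := Matrix.pow_eq_zero_of_isNilpotent hν
  have h1 : (1 + ν) ^ j = ∑ k ∈ Finset.range (n + j + 1), (j.choose k : K) • ν ^ k := by
    rw [add_comm 1 ν, (Commute.one_right ν).add_pow]
    refine (Finset.sum_congr rfl fun k _ => ?_).trans
      (Finset.sum_subset (Finset.range_subset_range.2 (by omega)) fun k _ hk => ?_)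
    · rw [one_pow, mul_one, ← Nat.cast_commute, ← nsmul_eq_mul, Nat.cast_smul_eq_nsmul]
    · rw [Finset.mem_range, not_lt] at hk
      rw [Nat.choose_eq_zero_of_lt (by omega), Nat.cast_zero, zero_smul]
  have h2 : ∑ k ∈ Finset.range (n + j + 1), (j.choose k : K) • ν ^ k =
      ∑ k ∈ Finset.range (n + 1), (j.choose k : K) • ν ^ k := by
    refine (Finset.sum_subset (Finset.range_subset_range.2 (by omega)) fun k _ hk => ?_).symm
    rw [Finset.mem_range, not_lt] at hk
    rw [pow_eq_zero_of_le (by omega) h0, smul_zero]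
  rw [h1, h2, Finset.sum_range_succ', map_add, map_one, evalMat_smul, eval_X, powCurve, map_sum,
    Finset.smul_sum, add_comm]
  congr 1
  · refine Finset.sum_congr rfl fun k _ => ?_
    rw [evalMat_smul, evalMat_constMat, smul_smul, eval_mul, eval_C]
    congr 1
    have h3 : (j : K) * ((descPochhammer K k).comp (X - 1)).eval (j : K) =
        (j.descFactorial (k + 1) : K) := by
      rw [← descPochhammer_eval_eq_descFactorial, descPochhammer_succ_left, eval_mul, eval_X]
    rw [mul_left_comm, h3, Nat.descFactorial_eq_factorial_mul_choose, Nat.cast_mul,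
      inv_mul_cancel_left₀]
    exact_mod_cast Nat.factorial_ne_zero _
  · simp

theorem nilLog_conj (ν a b : Matrix (Fin n) (Fin n) K) (hab : b * a = 1) :
    nilLog (a * ν * b) = a * nilLog ν * b := by
  have hp : ∀ k, (a * ν * b) ^ (k + 1) = a * ν ^ (k + 1) * b := by
    intro k
    induction k with
    | zero => simp
    | succ k ih =>
      rw [pow_succ, ih, pow_succ ν (k + 1)]
      simp only [mul_assoc]
      rw [← mul_assoc b a, hab, one_mul]
  simp only [nilLog, powCurve, map_sum, evalMat_smul, evalMat_constMat, hp, Finset.mul_sum,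
    Finset.sum_mul, mul_smul_comm, smul_mul_assoc]

theorem nilLog_mem {ν : Matrix (Fin n) (Fin n) K} (V : Submodule K (Matrix (Fin n) (Fin n) K))
    (hV : ∀ k : ℕ, ν ^ k ∈ V) : nilLog ν ∈ V := by
  simp only [nilLog, powCurve, map_sum, evalMat_smul, evalMat_constMat]
  exact sum_mem fun k _ => V.smul_mem _ (hV _)

theorem exists_nilLog_eq_mul [CharZero K] {ν : Matrix (Fin n) (Fin n) K} (hν : IsNilpotent ν) :
    ∃ q s : K[X], nilLog ν = ν * aeval ν q ∧ ν = nilLog ν * aeval ν s := by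
  rcases n with _ | n
  · exact ⟨1, 1, Subsingleton.elim _ _, Subsingleton.elim _ _⟩
  let c : ℕ → K := fun k =>
    (C ((k + 1).factorial : K)⁻¹ * (descPochhammer K k).comp (X - 1)).eval 0
  have hc0 : c 0 = 1 := by simp [c]
  let r : K[X] := ∑ k ∈ Finset.range n, C (c (k + 1)) * X ^ k
  have hlog : nilLog ν = ν * aeval ν (1 + X * r) := by
    have : nilLog ν = ∑ k ∈ Finset.range (n + 1), c k • ν ^ (k + 1) := by
      simp only [nilLog, powCurve, map_sum, evalMat_smul, evalMat_constMat, c]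
    rw [this, Finset.sum_range_succ', hc0, map_add, map_one, mul_add, mul_one, map_mul, aeval_X,
      zero_add, pow_one, one_smul]
    refine (add_comm _ _).trans ?_
    congr 1
    simp only [r, map_sum, Finset.mul_sum, map_mul, aeval_C, map_pow, aeval_X,
      Algebra.algebraMap_eq_smul_one, smul_mul_assoc, one_mul, mul_smul_comm]
    exact Finset.sum_congr rfl fun k _ => by rw [pow_succ', pow_succ']
  obtain ⟨s, hs⟩ : ∃ s : K[X], aeval ν (1 + X * r) * aeval ν s = 1 := by
    let S := Algebra.adjoin K {ν}
    let x : S := ⟨ν * aeval ν r, mul_mem (Algebra.self_mem_adjoin_singleton K ν)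
      (Polynomial.aeval_mem_adjoin_singleton K ν)⟩
    have hx : IsNilpotent x := by
      have hcom : Commute ν (aeval ν r) := by
        simpa using (Commute.all (X : K[X]) r).map (aeval ν)
      obtain ⟨m, hm⟩ := hcom.isNilpotent_mul_right hν
      exact ⟨m, Subtype.ext (by simpa [x] using hm)⟩
    obtain ⟨y, hy⟩ := hx.isUnit_one_add.exists_right_inv
    have hyS : (y : Matrix (Fin (n + 1)) (Fin (n + 1)) K) ∈ Algebra.adjoin K {ν} := y.2
    rw [Algebra.adjoin_singleton_eq_range_aeval] at hyS
    obtain ⟨s, hs⟩ := hyS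
    refine ⟨s, ?_⟩
    have := congrArg Subtype.val hy
    rw [map_add, map_one, map_mul, aeval_X]
    exact (congrArg _ hs).trans this
  exact ⟨_, s, hlog, by rw [hlog, mul_assoc, hs, mul_one]⟩

end

section
open Polynomial
variable {K : Type*} [Field K] {n : ℕ}

/-- `T` is diagonalizable with diagonal entries `d`, and `U` is unipotent and commutes with `T`. -/
structure IsJordanPair (T U : Matrix (Fin n) (Fin n) K) (d : Fin n → K) : Prop where
  commute : Commute T U
  exists_diagonal : ∃ S : (Matrix (Fin n) (Fin n) K)ˣ, T * S = S * Matrix.diagonal d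
  isNilpotent : IsNilpotent (U - 1)

theorem Commute.aeval_right {A : Type*} [Ring A] [Algebra K A] {a b : A} (hab : Commute a b)
    (q : K[X]) : Commute a (aeval b q) := by
  induction q using Polynomial.induction_on' with
  | add p q hp hq => rw [map_add]; exact hp.add_right hq
  | monomial m c =>
    rw [aeval_monomial]
    exact (Algebra.commute_algebraMap_right c a).mul_right (hab.pow_right m)

theorem exists_aeval_add_eq {A : Type*} [Ring A] [Algebra K A] {a b : A} (hab : Commute a b)
    (p : K[X]) : ∃ r, Commute b r ∧ aeval (a + b) p = aeval a p + b * r := by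
  suffices ∃ r, Commute a r ∧ Commute b r ∧ aeval (a + b) p = aeval a p + b * r by
    obtain ⟨r, -, h⟩ := this
    exact ⟨r, h⟩
  have hca : ∀ q : K[X], Commute a (aeval a q) := (Commute.refl a).aeval_right
  have hcb : ∀ q : K[X], Commute b (aeval a q) := hab.symm.aeval_right
  induction p using Polynomial.induction_on with
  | C c => exact ⟨0, Commute.zero_right _, Commute.zero_right _, by simp⟩
  | add p q hp hq =>
    obtain ⟨r, h1, h2, h3⟩ := hp
    obtain ⟨r', h1', h2', h3'⟩ := hq
    exact ⟨r + r', h1.add_right h1', h2.add_right h2', by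
      rw [map_add, map_add, h3, h3', mul_add]; abel⟩
  | monomial m c hp =>
    obtain ⟨r, h1, h2, h3⟩ := hp
    refine ⟨r * (a + b) + aeval a (C c * X ^ m), ?_, ?_, ?_⟩
    · exact (h1.mul_right ((Commute.refl a).add_right hab)).add_right (hca _)
    · exact (h2.mul_right (hab.symm.add_right (Commute.refl b))).add_right (hcb _)
    · rw [pow_succ, ← mul_assoc, map_mul _ (C c * X ^ m) X, h3, map_mul _ (C c * X ^ m) X, aeval_X,
        aeval_X, mul_add b, ← mul_assoc b, (hcb _).eq, add_mul, mul_add (aeval a (C c * X ^ m))]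
      abel

namespace IsJordanPair
variable {T U : Matrix (Fin n) (Fin n) K} {d : Fin n → K}

theorem aeval_eq (h : IsJordanPair T U d) : ∃ S : (Matrix (Fin n) (Fin n) K)ˣ, ∀ p : K[X],
    aeval T p = S * Matrix.diagonal (fun i => p.eval (d i)) * (S⁻¹ : (Matrix _ _ K)ˣ) := by
  obtain ⟨S, hS⟩ := h.exists_diagonal
  refine ⟨S, fun p => ?_⟩
  rw [Units.eq_mul_inv_iff_mul_eq]
  induction p using Polynomial.induction_on with
  | C c =>
    rw [aeval_C, Algebra.commutes, Matrix.algebraMap_eq_diagonal]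
    simp [Pi.algebraMap_def]
  | add p q hp hq =>
    rw [map_add, add_mul, hp, hq, ← mul_add, Matrix.diagonal_add]
    simp
  | monomial m c hp =>
    rw [pow_succ, ← mul_assoc, map_mul, aeval_X, mul_assoc, hS, ← mul_assoc, hp, mul_assoc,
      Matrix.diagonal_mul_diagonal]
    simp [mul_assoc]

theorem aeval_congr (h : IsJordanPair T U d) {p q : K[X]}
    (hpq : ∀ i, p.eval (d i) = q.eval (d i)) : aeval T p = aeval T q := by
  obtain ⟨S, hS⟩ := h.aeval_eq
  rw [hS, hS]
  simp only [hpq]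

theorem trace_aeval_left (h : IsJordanPair T U d) (p : K[X]) :
    (aeval T p).trace = ∑ i, p.eval (d i) := by
  obtain ⟨S, hS⟩ := h.aeval_eq
  rw [hS, Matrix.trace_mul_comm, ← mul_assoc, Units.inv_mul, one_mul, Matrix.trace_diagonal]

theorem trace_aeval (h : IsJordanPair T U d) (p : K[X]) :
    (aeval (T * U) p).trace = ∑ i, p.eval (d i) := by
  have hc : Commute T (U - 1) := h.commute.sub_right (Commute.one_right T)
  have hc2 : Commute T (T * (U - 1)) := (Commute.refl T).mul_right hc
  obtain ⟨r, hr, hr2⟩ := exists_aeval_add_eq hc2 p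
  have h1 : T * U = T + T * (U - 1) := by rw [mul_sub, mul_one]; abel
  rw [h1, hr2, Matrix.trace_add, h.trace_aeval_left, Matrix.trace_eq_zero_of_isNilpotent
    (hr.isNilpotent_mul_right (hc.isNilpotent_mul_left h.isNilpotent)), add_zero]

theorem det_gram_eq_zero [DecidableEq K] (h : IsJordanPair T U d) {ι : Type*} [Fintype ι]
    [DecidableEq ι] (f : ι → K[X]) (hcard : (Finset.univ.image d).card < Fintype.card ι) :
    (Matrix.of fun a b => (aeval (T * U) (f a * f b)).trace).det = 0 := by
  obtain ⟨c, hc0, hc⟩ : ∃ c : ι → K, c ≠ 0 ∧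
      ∀ x ∈ Finset.univ.image d, ∑ b, (f b).eval x * c b = 0 := by
    let F : Matrix (Finset.univ.image d) ι K := Matrix.of fun x b => (f b).eval (x : K)
    have : ¬ Function.Injective F.mulVecLin := fun hinj => by
      have := LinearMap.finrank_le_finrank_of_injective hinj
      simp only [Module.finrank_fintype_fun_eq_card, Fintype.card_coe] at this
      omega
    rw [← LinearMap.ker_eq_bot, Submodule.eq_bot_iff] at this
    push Not at this
    obtain ⟨c, hc, hc0⟩ := this
    exact ⟨c, hc0, fun x hx => congrFun hc ⟨x, hx⟩⟩
  refine Matrix.exists_mulVec_eq_zero_iff.1 ⟨c, hc0, ?_⟩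
  ext a
  simp only [Matrix.mulVec, dotProduct, Matrix.of_apply, h.trace_aeval, eval_mul,
    Finset.sum_mul, Pi.zero_apply]
  rw [Finset.sum_comm]
  refine Finset.sum_eq_zero fun i _ => ?_
  simp only [mul_assoc]
  rw [← Finset.mul_sum, hc _ (Finset.mem_image_of_mem d (Finset.mem_univ i)), mul_zero]

end IsJordanPair
end

section
open Polynomial
variable {K : Type*} [Field K] [DecidableEq K] {n : ℕ}

/-- The interpolation polynomial of the indicator function of `b` on the entries of `d`. -/
noncomputable def indicatorPoly (d : Fin n → K) (b : K) : K[X] :=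
  Lagrange.basis (Finset.univ.image d) id b

theorem eval_indicatorPoly (d : Fin n → K) {b : K} (hb : b ∈ Finset.univ.image d) (i : Fin n) :
    (indicatorPoly d b).eval (d i) = if d i = b then 1 else 0 := by
  split_ifs with h
  · rw [h]
    exact Lagrange.eval_basis_self (v := id) Function.injective_id.injOn hb
  · exact Lagrange.eval_basis_of_ne (v := id) (i := b) (j := d i) (Ne.symm h)
      (Finset.mem_image_of_mem d (Finset.mem_univ i))

/-- The spectral projection of a diagonalizable matrix `T` with diagonal entries `d`. -/
noncomputable def specProj (T : Matrix (Fin n) (Fin n) K) (d : Fin n → K) (b : K) :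
    Matrix (Fin n) (Fin n) K :=
  aeval T (indicatorPoly d b)

namespace IsJordanPair
variable {T U : Matrix (Fin n) (Fin n) K} {d : Fin n → K}

theorem specProj_mul_specProj (h : IsJordanPair T U d) {b c : K} (hb : b ∈ Finset.univ.image d)
    (hc : c ∈ Finset.univ.image d) :
    specProj T d b * specProj T d c = if b = c then specProj T d b else 0 := by
  have : (if b = c then specProj T d b else 0) =
      aeval T (if b = c then indicatorPoly d b else 0) := by
    split_ifs <;> simp [specProj]
  rw [this, specProj, specProj, ← map_mul]
  refine h.aeval_congr fun i => ?_
  rw [eval_mul, eval_indicatorPoly d hb, eval_indicatorPoly d hc]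
  by_cases hbc : b = c
  · subst hbc
    simp [eval_indicatorPoly d hb]
  · by_cases hd : d i = b
    · simp [hd, hbc]
    · simp [hd, hbc]

theorem mul_specProj (h : IsJordanPair T U d) {b : K} (hb : b ∈ Finset.univ.image d) :
    T * specProj T d b = b • specProj T d b := by
  have h1 : T * specProj T d b = aeval T (X * indicatorPoly d b) := by simp [specProj]
  have h2 : b • specProj T d b = aeval T (C b * indicatorPoly d b) := by
    simp [specProj, Algebra.smul_def]
  rw [h1, h2]
  refine h.aeval_congr fun i => ?_
  rw [eval_mul, eval_mul, eval_indicatorPoly d hb, eval_X, eval_C]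
  split_ifs with hd <;> simp [hd]

theorem specProj_mul (h : IsJordanPair T U d) {b : K} (hb : b ∈ Finset.univ.image d) :
    specProj T d b * T = b • specProj T d b := by
  rw [← h.mul_specProj hb]
  exact ((Commute.refl T).aeval_right _).eq.symm

theorem sum_specProj (h : IsJordanPair T U d) :
    ∑ b ∈ Finset.univ.image d, specProj T d b = 1 := by
  have h2 : (1 : Matrix (Fin n) (Fin n) K) = aeval T (1 : K[X]) := by simp
  rw [h2]
  simp only [specProj]
  rw [← map_sum]
  refine h.aeval_congr fun i => ?_
  rw [eval_finsetSum, eval_one, Finset.sum_congr rfl fun b hb => eval_indicatorPoly d hb i]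
  simp

theorem trace_specProj_ne_zero [CharZero K] (h : IsJordanPair T U d) {b : K}
    (hb : b ∈ Finset.univ.image d) : (specProj T d b).trace ≠ 0 := by
  rw [specProj, h.trace_aeval_left, Finset.sum_congr rfl fun i _ => eval_indicatorPoly d hb i,
    Finset.sum_boole, Nat.cast_ne_zero, Finset.card_ne_zero]
  obtain ⟨i, -, hi⟩ := Finset.mem_image.1 hb
  exact ⟨i, by simp [hi]⟩

theorem trace_specProj_mul (h : IsJordanPair T U d) [CharZero K] (hT : IsUnit T)
    (B : Matrix (Fin n) (Fin n) K[X])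
    (hB : ∀ j : ℕ, ∃ T' U' d', IsJordanPair T' U' d' ∧
      (Finset.univ.image d').card ≤ (Finset.univ.image d).card ∧
      evalMat (j : K) (constMat T * (1 + (X : K[X]) • B)) = T' * U')
    {a : K} (ha : a ∈ Finset.univ.image d) :
    (specProj T d a).trace *
      (specProj T d a * evalMat 0 B * (specProj T d a * evalMat 0 B)).trace =
      (specProj T d a * evalMat 0 B).trace ^ 2 := by
  have haev : ∀ (c : K) (P : Matrix (Fin n) (Fin n) K[X]) (q : K[X]),
      evalMat c (aeval P q) = aeval (evalMat c P) q := fun c P q =>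
    (Polynomial.aeval_algHom_apply (evalMat c) P q).symm
  set w : Matrix (Fin n) (Fin n) K[X] := constMat T * (1 + (X : K[X]) • B) with hw
  have hw0 : evalMat 0 w = T := by simp [hw]
  set e := specProj T d a with he
  set m := constMat T * B with hm
  obtain ⟨E, hE⟩ := exists_eq_constMat_add (aeval w (indicatorPoly d a))
  rw [haev, hw0] at hE
  change _ = constMat e + _ at hE
  set τ := T - algebraMap K _ a with hτ
  have heτ : e * τ = 0 := by
    rw [hτ, mul_sub, h.specProj_mul ha, ← Algebra.commutes, ← Algebra.smul_def, sub_self]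
  have hτe : τ * e = 0 := by
    rw [hτ, sub_mul, h.mul_specProj ha, ← Algebra.smul_def, sub_self]
  have hwτ : aeval w (X - C a) = constMat τ + (X : K[X]) • m := by
    rw [map_sub, aeval_X, aeval_C, hτ, map_sub, AlgHom.commutes, hw, mul_add, mul_one,
      mul_smul_comm]
    abel
  set q := indicatorPoly d a * (X - C a) * indicatorPoly d a with hq
  set H := (constMat e * m + E * constMat τ + (X : K[X]) • (E * m)) *
    (constMat e + (X : K[X]) • E) with hH
  have hqH : aeval w q = (X : K[X]) • H := by
    have h1 : (constMat e + (X : K[X]) • E) * (constMat τ + (X : K[X]) • m) =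
        (X : K[X]) • (constMat e * m + E * constMat τ + (X : K[X]) • (E * m)) := by
      have h2 : constMat e * constMat τ = 0 := by rw [← map_mul, heτ, map_zero]
      simp only [add_mul, mul_add, smul_mul_assoc, mul_smul_comm, h2, zero_add, smul_add]
      abel
    rw [hq, map_mul, map_mul, hE, hwτ, h1, hH, smul_mul_assoc]
  have hH0 : evalMat 0 H = a • (e * evalMat 0 B * e) := by
    rw [hH, hm]
    simp only [map_mul, map_add, evalMat_smul, eval_X, zero_smul, add_zero, evalMat_constMat]
    rw [add_mul, mul_assoc (evalMat 0 E), hτe, mul_zero, add_zero, ← mul_assoc, h.specProj_mul ha,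
      smul_mul_assoc, smul_mul_assoc]
  let g : Option (Finset.univ.image d) → K[X] := fun x => x.elim q fun b => indicatorPoly d b
  let G : Option (Finset.univ.image d) → Matrix (Fin n) (Fin n) K[X] := fun x =>
    x.elim H fun b => aeval w (indicatorPoly d (b : K))
  let c : Option (Finset.univ.image d) → K[X] := fun x => x.elim X fun _ => 1
  have hgG : ∀ x, aeval w (g x) = c x • G x := by
    rintro (_ | b)
    · exact hqH
    · exact (one_smul _ _).symm
  have hdet : (Matrix.of fun x y => (aeval w (g x * g y)).trace).det = 0 := by
    refine Polynomial.eq_zero_of_eval_nat fun j _ => ?_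
    obtain ⟨T', U', d', hp, hcard, hj⟩ := hB j
    have := hp.det_gram_eq_zero g (by
      rw [Fintype.card_option, Fintype.card_coe]
      omega)
    rw [← this, ← coe_evalRingHom, RingHom.map_det]
    congr 1
    ext x y
    simp only [RingHom.mapMatrix_apply, Matrix.map_apply, Matrix.of_apply, coe_evalRingHom,
      eval_trace, haev, hj]
  have hdet' : (Matrix.of fun x y => (G x * G y).trace).det = 0 := by
    have h1 : (Matrix.of fun x y => (aeval w (g x * g y)).trace) =
        Matrix.diagonal c * (Matrix.of fun x y => (G x * G y).trace) * Matrix.diagonal c := by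
      ext1 x y
      rw [Matrix.mul_diagonal, Matrix.diagonal_mul, Matrix.of_apply, Matrix.of_apply, map_mul,
        hgG, hgG, smul_mul_assoc, mul_smul_comm, Matrix.trace_smul, Matrix.trace_smul, smul_eq_mul,
        smul_eq_mul]
      ring
    rw [h1, Matrix.det_mul, Matrix.det_mul, Matrix.det_diagonal, Fintype.prod_option] at hdet
    simpa [c] using hdet
  set Q := a • (e * evalMat 0 B * e) with hQ
  let G₀ : Option (Finset.univ.image d) → Matrix (Fin n) (Fin n) K := fun x =>
    x.elim Q fun b => specProj T d b
  have hG₀ : ∀ x, evalMat 0 (G x) = G₀ x := by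
    rintro (_ | b)
    · exact hH0
    · exact (haev _ _ _).trans (by rw [hw0]; rfl)
  have hdet₀ : (Matrix.of fun x y => (G₀ x * G₀ y).trace).det = 0 := by
    have h1 := congrArg (evalRingHom (0 : K)) hdet'
    rw [map_zero, RingHom.map_det] at h1
    rw [← h1]
    congr 1
    ext x y
    simp only [RingHom.mapMatrix_apply, Matrix.map_apply, Matrix.of_apply, coe_evalRingHom,
      eval_trace, map_mul, hG₀]
  obtain ⟨v, hv0, hv⟩ := Matrix.exists_mulVec_eq_zero_iff.2 hdet₀
  have hee : ∀ b : Finset.univ.image d, specProj T d b * e = if (b : K) = a then e else 0 := by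
    intro b
    rw [he, h.specProj_mul_specProj b.2 ha]
    split_ifs with hb
    · rw [hb]
    · rfl
  have hbQ : ∀ b : Finset.univ.image d, (specProj T d b * Q).trace =
      if (b : K) = a then Q.trace else 0 := by
    intro b
    rw [hQ, mul_smul_comm, ← mul_assoc, ← mul_assoc, hee]
    split_ifs <;> simp
  have hQb : ∀ b : Finset.univ.image d, (Q * specProj T d b).trace =
      if (b : K) = a then Q.trace else 0 := fun b => by rw [Matrix.trace_mul_comm, hbQ]
  have hrow : ∀ b : Finset.univ.image d, (specProj T d b).trace * v (some b) +
      (if (b : K) = a then Q.trace else 0) * v none = 0 := by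
    intro b
    have := congrFun hv (some b)
    simp only [Matrix.mulVec, dotProduct, Matrix.of_apply, Fintype.sum_option, G₀, Option.elim,
      Pi.zero_apply] at this
    rw [hbQ, Finset.sum_eq_single b, h.specProj_mul_specProj b.2 b.2, if_pos rfl] at this
    · rw [add_comm, this]
    · intro b' _ hb'
      rw [h.specProj_mul_specProj b.2 b'.2, if_neg (fun h => hb' (Subtype.ext h.symm)),
        Matrix.trace_zero, zero_mul]
    · simp
  have hlast : Q.trace * v (some ⟨a, ha⟩) + (Q * Q).trace * v none = 0 := by
    have := congrFun hv none
    simp only [Matrix.mulVec, dotProduct, Matrix.of_apply, Fintype.sum_option, G₀, Option.elim,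
      Pi.zero_apply, hQb] at this
    rw [Finset.sum_eq_single ⟨a, ha⟩, if_pos rfl] at this
    · rw [add_comm, this]
    · intro b' _ hb'
      rw [if_neg (fun h => hb' (Subtype.ext h)), zero_mul]
    · simp
  have hv1 : v none ≠ 0 := by
    intro h0
    apply hv0
    funext x
    rcases x with _ | b
    · exact h0
    · have := hrow b
      rw [h0, mul_zero, add_zero] at this
      exact (mul_eq_zero.1 this).resolve_left (h.trace_specProj_ne_zero b.2)
  have ha0 : a ≠ 0 := by
    rintro rfl
    have h1 := h.mul_specProj ha
    rw [zero_smul] at h1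
    have h2 := hT.mul_right_eq_zero.1 h1
    exact h.trace_specProj_ne_zero ha (by rw [h2, Matrix.trace_zero])
  have heid : e * e = e := by rw [he, h.specProj_mul_specProj ha ha, if_pos rfl]
  have hQQ : e.trace * (Q * Q).trace = Q.trace ^ 2 := by
    have h1 := hrow ⟨a, ha⟩
    rw [if_pos rfl] at h1
    change e.trace * _ + _ = 0 at h1
    refine mul_right_cancel₀ hv1 ?_
    linear_combination e.trace * hlast - Q.trace * h1
  have hQ1 : Q.trace = a * (e * evalMat 0 B).trace := by
    rw [hQ, Matrix.trace_smul, Matrix.trace_mul_comm, ← mul_assoc, heid, smul_eq_mul]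
  have hQ2 : (Q * Q).trace = a ^ 2 * (e * evalMat 0 B * (e * evalMat 0 B)).trace := by
    have h1 : (e * evalMat 0 B * e * (e * evalMat 0 B * e)).trace =
        (e * evalMat 0 B * (e * evalMat 0 B)).trace := by
      rw [← mul_assoc, Matrix.trace_mul_comm]
      congr 1
      simp only [← mul_assoc, heid]
      rw [mul_assoc (e * evalMat 0 B) e e, heid]
    rw [hQ, smul_mul_smul_comm, Matrix.trace_smul, smul_eq_mul, sq, h1]
  rw [hQ1, hQ2] at hQQ
  refine mul_left_cancel₀ (pow_ne_zero 2 ha0) ?_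
  linear_combination hQQ

end IsJordanPair
end

section
open Polynomial
variable {K : Type*} [Field K] [CharZero K] {n : ℕ}

theorem isNilpotent_nilLog {ν : Matrix (Fin n) (Fin n) K} (hν : IsNilpotent ν) :
    IsNilpotent (nilLog ν) := by
  obtain ⟨q, -, hq, -⟩ := exists_nilLog_eq_mul hν
  rw [hq]
  exact ((Commute.refl ν).aeval_right q).isNilpotent_mul_right hν

theorem commute_nilLog {ν A : Matrix (Fin n) (Fin n) K} (hν : IsNilpotent ν) (h : Commute A ν) :
    Commute A (nilLog ν) := by
  obtain ⟨q, -, hq, -⟩ := exists_nilLog_eq_mul hν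
  rw [hq]
  exact h.mul_right (h.aeval_right q)

variable {G : Type*} [Group G] (ρ : G →* Matrix (Fin n) (Fin n) K)

theorem evalMat_powCurve_map {v : G} (hv : IsNilpotent (ρ v - 1)) (j : ℕ) :
    evalMat (j : K) (1 + (X : K[X]) • powCurve (ρ v - 1)) = ρ (v ^ j) := by
  rw [evalMat_powCurve hv, map_pow, add_sub_cancel]

theorem trace_nilLog_mul_nilLog_eq_zero [DecidableEq K] {t u : G} {d : Fin n → K}
    (h : IsJordanPair (ρ t) (ρ u) d)
    (hmax : ∀ g : G, ∃ T U d', IsJordanPair T U d' ∧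
      (Finset.univ.image d').card ≤ (Finset.univ.image d).card ∧ ρ g = T * U)
    {v : G} (hv : IsNilpotent (ρ v - 1)) :
    (nilLog (ρ u - 1) * nilLog (ρ v - 1)).trace = 0 := by
  have hu := h.isNilpotent
  have hT : IsUnit (ρ t) := (Group.isUnit t).map ρ
  have hX := isNilpotent_nilLog hu
  have hTX : Commute (ρ t) (nilLog (ρ u - 1)) :=
    commute_nilLog hu (h.commute.sub_right (Commute.one_right _))
  have hY := fun {a : K} (ha : a ∈ Finset.univ.image d) =>
    h.trace_specProj_mul hT (powCurve (ρ v - 1)) (fun j => by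
      obtain ⟨T, U, d', h1, h2, h3⟩ := hmax (t * v ^ j)
      exact ⟨T, U, d', h1, h2, by
        rw [map_mul, evalMat_constMat, evalMat_powCurve_map ρ hv, ← map_mul, h3]⟩) ha
  have hXY := fun {a : K} (ha : a ∈ Finset.univ.image d) =>
    h.trace_specProj_mul hT (powCurve (ρ u - 1) + powCurve (ρ v - 1) +
        (X : K[X]) • (powCurve (ρ u - 1) * powCurve (ρ v - 1))) (fun j => by
      obtain ⟨T, U, d', h1, h2, h3⟩ := hmax (t * (u ^ j * v ^ j))
      refine ⟨T, U, d', h1, h2, ?_⟩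
      have : 1 + (X : K[X]) • (powCurve (ρ u - 1) + powCurve (ρ v - 1) +
          (X : K[X]) • (powCurve (ρ u - 1) * powCurve (ρ v - 1))) =
          (1 + (X : K[X]) • powCurve (ρ u - 1)) * (1 + (X : K[X]) • powCurve (ρ v - 1)) := by
        simp only [add_mul, mul_add, one_mul, mul_one, smul_add, smul_mul_assoc, mul_smul_comm]
        abel
      rw [this, map_mul, map_mul, evalMat_constMat, evalMat_powCurve_map ρ hv,
        evalMat_powCurve_map ρ hu, ← map_mul, ← map_mul, h3]) ha
  have h0 : evalMat 0 (powCurve (ρ u - 1) + powCurve (ρ v - 1) +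
        (X : K[X]) • (powCurve (ρ u - 1) * powCurve (ρ v - 1))) =
      nilLog (ρ u - 1) + nilLog (ρ v - 1) := by
    simp [nilLog]
  rw [h0] at hXY
  change ∀ {a : K}, a ∈ Finset.univ.image d → (specProj (ρ t) d a).trace *
    (specProj (ρ t) d a * nilLog (ρ v - 1) * (specProj (ρ t) d a * nilLog (ρ v - 1))).trace =
      (specProj (ρ t) d a * nilLog (ρ v - 1)).trace ^ 2 at hY
  set x := nilLog (ρ u - 1)
  set y := nilLog (ρ v - 1)
  have key : ∀ a ∈ Finset.univ.image d, (specProj (ρ t) d a * (x * y)).trace = 0 := by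
    intro a ha
    have h1 := hY ha
    have h2 := hXY ha
    have hetr := h.trace_specProj_ne_zero ha
    have heid := h.specProj_mul_specProj ha ha
    rw [if_pos rfl] at heid
    have hex : Commute (specProj (ρ t) d a) x := (hTX.symm.aeval_right _).symm
    set e := specProj (ρ t) d a
    have ht0 : (e * x).trace = 0 :=
      Matrix.trace_eq_zero_of_isNilpotent (hex.isNilpotent_mul_left hX)
    have hexex : (e * x * (e * x)).trace = 0 := by
      have : Commute (e * x) (e * x) := Commute.refl _
      exact Matrix.trace_eq_zero_of_isNilpotent
        (this.isNilpotent_mul_right (hex.isNilpotent_mul_left hX))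
    have h3 : (e * x * (e * y)).trace = (e * (x * y)).trace := by
      rw [hex.eq, mul_assoc x, ← mul_assoc e, heid, ← mul_assoc, ← hex.eq, mul_assoc]
    have h4 : (e * y * (e * x)).trace = (e * (x * y)).trace := by
      rw [Matrix.trace_mul_comm, h3]
    rw [mul_add, Matrix.trace_add, ht0, zero_add, add_mul, mul_add, mul_add, Matrix.trace_add,
      Matrix.trace_add, Matrix.trace_add, hexex, h3, h4, ← h1] at h2
    have h5 : 2 * e.trace * (e * (x * y)).trace = 0 := by linear_combination h2
    exact (mul_eq_zero.1 h5).resolve_left (mul_ne_zero two_ne_zero hetr)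
  rw [← one_mul (x * y), ← h.sum_specProj, Finset.sum_mul, Matrix.trace_sum]
  exact Finset.sum_eq_zero key

end

section
open Polynomial
variable {K : Type*} [Field K] {n : ℕ} {G : Type*} [Group G]
  (ρ : G →* Matrix (Fin n) (Fin n) K)

theorem isNilpotent_map_inv_sub_one {v : G} (hv : IsNilpotent (ρ v - 1)) :
    IsNilpotent (ρ v⁻¹ - 1) := by
  have h1 : ρ v⁻¹ - 1 = -(ρ v⁻¹ * (ρ v - 1)) := by
    rw [mul_sub, ← map_mul, inv_mul_cancel, map_one, mul_one]
    abel
  have h2 : Commute (ρ v⁻¹) (ρ v - 1) :=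
    (((Commute.refl v).inv_left).map ρ).sub_right (Commute.one_right _)
  rw [h1]
  exact (h2.isNilpotent_mul_left hv).neg

theorem nilLog_map_inv [CharZero K] {v : G} (hv : IsNilpotent (ρ v - 1)) :
    nilLog (ρ v⁻¹ - 1) = -nilLog (ρ v - 1) := by
  have hv' := isNilpotent_map_inv_sub_one ρ hv
  set B := powCurve (ρ v - 1) with hB
  set B' := powCurve (ρ v⁻¹ - 1) with hB'
  have h1 : (1 + (X : K[X]) • B) * (1 + (X : K[X]) • B') = 1 := evalMat_ext fun j => by
    rw [map_mul, evalMat_powCurve_map ρ hv, evalMat_powCurve_map ρ hv', ← map_mul, inv_pow,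
      mul_inv_cancel, map_one, map_one]
  have h2 : (X : K[X]) • (B + B' + (X : K[X]) • (B * B')) = (X : K[X]) • 0 := by
    have : 1 + (X : K[X]) • (B + B' + (X : K[X]) • (B * B')) = 1 := by
      refine Eq.trans ?_ h1
      simp only [add_mul, mul_add, one_mul, mul_one, smul_add, smul_mul_assoc, mul_smul_comm]
      abel
    rw [smul_zero]
    exact left_eq_add.1 this.symm
  have h3 := congrArg (evalMat (0 : K)) (X_smul_injective h2)
  simp only [map_add, evalMat_smul, eval_X, zero_smul, add_zero, map_zero] at h3
  rw [nilLog, nilLog, ← hB, ← hB']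
  exact eq_neg_of_add_eq_zero_right h3

/-- The span of the logarithms of the unipotent elements of a linear group. -/
noncomputable def logSpan : Submodule K (Matrix (Fin n) (Fin n) K) :=
  Submodule.span K {Y | ∃ v : G, IsNilpotent (ρ v - 1) ∧ Y = nilLog (ρ v - 1)}

theorem isConjStable_logSpan : IsConjStable ρ (logSpan ρ) := by
  intro g y hy
  have hinv : ρ g⁻¹ * ρ g = 1 := by rw [← map_mul, inv_mul_cancel, map_one]
  induction hy using Submodule.span_induction with
  | mem y hy =>
    obtain ⟨v, ⟨m, hm⟩, rfl⟩ := hy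
    have h1 : ρ (g * v * g⁻¹) - 1 = ρ g * (ρ v - 1) * ρ g⁻¹ := by
      rw [mul_sub, sub_mul, mul_one, map_mul, map_mul, ← map_mul ρ g g⁻¹, mul_inv_cancel, map_one]
    refine Submodule.subset_span ⟨g * v * g⁻¹, ⟨m, ?_⟩, ?_⟩
    · have h2 : ∀ m : ℕ, (ρ g * (ρ v - 1) * ρ g⁻¹) ^ m = ρ g * (ρ v - 1) ^ m * ρ g⁻¹ := by
        intro m
        induction m with
        | zero => simp [← map_mul]
        | succ m ih =>
          rw [pow_succ, ih, pow_succ]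
          simp only [mul_assoc]
          rw [← mul_assoc (ρ g⁻¹), hinv, one_mul]
      rw [h1, h2, hm]
      simp
    · rw [h1, nilLog_conj _ _ _ hinv]
  | zero => simp
  | add x y _ _ hx hy => rw [mul_add, add_mul]; exact add_mem hx hy
  | smul c x _ hx => rw [mul_smul_comm, smul_mul_assoc]; exact Submodule.smul_mem _ c hx

theorem commutator_mem_logSpan [CharZero K] {x y : Matrix (Fin n) (Fin n) K} (hx : x ∈ logSpan ρ)
    (hy : y ∈ logSpan ρ) : x * y - y * x ∈ logSpan ρ := by
  induction hx using Submodule.span_induction with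
  | mem x hx =>
    obtain ⟨v, hv, rfl⟩ := hx
    have hv' := isNilpotent_map_inv_sub_one ρ hv
    set B := powCurve (ρ v - 1) with hB
    set B' := powCurve (ρ v⁻¹ - 1) with hB'
    set Q := B * constMat y + constMat y * B' + (X : K[X]) • (B * constMat y * B') with hQ
    have hP : (1 + (X : K[X]) • B) * constMat y * (1 + (X : K[X]) • B') =
        constMat y + (X : K[X]) • Q := by
      simp only [hQ, add_mul, mul_add, one_mul, mul_one, smul_add, smul_mul_assoc, mul_smul_comm]
      abel
    have hmem := evalMat_mem (logSpan ρ) Q (fun j hj => by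
      have h1 := congrArg (evalMat (j : K)) hP
      rw [map_mul, map_mul, evalMat_powCurve_map ρ hv, evalMat_powCurve_map ρ hv', map_add,
        evalMat_constMat, evalMat_smul, eval_X] at h1
      have h2 : (j : K) • evalMat (j : K) Q = ρ (v ^ j) * y * ρ (v⁻¹ ^ j) - y := by
        rw [h1, add_sub_cancel_left]
      have h3 := (logSpan ρ).sub_mem (isConjStable_logSpan ρ (v ^ j) y hy) hy
      rw [← inv_pow, ← h2] at h3
      exact ((logSpan ρ).smul_mem_iff (Nat.cast_ne_zero.2 hj)).1 h3) 0
    have h0 : evalMat 0 Q = nilLog (ρ v - 1) * y + y * nilLog (ρ v⁻¹ - 1) := by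
      simp [hQ, nilLog, hB, hB']
    rwa [h0, nilLog_map_inv ρ hv, mul_neg, ← sub_eq_add_neg] at hmem
  | zero => simp
  | add x x' _ _ hx hx' =>
    rw [add_mul, mul_add, add_sub_add_comm]
    exact add_mem hx hx'
  | smul c x _ hx =>
    rw [mul_smul_comm, smul_mul_assoc, ← smul_sub]
    exact Submodule.smul_mem _ c hx

theorem sub_one_pow_mem_repSpan (v : G) (k : ℕ) : (ρ v - 1) ^ k ∈ repSpan (K := K) ρ := by
  rcases eq_or_ne k 0 with rfl | hk
  · simpa using one_mem_repSpan (K := K) ρ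
  · exact repSpan_pow_le ρ hk (Submodule.pow_mem_pow _
      (sub_mem (mem_repSpan ρ v) (one_mem_repSpan ρ)) k)

theorem logSpan_le_repSpan : logSpan ρ ≤ repSpan ρ := by
  rw [logSpan, Submodule.span_le]
  rintro _ ⟨v, -, rfl⟩
  exact nilLog_mem _ (sub_one_pow_mem_repSpan ρ v)

theorem exists_prod_conj_sub_one_eq_zero_of_trace [CharZero K] {u : G} (hu : IsNilpotent (ρ u - 1))
    (htr : ∀ v : G, IsNilpotent (ρ v - 1) → (nilLog (ρ u - 1) * nilLog (ρ v - 1)).trace = 0) :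
    ∃ N : ℕ, ∀ g : Fin N → G, (List.ofFn fun i => ρ (g i * u * (g i)⁻¹) - 1).prod = 0 := by
  let I : Submodule K (Matrix (Fin n) (Fin n) K) :=
    { carrier := {z | z ∈ logSpan ρ ∧ ∀ y ∈ logSpan ρ, (z * y).trace = 0}
      zero_mem' := ⟨zero_mem _, fun y _ => by simp⟩
      add_mem' := fun {a b} ha hb => ⟨add_mem ha.1 hb.1, fun y hy => by
        rw [add_mul, Matrix.trace_add, ha.2 y hy, hb.2 y hy, add_zero]⟩
      smul_mem' := fun c a ha => ⟨Submodule.smul_mem _ c ha.1, fun y hy => by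
        rw [smul_mul_assoc, Matrix.trace_smul, ha.2 y hy, smul_zero]⟩ }
  obtain ⟨-, s, -, hs⟩ := exists_nilLog_eq_mul hu
  refine exists_prod_conj_sub_one_eq_zero ρ I ?_ (fun x hx y hy => hx.2 y hy.1) ?_
    (fun x hx => logSpan_le_repSpan ρ hx.1) (X := nilLog (ρ u - 1)) ?_ (isNilpotent_nilLog hu)
    (b := aeval (ρ u - 1) s) ?_ hs
  · intro x hx y hy
    refine ⟨commutator_mem_logSpan ρ hx.1 hy.1, fun z hz => ?_⟩
    have h1 := hx.2 _ (commutator_mem_logSpan ρ hy.1 hz)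
    rw [mul_sub, Matrix.trace_sub] at h1
    rw [sub_mul, Matrix.trace_sub, mul_assoc x, ← h1, mul_assoc y, Matrix.trace_mul_comm y,
      mul_assoc x z y]
  · intro g z hz
    refine ⟨isConjStable_logSpan ρ g z hz.1, fun y hy => ?_⟩
    have h1 := hz.2 _ (isConjStable_logSpan ρ g⁻¹ y hy)
    rw [inv_inv] at h1
    rw [← h1, mul_assoc, mul_assoc, Matrix.trace_mul_comm]
    simp only [mul_assoc]
  · refine ⟨Submodule.subset_span ⟨u, hu, rfl⟩, fun y hy => ?_⟩
    induction hy using Submodule.span_induction with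
    | mem y hy =>
      obtain ⟨v, hv, rfl⟩ := hy
      exact htr v hv
    | zero => simp
    | add x y _ _ hx hy => rw [mul_add, Matrix.trace_add, hx, hy, add_zero]
    | smul c x _ hx => rw [mul_smul_comm, Matrix.trace_smul, hx, smul_zero]
  · rw [aeval_eq_sum_range]
    exact sum_mem fun k _ => Submodule.smul_mem _ _ (sub_one_pow_mem_repSpan ρ u k)

end

section
open Polynomial
variable {K : Type*} [Field K] [CharZero K] {n : ℕ} {G : Type*} [Group G]

/-- If every element of a linear group in characteristic zero has a Jordan decomposition inside the
group, then any additive character which is trivial on semisimple parts and nontrivial takes a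
nonzero value on an element whose conjugates generate a group of unipotent matrices. -/
theorem exists_unipotent_normal_of_character (ρ : G →* Matrix (Fin n) (Fin n) K)
    (χ : G →* Multiplicative K) (hχ : χ ≠ 1)
    (hdec : ∀ g : G, ∃ t u : G, ∃ d : Fin n → K, g = t * u ∧ IsJordanPair (ρ t) (ρ u) d ∧
      χ t = 1) :
    ∃ u : G, χ u ≠ 1 ∧
      ∃ N : ℕ, ∀ g : Fin N → G, (List.ofFn fun i => ρ (g i * u * (g i)⁻¹) - 1).prod = 0 := by
  classical
  let P : ℕ → Prop := fun k => ∃ t u : G, ∃ d : Fin n → K, IsJordanPair (ρ t) (ρ u) d ∧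
    χ t = 1 ∧ (Finset.univ.image d).card = k
  have hPn : ∀ k, P k → k ≤ n := by
    rintro k ⟨t, u, d, -, -, rfl⟩
    simpa using Finset.card_image_le (s := Finset.univ) (f := d)
  obtain ⟨m, ⟨t₀, u₀, d₀, h₀, -, hm⟩, hmax⟩ : ∃ m, P m ∧ ∀ k, P k → k ≤ m := by
    obtain ⟨t, u, d, -, hp, ht⟩ := hdec 1
    have hPk : P (Finset.univ.image d).card := ⟨t, u, d, hp, ht, rfl⟩
    exact ⟨Nat.findGreatest P n, Nat.findGreatest_spec (hPn _ hPk) hPk,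
      fun k hk => Nat.le_findGreatest (hPn _ hk) hk⟩
  obtain ⟨y, hy, hχy⟩ : ∃ y : G, IsNilpotent (ρ y - 1) ∧ χ y ≠ 1 := by
    obtain ⟨g, hg⟩ : ∃ g, χ g ≠ 1 := by
      by_contra! h
      exact hχ (MonoidHom.ext h)
    obtain ⟨t, u, d, rfl, hp, ht⟩ := hdec g
    exact ⟨u, hp.isNilpotent, by simpa [ht] using hg⟩
  let W : Matrix (Fin n) (Fin n) K[X] :=
    (1 + (X : K[X]) • powCurve (ρ y - 1)) * constMat (ρ (t₀ * u₀))
  have haev : ∀ (c : K) (q : K[X]), evalMat c (aeval W q) = aeval (evalMat c W) q := fun c q =>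
    (Polynomial.aeval_algHom_apply (evalMat c) W q).symm
  let D : Matrix (Finset.univ.image d₀) (Finset.univ.image d₀) K[X] :=
    Matrix.of fun a b => (aeval W (indicatorPoly d₀ (a : K) * indicatorPoly d₀ (b : K))).trace
  have hD : ∀ c : K, D.det.eval c = (Matrix.of fun a b : Finset.univ.image d₀ =>
      (aeval (evalMat c W)
        (indicatorPoly d₀ (a : K) * indicatorPoly d₀ (b : K))).trace).det := by
    intro c
    rw [← coe_evalRingHom, RingHom.map_det]
    congr 1
    ext a b
    simp only [D, RingHom.mapMatrix_apply, Matrix.map_apply, Matrix.of_apply, coe_evalRingHom,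
      eval_trace, haev]
  have hD0 : D.det ≠ 0 := by
    intro h
    have h1 := hD 0
    have h2 : evalMat 0 W = ρ t₀ * ρ u₀ := by simp [W]
    have h3 : (Matrix.of fun a b : Finset.univ.image d₀ => (aeval (ρ t₀ * ρ u₀)
        (indicatorPoly d₀ (a : K) * indicatorPoly d₀ (b : K))).trace) =
        Matrix.diagonal fun a : Finset.univ.image d₀ => (specProj (ρ t₀) d₀ (a : K)).trace := by
      ext a b
      rw [Matrix.of_apply, h₀.trace_aeval, ← h₀.trace_aeval_left, map_mul]
      change (specProj (ρ t₀) d₀ a * specProj (ρ t₀) d₀ b).trace = _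
      rw [h₀.specProj_mul_specProj a.2 b.2, Matrix.diagonal_apply]
      by_cases hab : a = b
      · rw [if_pos hab, if_pos (congrArg _ hab)]
      · rw [if_neg hab, if_neg (fun h => hab (Subtype.ext h)), Matrix.trace_zero]
    rw [h, eval_zero, h2, h3, Matrix.det_diagonal, eq_comm, Finset.prod_eq_zero_iff] at h1
    obtain ⟨a, -, ha⟩ := h1
    exact h₀.trace_specProj_ne_zero a.2 ha
  obtain ⟨j, hj⟩ : ∃ j : ℕ,
      (D.det * (C (χ y).toAdd * X + C (χ (t₀ * u₀)).toAdd)).eval (j : K) ≠ 0 := by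
    by_contra! h
    refine mul_ne_zero hD0 (fun h0 => ?_) (Polynomial.eq_zero_of_eval_nat fun j _ => h j)
    have h1 := congrArg (fun p : K[X] => p.coeff 1) h0
    simp only [coeff_add, coeff_C_mul, coeff_X_one, mul_one, coeff_C_of_ne_zero one_ne_zero,
      add_zero, coeff_zero] at h1
    exact hχy (toAdd_eq_zero.1 h1)
  rw [eval_mul, mul_ne_zero_iff] at hj
  obtain ⟨t, u, d, hg, hp, ht⟩ := hdec (y ^ j * (t₀ * u₀))
  have hcard : (Finset.univ.image d).card = m := by
    refine le_antisymm (hmax _ ⟨t, u, d, hp, ht, rfl⟩) ?_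
    by_contra! hlt
    apply hj.1
    have h1 := hp.det_gram_eq_zero (fun a : Finset.univ.image d₀ => indicatorPoly d₀ (a : K)) (by
      rw [Fintype.card_coe, hm]
      exact hlt)
    rw [hD, ← h1]
    have : evalMat (j : K) W = ρ t * ρ u := by
      rw [map_mul, evalMat_powCurve_map ρ hy, evalMat_constMat, ← map_mul, hg, map_mul]
    rw [this]
  refine ⟨u, ?_, exists_prod_conj_sub_one_eq_zero_of_trace ρ hp.isNilpotent fun v hv =>
    trace_nilLog_mul_nilLog_eq_zero ρ hp (fun g => ?_) hv⟩
  · intro hu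
    apply hj.2
    have h1 : χ (y ^ j * (t₀ * u₀)) = 1 := by rw [hg, map_mul, ht, hu, one_mul]
    rw [map_mul χ (y ^ j), map_pow] at h1
    have h2 := congrArg Multiplicative.toAdd h1
    rw [toAdd_mul, toAdd_pow, toAdd_one, nsmul_eq_mul] at h2
    rw [eval_add, eval_mul, eval_C, eval_X, eval_C, mul_comm]
    exact h2
  · obtain ⟨t', u', d', rfl, hp', ht'⟩ := hdec g
    exact ⟨_, _, d', hp', by rw [hcard]; exact hmax _ ⟨t', u', d', hp', ht', rfl⟩, map_mul _ _ _⟩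

end

section
variable {ι : Type*} (U : Ultrafilter ι) (F : ι → Type*) [∀ i, Field (F i)]

/-- The ideal of families of scalars which vanish along an ultrafilter. -/
def ultraIdeal : Ideal (∀ i, F i) where
  carrier := {x | ∀ᶠ i in U, x i = 0}
  zero_mem' := Filter.Eventually.of_forall fun _ => rfl
  add_mem' := fun {x y} hx hy => by
    filter_upwards [hx, hy] with i hi hj
    rw [Pi.add_apply, hi, hj, add_zero]
  smul_mem' := fun c x hx => by
    filter_upwards [hx] with i hi
    rw [smul_eq_mul, Pi.mul_apply, hi, mul_zero]

theorem mem_ultraIdeal {x : ∀ i, F i} : x ∈ ultraIdeal U F ↔ ∀ᶠ i in U, x i = 0 := Iff.rfl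

instance isMaximal_ultraIdeal : (ultraIdeal U F).IsMaximal := by
  rw [Ideal.isMaximal_iff]
  refine ⟨fun h => ?_, fun J x hJ hx hxJ => ?_⟩
  · obtain ⟨i, hi⟩ := ((mem_ultraIdeal U F).1 h).exists
    exact one_ne_zero hi
  · have h1 : 1 - x⁻¹ * x ∈ ultraIdeal U F := by
      rw [mem_ultraIdeal] at hx ⊢
      filter_upwards [Ultrafilter.eventually_not.2 hx] with i hi
      rw [Pi.sub_apply, Pi.mul_apply, Pi.inv_apply, inv_mul_cancel₀ hi, Pi.one_apply, sub_self]
    simpa using J.add_mem (hJ h1) (J.mul_mem_left x⁻¹ hxJ)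

/-- The ultraproduct of a family of fields. -/
abbrev Ultraproduct : Type _ := (∀ i, F i) ⧸ ultraIdeal U F

noncomputable instance : Field (Ultraproduct U F) := Ideal.Quotient.field _

theorem ultraproduct_mk_eq_zero_iff {x : ∀ i, F i} :
    Ideal.Quotient.mk (ultraIdeal U F) x = 0 ↔ ∀ᶠ i in U, x i = 0 :=
  Ideal.Quotient.eq_zero_iff_mem

theorem charZero_ultraproduct (h : ∀ j : ℕ, j ≠ 0 → ∀ᶠ i in U, (j : F i) ≠ 0) :
    CharZero (Ultraproduct U F) := by
  refine charZero_of_inj_zero fun j hj => ?_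
  by_contra hj0
  rw [← map_natCast (Ideal.Quotient.mk (ultraIdeal U F)), ultraproduct_mk_eq_zero_iff] at hj
  obtain ⟨i, hi, hi'⟩ := (hj.and (h j hj0)).exists
  exact hi' hi

variable {n : ℕ}

/-- The matrix over an ultraproduct of fields which is defined by a family of matrices. -/
noncomputable def ultraMat :
    (∀ i, Matrix (Fin n) (Fin n) (F i)) →+* Matrix (Fin n) (Fin n) (Ultraproduct U F) where
  toFun A := Matrix.of fun a b => Ideal.Quotient.mk (ultraIdeal U F) fun i => A i a b
  map_one' := by
    ext a b
    rw [Matrix.of_apply, Matrix.one_apply]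
    split_ifs with h
    · rw [← map_one (Ideal.Quotient.mk (ultraIdeal U F))]
      congr 1
      exact funext fun i => Matrix.one_apply.trans (if_pos h)
    · rw [← map_zero (Ideal.Quotient.mk (ultraIdeal U F))]
      congr 1
      exact funext fun i => Matrix.one_apply.trans (if_neg h)
  map_mul' A B := by
    ext a b
    rw [Matrix.of_apply, Matrix.mul_apply]
    simp only [Matrix.of_apply, ← map_mul, ← map_sum]
    congr 1
    ext i
    simp [Matrix.mul_apply]
  map_zero' := by
    ext a b
    exact map_zero (Ideal.Quotient.mk (ultraIdeal U F))
  map_add' A B := by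
    ext a b
    exact map_add (Ideal.Quotient.mk (ultraIdeal U F)) _ _

theorem ultraMat_eq_zero_iff {A : ∀ i, Matrix (Fin n) (Fin n) (F i)} :
    ultraMat U F A = 0 ↔ ∀ᶠ i in U, A i = 0 := by
  simp only [← Matrix.ext_iff, Matrix.zero_apply, Filter.eventually_all]
  exact forall_congr' fun a => forall_congr' fun b => ultraproduct_mk_eq_zero_iff U F

theorem ultraMat_diagonal (d : ∀ i, Fin n → F i) :
    ultraMat U F (fun i => Matrix.diagonal (d i)) =
      Matrix.diagonal fun a => Ideal.Quotient.mk (ultraIdeal U F) fun i => d i a := by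
  ext a b
  change Ideal.Quotient.mk (ultraIdeal U F) (fun i => Matrix.diagonal (d i) a b) = _
  by_cases h : a = b
  · subst h
    simp only [Matrix.diagonal_apply_eq]
  · simp only [Matrix.diagonal_apply_ne _ h]
    exact map_zero (Ideal.Quotient.mk (ultraIdeal U F))

theorem isJordanPair_ultraMat {T V : ∀ i, Matrix (Fin n) (Fin n) (F i)} {d : ∀ i, Fin n → F i}
    (h : ∀ i, IsJordanPair (T i) (V i) (d i)) :
    IsJordanPair (ultraMat U F T) (ultraMat U F V)
      fun a => Ideal.Quotient.mk (ultraIdeal U F) fun i => d i a where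
  commute := by
    have : Commute T V := funext fun i => (h i).commute
    exact this.map (ultraMat U F)
  exists_diagonal := by
    choose S hS using fun i => (h i).exists_diagonal
    refine ⟨Units.map (ultraMat U F).toMonoidHom (MulEquiv.piUnits.symm S), ?_⟩
    rw [← ultraMat_diagonal]
    change ultraMat U F T * ultraMat U F (fun i => S i) = ultraMat U F (fun i => S i) * _
    rw [← map_mul, ← map_mul]
    congr 1
    exact funext hS
  isNilpotent := by
    have : IsNilpotent (V - 1) :=
      ⟨n, funext fun i => Matrix.pow_eq_zero_of_isNilpotent (h i).isNilpotent⟩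
    simpa using this.map (ultraMat U F)

end

section
variable {n : ℕ}

theorem Matrix.sub_one_pow_eq {F : Type*} [Field F] {p : ℕ} [CharP F p] (hp : p.Prime)
    (A : Matrix (Fin n) (Fin n) F) (b : ℕ) :
    (A - 1) ^ p ^ b = A ^ p ^ b - 1 := by
  have := Fact.mk hp
  rcases n with _ | n
  · exact Subsingleton.elim _ _
  · rw [sub_pow_char_pow_of_commute _ _ (Commute.one_right _), one_pow]

/-- The Jordan decomposition of an element of a finite linear group in characteristic `p`. -/
theorem exists_isJordanPair {F : Type*} [Field F] [IsAlgClosed F] {p : ℕ} (hp : p.Prime)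
    [CharP F p] {G : Type*} [Group G] [Finite G] (ρ : G →* Matrix (Fin n) (Fin n) F)
    (χ : G →* Multiplicative F) (g : G) : ∃ t u : G, ∃ d : Fin n → F, g = t * u ∧
      IsJordanPair (ρ t) (ρ u) d ∧ χ t = 1 := by
  obtain ⟨b, N, hN, hg⟩ := Nat.exists_eq_pow_mul_and_not_dvd (orderOf_pos g).ne' p hp.ne_one
  have hcop : (p ^ b).Coprime N := ((Nat.Prime.coprime_iff_not_dvd hp).2 hN).pow_left b
  have hbez := Int.gcd_eq_gcd_ab (p ^ b : ℕ) N
  rw [Int.gcd_natCast_natCast, hcop, Nat.cast_one] at hbez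
  set x := Int.gcdA (p ^ b : ℕ) N
  set y := Int.gcdB (p ^ b : ℕ) N
  have hg1 : g ^ ((p ^ b : ℕ) * N : ℤ) = 1 := by
    rw [← Nat.cast_mul, zpow_natCast, ← hg, pow_orderOf_eq_one]
  have hNF : (N : F) ≠ 0 := fun h => hN ((CharP.cast_eq_zero_iff F p N).1 h)
  have ht : (g ^ ((p ^ b : ℕ) * x : ℤ)) ^ N = 1 := by
    rw [← zpow_natCast, ← zpow_mul, mul_right_comm, zpow_mul, hg1, one_zpow]
  have hu : (g ^ (N * y : ℤ)) ^ p ^ b = 1 := by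
    rw [← zpow_natCast, ← zpow_mul, mul_right_comm, mul_comm (N : ℤ), zpow_mul, hg1, one_zpow]
  have htu : Commute (g ^ ((p ^ b : ℕ) * x : ℤ)) (g ^ (N * y : ℤ)) :=
    (Commute.refl g).zpow_zpow _ _
  obtain ⟨S, d, hS⟩ := exists_simultaneous_diagonalization
    (fun _ : Unit => ρ (g ^ ((p ^ b : ℕ) * x : ℤ))) (fun _ _ => Commute.refl _) hNF
    (fun _ => by rw [← map_pow, ht, map_one])
  refine ⟨_, _, d (), ?_, ⟨htu.map ρ, ⟨S, hS ()⟩, p ^ b, ?_⟩, ?_⟩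
  · rw [← zpow_add, ← hbez, zpow_one]
  · rw [Matrix.sub_one_pow_eq hp, ← map_pow, hu, map_one, sub_self]
  · have h1 := congrArg (fun z => Multiplicative.toAdd (χ z)) ht
    simp only [map_pow, toAdd_pow, map_one, toAdd_one, nsmul_eq_mul, mul_eq_zero, hNF,
      false_or] at h1
    exact toAdd_eq_zero.1 h1

theorem exists_prod_conj_sub_one_eq_zero_of_charP {p : ℕ → ℕ} (hp : ∀ i, (p i).Prime)
    (hpi : ∀ i, i ≤ p i) {F : ℕ → Type*} [∀ i, Field (F i)] [∀ i, IsAlgClosed (F i)]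
    [∀ i, CharP (F i) (p i)] {G : ℕ → Type*} [∀ i, Group (G i)] [∀ i, Finite (G i)]
    (ρ : ∀ i, G i →* Matrix (Fin n) (Fin n) (F i)) (χ : ∀ i, G i →* Multiplicative (F i))
    (hχ : ∀ i, χ i ≠ 1) : ∃ i, ∃ u : G i, χ i u ≠ 1 ∧ ∃ N : ℕ, ∀ g : Fin N → G i,
      (List.ofFn fun j => ρ i (g j * u * (g j)⁻¹) - 1).prod = 0 := by
  let U : Ultrafilter ℕ := Filter.hyperfilter ℕ
  have : CharZero (Ultraproduct U F) := by
    refine charZero_ultraproduct U F fun j hj => ?_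
    have h1 : ∀ᶠ i in Filter.atTop, ((j : ℕ) : F i) ≠ 0 := by
      filter_upwards [Filter.eventually_gt_atTop j] with i hi h
      have h2 := (CharP.cast_eq_zero_iff (F i) (p i) j).1 h
      exact absurd (Nat.le_of_dvd (Nat.pos_of_ne_zero hj) h2) (not_le.2 (hi.trans_le (hpi i)))
    rw [← Nat.cofinite_eq_atTop] at h1
    exact Filter.hyperfilter_le_cofinite h1
  let R : (∀ i, G i) →* Matrix (Fin n) (Fin n) (Ultraproduct U F) :=
    (ultraMat U F).toMonoidHom.comp (MonoidHom.pi fun i => (ρ i).comp (Pi.evalMonoidHom _ i))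
  have hR : ∀ g, R g = ultraMat U F fun i => ρ i (g i) := fun g => rfl
  let X : (∀ i, G i) →* Multiplicative (Ultraproduct U F) :=
    { toFun := fun g => Multiplicative.ofAdd
        (Ideal.Quotient.mk (ultraIdeal U F) fun i => (χ i (g i)).toAdd)
      map_one' := by
        simp only [Pi.one_apply, map_one, toAdd_one]
        exact congrArg _ (map_zero (Ideal.Quotient.mk (ultraIdeal U F)))
      map_mul' := fun g h => by
        simp only [Pi.mul_apply, map_mul, toAdd_mul]
        exact congrArg _ (map_add (Ideal.Quotient.mk (ultraIdeal U F)) _ _) }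
  have hX : ∀ g, X g = 1 ↔ ∀ᶠ i in U, χ i (g i) = 1 := fun g =>
    (ofAdd_eq_one.trans (ultraproduct_mk_eq_zero_iff U F)).trans (by simp only [toAdd_eq_zero])
  have hX1 : X ≠ 1 := by
    have h1 : ∀ i, ∃ g, χ i g ≠ 1 := by
      intro i
      by_contra! h
      exact hχ i (MonoidHom.ext h)
    choose g hg using h1
    intro h
    obtain ⟨i, hi⟩ := ((hX g).1 (by rw [h, MonoidHom.one_apply])).exists
    exact hg i hi
  obtain ⟨u, hu, N, hN⟩ := exists_unipotent_normal_of_character R X hX1 fun g => by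
    choose t u d hg hd ht using fun i => exists_isJordanPair (hp i) (ρ i) (χ i) (g i)
    exact ⟨t, u, _, funext hg, isJordanPair_ultraMat U F hd,
      (hX t).2 (Filter.Eventually.of_forall ht)⟩
  have h1 : ∀ᶠ i in U, ∀ g : Fin N → G i,
      (List.ofFn fun j => ρ i (g j * u i * (g j)⁻¹) - 1).prod = 0 := by
    by_contra h
    rw [← Ultrafilter.eventually_not] at h
    have h2 : ∀ i, ∃ g : Fin N → G i, (∃ g : Fin N → G i,
        (List.ofFn fun j => ρ i (g j * u i * (g j)⁻¹) - 1).prod ≠ 0) →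
        (List.ofFn fun j => ρ i (g j * u i * (g j)⁻¹) - 1).prod ≠ 0 := by
      intro i
      by_cases h : ∃ g : Fin N → G i, (List.ofFn fun j => ρ i (g j * u i * (g j)⁻¹) - 1).prod ≠ 0
      · exact ⟨_, fun _ => h.choose_spec⟩
      · exact ⟨1, fun h' => absurd h' h⟩
    choose g hg using h2
    have h3 := hN fun j i => g i j
    have h4 : (List.ofFn fun j => R ((fun i => g i j) * u * (fun i => g i j)⁻¹) - 1).prod =
        ultraMat U F fun i => (List.ofFn fun j => ρ i (g i j * u i * (g i j)⁻¹) - 1).prod := by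
      have h5 : (fun i => (List.ofFn fun j => ρ i (g i j * u i * (g i j)⁻¹) - 1).prod) =
          (List.ofFn fun j => (fun i => ρ i (g i j * u i * (g i j)⁻¹) - 1 :
            ∀ i, Matrix (Fin n) (Fin n) (F i))).prod := by
        ext1 i
        rw [← Pi.evalRingHom_apply (fun i => Matrix (Fin n) (Fin n) (F i)) i (List.prod _),
          map_list_prod, List.map_ofFn]
        rfl
      rw [h5, map_list_prod, List.map_ofFn]
      congr 2
      ext1 j
      rw [hR, ← map_one (ultraMat U F), ← map_sub]
      rfl
    rw [h4, ultraMat_eq_zero_iff] at h3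
    obtain ⟨i, hi, hi'⟩ := (h.and h3).exists
    push Not at hi
    exact hg i hi hi'
  obtain ⟨i, hi, hi'⟩ := (h1.and (Ultrafilter.eventually_not.2 (mt (hX u).2 hu))).exists
  exact ⟨i, u i, hi', N, hi⟩

end

section
variable {n : ℕ} {F : Type*} [Field F] {p : ℕ}

theorem eq_one_of_prod_conj_sub_one_eq_zero [CharP F p] (hp : p.Prime) {G : Type*} [Group G]
    (hG : ∀ R : Subgroup G, R.Normal → IsPGroup p R → R = ⊥) (ρ : G →* Matrix (Fin n) (Fin n) F)
    (hρ : Function.Injective ρ) {u : G} {N : ℕ} (hu : ∀ g : Fin N → G,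
      (List.ofFn fun i => ρ (g i * u * (g i)⁻¹) - 1).prod = 0) : u = 1 := by
  let V : Submodule F (Matrix (Fin n) (Fin n) F) :=
    Submodule.span F (Set.range fun g => ρ (g * u * g⁻¹) - 1)
  have hV : IsConjStable ρ V := by
    intro g v hv
    induction hv using Submodule.span_induction with
    | mem v hv =>
      obtain ⟨h, rfl⟩ := hv
      refine Submodule.subset_span ⟨g * h, ?_⟩
      simp only
      rw [mul_sub, sub_mul, mul_one, ← map_mul, ← map_mul, ← map_mul, mul_inv_cancel, map_one]
      congr 2
      group
    | zero => simp
    | add x y _ _ hx hy => rw [mul_add, add_mul]; exact add_mem hx hy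
    | smul c x _ hx => rw [mul_smul_comm, smul_mul_assoc]; exact Submodule.smul_mem _ c hx
  have hVN : V ^ N = ⊥ := by
    rw [Submodule.span_pow, Submodule.span_eq_bot]
    intro x hx
    obtain ⟨f, rfl⟩ := Set.mem_pow.1 hx
    choose g hg using fun i => (f i).2
    rw [← hu g]
    congr 2
    exact funext fun i => (hg i).symm
  have hmem : ∀ v ∈ Subgroup.normalClosure {u}, ρ v - 1 ∈ V * repSpan ρ := by
    intro v hv
    induction hv using Subgroup.closure_induction with
    | mem v hv =>
      obtain ⟨_, rfl, hw⟩ := Group.mem_conjugatesOfSet_iff.1 hv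
      obtain ⟨g, rfl⟩ := isConj_iff.1 hw
      rw [← mul_one (_ - 1)]
      exact Submodule.mul_mem_mul (Submodule.subset_span ⟨g, rfl⟩) (one_mem_repSpan ρ)
    | one => simp
    | mul v w _ _ hv hw =>
      have h1 : ρ (v * w) - 1 = (ρ v - 1) * ρ w + (ρ w - 1) := by
        rw [map_mul, sub_mul, one_mul, sub_add_sub_cancel]
      rw [h1]
      refine add_mem ?_ hw
      have h2 := Submodule.mul_mem_mul hv (mem_repSpan (K := F) ρ w)
      rw [mul_assoc] at h2
      exact mul_le_mul' le_rfl (repSpan_mul_self_le ρ) h2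
    | inv v _ hv =>
      have h1 : ρ v⁻¹ - 1 = -((ρ v - 1) * ρ v⁻¹) := by
        rw [sub_mul, one_mul, ← map_mul, mul_inv_cancel, map_one, neg_sub]
      rw [h1]
      have h2 := Submodule.mul_mem_mul hv (mem_repSpan (K := F) ρ v⁻¹)
      rw [mul_assoc] at h2
      exact neg_mem (mul_le_mul' le_rfl (repSpan_mul_self_le ρ) h2)
  have hP : IsPGroup p (Subgroup.normalClosure {u}) := by
    rintro ⟨v, hv⟩
    refine ⟨N, Subtype.ext (hρ ?_)⟩
    have h1 := Submodule.pow_mem_pow _ (hmem v hv) N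
    rw [hV.mul_repSpan_pow_eq_bot hVN, Submodule.mem_bot] at h1
    have h2 := pow_eq_zero_of_le (Nat.lt_pow_self hp.one_lt).le h1
    rw [Matrix.sub_one_pow_eq hp, sub_eq_zero, ← map_pow] at h2
    rw [Subgroup.coe_pow, Subgroup.coe_one, h2, map_one]
  have h1 := Subgroup.subset_normalClosure (Set.mem_singleton u)
  rw [hG _ Subgroup.normalClosure_normal hP] at h1
  exact h1

/-- A finite linear group in large characteristic `p` with no nontrivial normal `p`-subgroup has no
quotient of order `p`. -/
theorem exists_forall_hom_zmod_eq_one (n : ℕ) : ∃ P : ℕ, ∀ p, P ≤ p → p.Prime →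
    ∀ (k : Type) [Field k] [CharP k p] (G : Type) [Group G] [Finite G]
      (ρ : G →* Matrix (Fin n) (Fin n) k), Function.Injective ρ →
      (∀ R : Subgroup G, R.Normal → IsPGroup p R → R = ⊥) →
      ∀ f : G →* Multiplicative (ZMod p), f = 1 := by
  by_contra! h
  choose p hPp hp k hk hkp G hG hGf ρ hρ hR f hf using h
  have hinj : ∀ i, Function.Injective
      ((algebraMap (k i) (AlgebraicClosure (k i))).mapMatrix (m := Fin n)) :=
    fun i => Matrix.map_injective (algebraMap (k i) _).injective
  have hchar : ∀ i, CharP (AlgebraicClosure (k i)) (p i) := fun i =>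
    charP_of_injective_algebraMap (algebraMap (k i) _).injective _
  let σ : ∀ i, G i →* Matrix (Fin n) (Fin n) (AlgebraicClosure (k i)) := fun i =>
    ((algebraMap (k i) (AlgebraicClosure (k i))).mapMatrix.toMonoidHom).comp (ρ i)
  have hσ : ∀ i, Function.Injective (σ i) := fun i => (hinj i).comp (hρ i)
  let χ : ∀ i, G i →* Multiplicative (AlgebraicClosure (k i)) := fun i =>
    (AddMonoidHom.toMultiplicative
      (ZMod.castHom (dvd_refl (p i)) (AlgebraicClosure (k i))).toAddMonoidHom).comp (f i)
  have hχ : ∀ i, χ i ≠ 1 := by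
    intro i h
    refine hf i (MonoidHom.ext fun g => ?_)
    have := Fact.mk (hp i)
    have h1 : ZMod.castHom (dvd_refl (p i)) (AlgebraicClosure (k i)) (f i g).toAdd = 0 :=
      congrArg Multiplicative.toAdd (DFunLike.congr_fun h g)
    rw [map_eq_zero] at h1
    exact toAdd_eq_zero.1 h1
  obtain ⟨i, u, hu, N, hN⟩ := exists_prod_conj_sub_one_eq_zero_of_charP hp hPp σ χ hχ
  exact hu (by rw [eq_one_of_prod_conj_sub_one_eq_zero (hp i) (hR i) (σ i) (hσ i) hN, map_one])

theorem pow_le_of_hom_surjective [CharP F p] (hp : p.Prime) (hn : 0 < n) {G : Type*} [Group G]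
    [Finite G] (ρ : G →* Matrix (Fin n) (Fin n) F) (hρ : Function.Injective ρ) {a : ℕ}
    (f : G →* Multiplicative (ZMod (p ^ a))) (hf : Function.Surjective f) : p ^ a ≤ p * n := by
  have := Fact.mk hp
  obtain ⟨x, ⟨b, hb⟩, hx⟩ := exists_pow_eq_one_of_surjective f hf
  have h1 : (ρ x - 1) ^ n = 0 := Matrix.pow_eq_zero_of_isNilpotent
    ⟨p ^ b, by rw [Matrix.sub_one_pow_eq hp, ← map_pow, hb, map_one, sub_self]⟩
  have h2 := pow_eq_zero_of_le (Nat.le_pow_clog hp.one_lt n) h1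
  rw [Matrix.sub_one_pow_eq hp, sub_eq_zero, ← map_pow, ← map_one ρ] at h2
  have h3 : p ^ a ∣ p ^ Nat.clog p n := by
    rw [← hx]
    exact orderOf_dvd_of_pow_eq_one (by rw [← map_pow, hρ h2, map_one])
  refine (Nat.le_of_dvd (pow_pos hp.pos _) h3).trans ?_
  rcases Nat.lt_or_ge 1 n with h | h
  · have h4 := Nat.pow_pred_clog_lt_self hp.one_lt h
    obtain ⟨c, hc⟩ := Nat.exists_eq_succ_of_ne_zero (Nat.clog_pos hp.one_lt h).ne'
    rw [hc] at h4 ⊢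
    rw [Nat.pow_succ']
    exact Nat.mul_le_mul_left _ h4.le
  · rw [Nat.clog_of_right_le_one h, pow_zero]
    exact Nat.mul_pos hp.pos hn

theorem Nat.exists_prime_pow_dvd_of_factorial_lt {B c : ℕ} (h : B.factorial < c) :
    ∃ ℓ a : ℕ, ℓ.Prime ∧ B < ℓ ^ a ∧ ℓ ^ a ∣ c := by
  by_contra! hc
  refine (Nat.le_of_dvd (Nat.factorial_pos B) ((Nat.dvd_iff_prime_pow_dvd_dvd _ _).2
    fun ℓ a hℓ hd => ?_)).not_gt h
  exact Nat.dvd_factorial (pow_pos hℓ.pos a) (not_lt.1 fun h' => hc ℓ a hℓ h' hd)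

end

/-- Lemma deduced from the Larsen–Pink classification: for all `n, c₁ > 0` there is
`c₂ > 0` such that any finite subgroup `Γ ⊆ GL_n(k)` (`k` a finite field of
characteristic `p`) with no nontrivial normal `p`-subgroup and admitting a cyclic
quotient of order at least `c₂` has a central element of order at least `c₁` and
coprime to `p`. -/
theorem larsen_pink_center
    (n c₁ : ℕ) (hn : 0 < n) (hc₁ : 0 < c₁) :
    ∃ c₂ : ℕ, 0 < c₂ ∧
      ∀ (p : ℕ), p.Prime →
        ∀ (k : Type) [Field k] [Fintype k], CharP k p →
          ∀ Γ : Subgroup ((Matrix (Fin n) (Fin n) k)ˣ),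
            (¬ ∃ Nsub : Subgroup ↥Γ, Nsub.Normal ∧ ∃ a : ℕ, 0 < a ∧ Nat.card Nsub = p ^ a) →
            (∃ c : ℕ, c₂ ≤ c ∧ ∃ f : ↥Γ →* Multiplicative (ZMod c), Function.Surjective f) →
            ∃ z ∈ Subgroup.center ↥Γ, c₁ ≤ orderOf z ∧ (orderOf z).Coprime p := by
  obtain ⟨P, hP⟩ := exists_forall_hom_zmod_eq_one n
  let B := rigidityLoss n * c₁ + P * n + 1
  refine ⟨B.factorial + 1, Nat.succ_pos _, fun p hp k _ _ _ Γ hΓ => ?_⟩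
  rintro ⟨c, hc, f, hf⟩
  have := Fact.mk hp
  let F := AlgebraicClosure k
  have : CharP F p := charP_of_injective_algebraMap (algebraMap k F).injective p
  let ρ : Γ →* Matrix (Fin n) (Fin n) k := (Units.coeHom _).comp Γ.subtype
  have hρ : Function.Injective ρ := Units.val_injective.comp Subtype.val_injective
  let σ : Γ →* Matrix (Fin n) (Fin n) F := (algebraMap k F).mapMatrix.toMonoidHom.comp ρ
  have hσ : Function.Injective σ :=
    (Matrix.map_injective (algebraMap k F).injective).comp hρ
  have hG : ∀ R : Subgroup Γ, R.Normal → IsPGroup p R → R = ⊥ := by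
    intro R hR hRp
    obtain ⟨a, ha⟩ := IsPGroup.iff_card.1 hRp
    rcases Nat.eq_zero_or_pos a with rfl | ha0
    · exact Subgroup.card_eq_one.1 (by rw [ha, pow_zero])
    · exact absurd ⟨R, hR, a, ha0, ha⟩ hΓ
  obtain ⟨ℓ, a, hℓ, hBa, hd⟩ := Nat.exists_prime_pow_dvd_of_factorial_lt (Nat.lt_of_succ_le hc)
  let red : ∀ {m m' : ℕ}, m ∣ m' → Multiplicative (ZMod m') →* Multiplicative (ZMod m) :=
    fun {m m'} h => AddMonoidHom.toMultiplicative (ZMod.castHom h (ZMod m)).toAddMonoidHom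
  have hred : ∀ {m m' : ℕ} (h : m ∣ m'), Function.Surjective (red h) :=
    fun {m m'} h => ZMod.castHom_surjective h
  let f' := (red hd).comp f
  have hf' : Function.Surjective f' := (hred hd).comp hf
  by_cases hℓp : ℓ = p
  · subst hℓp
    have h1 := pow_le_of_hom_surjective hp hn ρ hρ f' hf'
    have h2 : P ≤ ℓ := by
      refine Nat.le_of_mul_le_mul_right ?_ hn
      have : P * n ≤ B := by omega
      exact this.trans (hBa.le.trans h1)
    have ha : a ≠ 0 := by
      rintro rfl
      rw [pow_zero] at hBa
      omega
    have h3 := hP ℓ h2 hp k Γ ρ hρ hG ((red (dvd_pow_self ℓ ha)).comp f')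
    obtain ⟨x, hx⟩ := ((hred (dvd_pow_self ℓ ha)).comp hf') (Multiplicative.ofAdd 1)
    have h4 : (Multiplicative.ofAdd (1 : ZMod ℓ)) = 1 := by
      rw [← hx]
      exact DFunLike.congr_fun h3 x
    exact absurd (ofAdd_eq_one.1 h4) one_ne_zero
  · obtain ⟨z, hz, hza, hzp⟩ := exists_mem_center_of_surjective σ hσ
      (isLinearLike_of_injective hp σ hσ) hp hℓ hℓp hG f' hf'
    refine ⟨z, hz, ?_, hzp⟩
    by_contra! hlt
    have h1 := Nat.mul_le_mul_left (rigidityLoss n) hlt.le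
    omega
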